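/- Geometric runs for the square-lattice spanning tree trunk: for every integer k ≥ 0, the ratio (number of spanning trees T of G_n whose trunk contains every one of the edges e₀, e₁, …, e_k) / (number of spanning trees T of G_n whose trunk contains e₀) converges to (√2 − 1)^k as n → ∞. -/

import Mathlib

/-- Vertex type for the wired grid graphs: lattice points together with the two extra
vertices `L = Sum.inr false` and `R = Sum.inr true`. -/
abbrev GridV : Type := (ℤ × ℤ) ⊕ Bool

/-- The left wired vertex `L`. -/
def Lv : GridV := Sum.inr false

/-- The right wired vertex `R`. -/
def Rv : GridV := Sum.inr true

/-- The adjacency generator of the graph `G_n`: two lattice points of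
`{-n,…,n} × {-n,…,n}` are related when at Euclidean distance `1`; `L` is related to
every vertex `(-n, y)` and `R` to every vertex `(n, y)` with `|y| ≤ n`. -/
def gridRel (n : ℕ) : GridV → GridV → Prop
  | Sum.inl p, Sum.inl q =>
      |p.1| ≤ (n : ℤ) ∧ |p.2| ≤ (n : ℤ) ∧ |q.1| ≤ (n : ℤ) ∧ |q.2| ≤ (n : ℤ) ∧
        (p.1 - q.1) ^ 2 + (p.2 - q.2) ^ 2 = 1
  | Sum.inr b, Sum.inl p =>
      |p.2| ≤ (n : ℤ) ∧ ((b = false ∧ p.1 = -(n : ℤ)) ∨ (b = true ∧ p.1 = (n : ℤ)))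
  | _, _ => False

/-- The graph `G_n`: the `{-n,…,n} × {-n,…,n}` grid with wired left and right
boundaries `L` and `R`. -/
def gridGraph (n : ℕ) : SimpleGraph GridV := SimpleGraph.fromRel (gridRel n)

/-- The vertex set of `G_n`: the lattice points of `{-n,…,n} × {-n,…,n}` together
with `L` and `R`. -/
def gridVerts (n : ℕ) : Set GridV :=
  {v | ∃ p : ℤ × ℤ, v = Sum.inl p ∧ |p.1| ≤ (n : ℤ) ∧ |p.2| ≤ (n : ℤ)} ∪ {Lv, Rv}

/-- `T` is a spanning tree of `G_n`: a subgraph whose vertex set is all of `G_n`'s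
vertex set and which is a tree. -/
def IsSpanningTree (n : ℕ) (T : (gridGraph n).Subgraph) : Prop :=
  T.verts = gridVerts n ∧ T.coe.IsTree

/-- The horizontal edge `e_j = {(j,0), (j+1,0)}`. -/
def hEdge (j : ℕ) : Sym2 GridV := s(Sum.inl ((j : ℤ), 0), Sum.inl ((j : ℤ) + 1, 0))

/-- The trunk of a spanning tree `T` (the unique path in `T` from `L` to `R`)
contains the edge `e`: equivalently, `e` is an edge of `T` whose removal disconnects
`L` from `R`. -/
def TrunkContains (n : ℕ) (T : (gridGraph n).Subgraph) (e : Sym2 GridV) : Prop :=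
  e ∈ T.edgeSet ∧ ¬ (T.deleteEdges {e}).spanningCoe.Reachable Lv Rv

namespace TrunkRuns

section FunctionalGraphs

variable {W : Type*}

/-- The orbit of `v` under `g` meets `S` for the first time after `m` steps, at `e`. -/
def HitsAt (g : W → W) (S : Finset W) (v : W) (m : ℕ) (e : W) : Prop :=
  (∀ i < m, g^[i] v ∉ S) ∧ g^[m] v = e ∧ e ∈ S

/-- The product of the edge signs `s` along the first `m` steps of the orbit of `v`. -/
def holonomy (s : W → W → ℝ) (g : W → W) (v : W) (m : ℕ) : ℝ :=
  ∏ i ∈ Finset.range m, s (g^[i] v) (g^[i + 1] v)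

lemma holonomy_succ' (s : W → W → ℝ) (g : W → W) (v : W) (m : ℕ) :
    holonomy s g v (m + 1) = s v (g v) * holonomy s g (g v) m := by
  simp only [holonomy, Finset.prod_range_succ', Function.iterate_succ_apply,
    Function.iterate_zero_apply]
  ring

lemma holonomy_eq_or {s : W → W → ℝ} (hs : ∀ u v, s u v = 1 ∨ s u v = -1) (g : W → W) (v : W)
    (m : ℕ) : holonomy s g v m = 1 ∨ holonomy s g v m = -1 := by
  induction m generalizing v with
  | zero => simp [holonomy]
  | succ m ih =>
    rw [holonomy_succ']
    rcases hs v (g v) with h | h <;> rcases ih (g v) with h' | h' <;> rw [h, h'] <;> norm_num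

lemma exists_hitsAt {g : W → W} {S : Finset W} {v : W} (h : ∃ m, g^[m] v ∈ S) :
    ∃ m e, HitsAt g S v m e := by
  classical
  exact ⟨Nat.find h, _, fun i hi => Nat.find_min h hi, rfl, Nat.find_spec h⟩

lemma exists_cycle_of_not_hits [Finite W] {g : W → W} {S : Finset W} {v : W}
    (h : ∀ m, g^[m] v ∉ S) :
    ∃ a, (∀ i, g^[i] (g^[a] v) ∉ S) ∧ 0 < Function.minimalPeriod g (g^[a] v) := by
  obtain ⟨i, j, hij, he⟩ := Finite.exists_ne_map_eq_of_infinite (fun m : ℕ => g^[m] v)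
  wlog hlt : i < j generalizing i j
  · exact this j i hij.symm he.symm (by omega)
  refine ⟨i, fun k => ?_, ?_⟩
  · rw [← Function.iterate_add_apply]; exact h _
  · apply Function.IsPeriodicPt.minimalPeriod_pos (n := j - i) (by omega)
    change g^[j - i] (g^[i] v) = _
    rw [← Function.iterate_add_apply, Nat.sub_add_cancel hlt.le]
    exact he.symm

/-- Every orbit of `g` meets `S`, and the orbits of `l` and `r` meet `S` first at the two
distinct points `a` and `b`, in some order. -/
def IsLinked (g : W → W) (S : Finset W) (a b l r : W) : Prop :=
  (∀ v, ∃ m, g^[m] v ∈ S) ∧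
    ((∃ m m', HitsAt g S l m a ∧ HitsAt g S r m' b) ∨
      ∃ m m', HitsAt g S l m b ∧ HitsAt g S r m' a)

lemma HitsAt.unique {g : W → W} {S : Finset W} {v e e' : W} {m m' : ℕ} (h : HitsAt g S v m e)
    (h' : HitsAt g S v m' e') : m = m' ∧ e = e' := by
  have : m = m' := by
    rcases lt_trichotomy m m' with h1 | h1 | h1
    · exact absurd (h.2.1 ▸ h.2.2) (h'.1 m h1)
    · exact h1
    · exact absurd (h'.2.1 ▸ h'.2.2) (h.1 m' h1)
  subst this
  exact ⟨rfl, h.2.1.symm.trans h'.2.1⟩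

variable [DecidableEq W] [Fintype W]

/-- The row of the signed functional graph of `g` at `v`. -/
def stepRow (s : W → W → ℝ) (g : W → W) (v : W) : W → ℝ :=
  Pi.single v 1 - s v (g v) • Pi.single (g v) 1

lemma det_updateRow_step {s : W → W → ℝ} {g : W → W} {K : Matrix W W ℝ} {i v : W}
    (hK : K v = stepRow s g v) (hiv : v ≠ i) :
    (K.updateRow i (Pi.single v 1)).det = s v (g v) * (K.updateRow i (Pi.single (g v) 1)).det := by
  have h : (Pi.single v 1 : W → ℝ) = s v (g v) • Pi.single (g v) 1 + K v := by
    rw [hK, stepRow]; abel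
  rw [h, Matrix.det_updateRow_add, Matrix.det_updateRow_smul,
    Matrix.det_updateRow_eq_zero hiv, add_zero]

lemma det_updateRow_orbit {s : W → W → ℝ} {g : W → W} {K : Matrix W W ℝ} {i : W} (m : ℕ) (v : W)
    (hK : ∀ j < m, K (g^[j] v) = stepRow s g (g^[j] v) ∧ g^[j] v ≠ i) :
    (K.updateRow i (Pi.single v 1)).det =
      holonomy s g v m * (K.updateRow i (Pi.single (g^[m] v) 1)).det := by
  induction m generalizing v with
  | zero => simp [holonomy]
  | succ m ih =>
    have h0 : K v = stepRow s g v ∧ v ≠ i := hK 0 (by omega)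
    rw [det_updateRow_step h0.1 h0.2, ih (g v), holonomy_succ', Function.iterate_succ_apply,
      mul_assoc]
    intro j hj
    exact hK (j + 1) (by omega)

lemma det_eq_zero_of_cycle {s : W → W → ℝ} {g : W → W} {K : Matrix W W ℝ} {c : W}
    (hK : ∀ j, K (g^[j] c) = stepRow s g (g^[j] c))
    (hp : 0 < Function.minimalPeriod g c)
    (hol : holonomy s g c (Function.minimalPeriod g c) = 1) : K.det = 0 := by
  obtain ⟨p, hpe⟩ : ∃ p, Function.minimalPeriod g c = p + 1 :=
    ⟨_, (Nat.succ_pred_eq_of_pos hp).symm⟩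
  have hc : g^[p] (g c) = c := by
    rw [← Function.iterate_succ_apply]
    have := Function.iterate_minimalPeriod (f := g) (x := c)
    rwa [hpe] at this
  have h1 : K.det = (K.updateRow c (Pi.single c 1 + (-s c (g c)) • Pi.single (g c) 1)).det := by
    conv_lhs => rw [← Matrix.updateRow_eq_self K c]
    congr 2
    rw [show K c = _ from hK 0]
    simp [stepRow, sub_eq_add_neg]
  have h2 := det_updateRow_orbit (s := s) (g := g) (K := K) (i := c) p (g c) (by
    intro j hj
    rw [← Function.iterate_succ_apply]
    refine ⟨hK (j + 1), fun h => ?_⟩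
    have : Function.IsPeriodicPt g (j + 1) c := h
    have := this.minimalPeriod_le (by omega)
    omega)
  rw [hpe, holonomy_succ'] at hol
  rw [h1, Matrix.det_updateRow_add, Matrix.det_updateRow_smul, h2, hc]
  linear_combination -(K.updateRow c (Pi.single c 1)).det * hol

lemma det_eq_zero_of_not_hits {s : W → W → ℝ} (hs : ∀ u v, s u v = 1 ∨ s u v = -1) {g : W → W}
    {S : Finset W} {K : Matrix W W ℝ} (hK : ∀ v ∉ S, K v = stepRow s g v) {i l : W} (hi : i ∈ S)
    (hil : K i = Pi.single l 1) (hl : ∀ m, g^[m] l ∉ S) : K.det = 0 := by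
  obtain ⟨a, haS, hp⟩ := exists_cycle_of_not_hits hl
  set c := g^[a] l
  rcases holonomy_eq_or hs g c (Function.minimalPeriod g c) with h | h
  · exact det_eq_zero_of_cycle (fun j => hK _ (haS j)) hp h
  · have h1 : K.det = (K.updateRow i (Pi.single l 1)).det := by rw [← hil, Matrix.updateRow_eq_self]
    have ne : ∀ v, v ∉ S → v ≠ i := fun v hv h => hv (h ▸ hi)
    rw [h1, det_updateRow_orbit a l (fun j _ => ⟨hK _ (hl j), ne _ (hl j)⟩)]
    have h2 := det_updateRow_orbit (s := s) (g := g) (K := K) (i := i)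
      (Function.minimalPeriod g c) c (fun j _ => ⟨hK _ (haS j), ne _ (haS j)⟩)
    rw [h, Function.iterate_minimalPeriod] at h2
    have : (K.updateRow i (Pi.single c 1)).det = 0 := by linarith
    rw [this, mul_zero]

lemma det_eq_one_of_acyclic {s : W → W → ℝ} {g : W → W}
    {S : Finset W} {K : Matrix W W ℝ} (hK : ∀ v ∉ S, K v = stepRow s g v)
    (hKS : ∀ v ∈ S, K v = Pi.single v 1) (hg : ∀ v, ∃ m, g^[m] v ∈ S) : K.det = 1 := by
  classical
  let τ : W → ℕ := fun v => Nat.find (hg v)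
  have hτ : ∀ v ∉ S, τ (g v) < τ v := by
    intro v hv
    have hpos : 0 < τ v := by
      rw [Nat.pos_iff_ne_zero]
      intro h0
      have := Nat.find_spec (hg v)
      rw [show Nat.find (hg v) = 0 from h0] at this
      exact hv this
    have : τ (g v) ≤ τ v - 1 := by
      apply Nat.find_min'
      rw [← Function.iterate_succ_apply, Nat.succ_eq_add_one, Nat.sub_add_cancel hpos]
      exact Nat.find_spec (hg v)
    omega
  have hent : ∀ v w, v ≠ w → K v w ≠ 0 → τ w < τ v := by
    intro v w hvw h
    by_cases hv : v ∈ S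
    · rw [hKS v hv] at h
      simp [Ne.symm hvw] at h
    · rw [hK v hv] at h
      by_cases hw : w = g v
      · rw [hw]; exact hτ v hv
      · simp [stepRow, Ne.symm hvw, hw] at h
  have hdiag : ∀ v, K v v = 1 := by
    intro v
    by_cases hv : v ∈ S
    · rw [hKS v hv]; simp
    · rw [hK v hv]
      have : v ≠ g v := fun h => by have := hτ v hv; rw [← h] at this; omega
      simp [stepRow, this]
  have hB : Matrix.BlockTriangular K.transpose τ := by
    intro i j hij
    by_contra h
    have := hent j i (fun e => by rw [e] at hij; exact lt_irrefl _ hij) h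
    omega
  rw [← Matrix.det_transpose, hB.det]
  apply Finset.prod_eq_one
  intro a _
  have : K.transpose.toSquareBlock τ a = 1 := by
    ext ⟨i, hi⟩ ⟨j, hj⟩
    by_cases hij : i = j
    · subst hij
      simp [Matrix.toSquareBlock, Matrix.toSquareBlockProp, hdiag]
    · rw [Matrix.one_apply_ne (by simpa using hij)]
      by_contra h
      have := hent j i (Ne.symm hij) h
      omega
  rw [this, Matrix.det_one]

open Classical in
/-- The determinant of a signed functional graph with two rerouted rows detects linkedness, when
the signs satisfy the planarity relations. -/
lemma det_eq_ite_isLinked {s : W → W → ℝ} (hs : ∀ u v, s u v = 1 ∨ s u v = -1) {g : W → W}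
    {S : Finset W} {K : Matrix W W ℝ} {a b l r : W} (hab : a ≠ b) (ha : a ∈ S) (hb : b ∈ S)
    (hK : ∀ v ∉ S, K v = stepRow s g v)
    (hKS : ∀ v ∈ S, v ≠ a → v ≠ b → K v = Pi.single v 1)
    (hKa : K a = Pi.single l 1) (hKb : K b = Pi.single r 1)
    (hdir : ∀ m m', HitsAt g S l m a → HitsAt g S r m' b →
      holonomy s g l m * holonomy s g r m' = 1 ∧
      ∀ c, (∀ i, g^[i] c ∉ S) → 0 < Function.minimalPeriod g c →
        holonomy s g c (Function.minimalPeriod g c) = 1)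
    (hswap : ∀ m m', HitsAt g S l m b → HitsAt g S r m' a →
      holonomy s g l m * holonomy s g r m' = -1 ∧
      ∀ c, (∀ i, g^[i] c ∉ S) → 0 < Function.minimalPeriod g c →
        holonomy s g c (Function.minimalPeriod g c) = 1) :
    K.det = if IsLinked g S a b l r then 1 else 0 := by
  by_cases hl : ∃ m, g^[m] l ∈ S
  swap
  · rw [if_neg fun h => hl (h.1 l)]
    exact det_eq_zero_of_not_hits hs hK ha hKa (by simpa using hl)
  by_cases hr : ∃ m, g^[m] r ∈ S
  swap
  · rw [if_neg fun h => hr (h.1 r)]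
    exact det_eq_zero_of_not_hits hs hK hb hKb (by simpa using hr)
  obtain ⟨m, e, hle⟩ := exists_hitsAt hl
  obtain ⟨m', f, hrf⟩ := exists_hitsAt hr
  have ne : ∀ v i, v ∉ S → i ∈ S → v ≠ i := fun v i hv hi h => hv (h ▸ hi)
  set K' := K.updateRow a (Pi.single e 1) with hK'
  set K₁ := K'.updateRow b (Pi.single f 1) with hK₁
  have hdet : K.det = holonomy s g l m * holonomy s g r m' * K₁.det := by
    have h1 : K.det = (K.updateRow a (Pi.single l 1)).det := by
      rw [← hKa, Matrix.updateRow_eq_self]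
    have h2 : K'.det = (K'.updateRow b (Pi.single r 1)).det := by
      rw [← hKb, ← Matrix.updateRow_ne (M := K) (b := Pi.single e 1) hab.symm,
        Matrix.updateRow_eq_self]
    rw [h1, det_updateRow_orbit m l fun j hj => ⟨hK _ (hle.1 j hj), ne _ _ (hle.1 j hj) ha⟩,
      hle.2.1, ← hK', h2, det_updateRow_orbit m' r fun j hj =>
        ⟨by rw [hK', Matrix.updateRow_ne (ne _ _ (hrf.1 j hj) ha), hK _ (hrf.1 j hj)],
          ne _ _ (hrf.1 j hj) hb⟩, hrf.2.1, ← hK₁, mul_assoc]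
  have hK₁a : K₁ a = Pi.single e 1 := by
    rw [hK₁, Matrix.updateRow_ne hab, hK', Matrix.updateRow_self]
  have hK₁b : K₁ b = Pi.single f 1 := by rw [hK₁, Matrix.updateRow_self]
  have hK₁o : ∀ v, v ≠ a → v ≠ b → K₁ v = K v := fun v hva hvb => by
    rw [hK₁, Matrix.updateRow_ne hvb, hK', Matrix.updateRow_ne hva]
  have hK₁n : ∀ v ∉ S, K₁ v = stepRow s g v := fun v hv => by
    rw [hK₁o v (ne _ _ hv ha) (ne _ _ hv hb), hK v hv]
  by_cases hcase : (e = a ∧ f = b) ∨ (e = b ∧ f = a)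
  swap
  · have h0 : K₁.det = 0 := by
      by_cases hef : e = f
      · exact Matrix.det_zero_of_row_eq hab (by rw [hK₁a, hK₁b, hef])
      by_cases he : e ≠ a ∧ e ≠ b
      · exact Matrix.det_zero_of_row_eq he.1
          (by rw [hK₁a, hK₁o e he.1 he.2, hKS e hle.2.2 he.1 he.2])
      by_cases hf : f ≠ a ∧ f ≠ b
      · exact Matrix.det_zero_of_row_eq hf.2
          (by rw [hK₁b, hK₁o f hf.1 hf.2, hKS f hrf.2.2 hf.1 hf.2])
      exfalso
      grind
    rw [hdet, h0, mul_zero, if_neg]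
    rintro ⟨-, ⟨p, q, h1, h2⟩ | ⟨p, q, h1, h2⟩⟩
    · exact hcase (Or.inl ⟨(hle.unique h1).2, (hrf.unique h2).2⟩)
    · exact hcase (Or.inr ⟨(hle.unique h1).2, (hrf.unique h2).2⟩)
  have hcyc : ∀ c, (∀ i, g^[i] c ∉ S) → 0 < Function.minimalPeriod g c →
        holonomy s g c (Function.minimalPeriod g c) = 1 := by
    rcases hcase with ⟨rfl, rfl⟩ | ⟨rfl, rfl⟩
    · exact (hdir m m' hle hrf).2
    · exact (hswap m m' hle hrf).2
  by_cases hall : ∀ v, ∃ m, g^[m] v ∈ S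
  swap
  · rw [if_neg fun h => hall h.1]
    push Not at hall
    obtain ⟨v, hv⟩ := hall
    obtain ⟨q, hq, hp⟩ := exists_cycle_of_not_hits hv
    exact det_eq_zero_of_cycle (fun j => hK _ (hq j)) hp (hcyc _ hq hp)
  rcases hcase with ⟨rfl, rfl⟩ | ⟨rfl, rfl⟩
  · rw [if_pos ⟨hall, Or.inl ⟨m, m', hle, hrf⟩⟩, hdet, (hdir m m' hle hrf).1, one_mul]
    refine det_eq_one_of_acyclic hK₁n (fun v hv => ?_) hall
    by_cases hva : v = e
    · rw [hva, hK₁a]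
    by_cases hvb : v = f
    · rw [hvb, hK₁b]
    rw [hK₁o v hva hvb, hKS v hv hva hvb]
  · rw [if_pos ⟨hall, Or.inr ⟨m, m', hle, hrf⟩⟩, hdet, (hswap m m' hle hrf).1]
    have h1 : (K₁.submatrix (Equiv.swap f e) id).det = 1 := by
      refine det_eq_one_of_acyclic (s := s) (g := g) (S := S) (fun v hv => ?_) (fun v hv => ?_) hall
      · rw [← hK₁n v hv]
        ext w
        rw [Matrix.submatrix_apply, Equiv.swap_apply_of_ne_of_ne (ne _ _ hv ha) (ne _ _ hv hb)]
        rfl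
      · have hrow : K₁.submatrix (Equiv.swap f e) id v = K₁ (Equiv.swap f e v) := rfl
        rw [hrow]
        by_cases hva : v = f
        · rw [hva, Equiv.swap_apply_left, hK₁b]
        by_cases hvb : v = e
        · rw [hvb, Equiv.swap_apply_right, hK₁a]
        rw [Equiv.swap_apply_of_ne_of_ne hva hvb, hK₁o v hva hvb, hKS v hv hva hvb]
    rw [Matrix.det_permute, Equiv.Perm.sign_swap hab] at h1
    push_cast at h1
    linarith

end FunctionalGraphs

section Planarity

/-- Two points of `ℤ × ℤ` are nearest neighbours. -/
def NN (u w : ℤ × ℤ) : Prop :=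
  (u.2 = w.2 ∧ (w.1 = u.1 + 1 ∨ u.1 = w.1 + 1)) ∨ (u.1 = w.1 ∧ (w.2 = u.2 + 1 ∨ u.2 = w.2 + 1))

/-- The sign `-1` for steps between columns `x` and `x + 1` at a height exceeding `y`. -/
def zip (x y : ℤ) (u w : ℤ × ℤ) : ℝ :=
  if u.2 = w.2 ∧ y < u.2 ∧ ((u.1 = x ∧ w.1 = x + 1) ∨ (u.1 = x + 1 ∧ w.1 = x)) then -1 else 1

/-- The product of `f` along the first `m` steps of `p`. -/
def chainProd (f : ℤ × ℤ → ℤ × ℤ → ℝ) (p : ℕ → ℤ × ℤ) (m : ℕ) : ℝ :=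
  ∏ i ∈ Finset.range m, f (p i) (p (i + 1))

lemma chainProd_eq_of_telescope {f : ℤ × ℤ → ℤ × ℤ → ℝ} {r : ℤ × ℤ → ℝ} {p : ℕ → ℤ × ℤ} {m : ℕ}
    (hr : ∀ v, r v * r v = 1) (h : ∀ i < m, f (p i) (p (i + 1)) = r (p i) * r (p (i + 1))) :
    chainProd f p m = r (p 0) * r (p m) := by
  induction m with
  | zero => simp [chainProd, hr]
  | succ m ih =>
    have := ih fun i hi => h i (by omega)
    rw [chainProd] at this ⊢
    rw [Finset.prod_range_succ, this, h m (by omega)]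
    linear_combination (r (p 0) * r (p (m + 1))) * hr (p m)

lemma chainProd_eq_one {f : ℤ × ℤ → ℤ × ℤ → ℝ} {p : ℕ → ℤ × ℤ} {m : ℕ}
    (h : ∀ i < m, f (p i) (p (i + 1)) = 1) : chainProd f p m = 1 :=
  Finset.prod_eq_one fun i hi => h i (Finset.mem_range.1 hi)

lemma chainProd_mul (f f' : ℤ × ℤ → ℤ × ℤ → ℝ) (p : ℕ → ℤ × ℤ) (m : ℕ) :
    chainProd f p m * chainProd f' p m = chainProd (fun u w => f u w * f' u w) p m :=
  Finset.prod_mul_distrib.symm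

lemma chainProd_zip_sq (x y : ℤ) (p : ℕ → ℤ × ℤ) (m : ℕ) :
    chainProd (zip x y) p m * chainProd (zip x y) p m = 1 := by
  rw [chainProd_mul]
  apply chainProd_eq_one
  intro i _
  unfold zip
  split_ifs <;> norm_num

/-- The indicator sign of the open vertical ray above `(x, y)`. -/
def raySign (x y : ℤ) (v : ℤ × ℤ) : ℝ := if v.1 = x ∧ y < v.2 then -1 else 1

/-- Moving the zipper across a column not met by the chain at `(x, y)`. -/
lemma chainProd_zip_mul_zip {p : ℕ → ℤ × ℤ} {m : ℕ} (hp : ∀ i < m, NN (p i) (p (i + 1))) {x y : ℤ}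
    (hv : ∀ i ≤ m, p i ≠ (x, y)) :
    chainProd (zip (x - 1) y) p m * chainProd (zip x y) p m =
      raySign x y (p 0) * raySign x y (p m) := by
  rw [chainProd_mul]
  apply chainProd_eq_of_telescope
  · intro v; unfold raySign; split_ifs <;> norm_num
  · intro i hi
    have h1 := hp i hi
    have h2 := hv i hi.le
    have h3 := hv (i + 1) hi
    generalize p i = u at *
    generalize p (i + 1) = w at *
    obtain ⟨a, b⟩ := u
    obtain ⟨c, d⟩ := w
    simp only [NN, zip, raySign, ne_eq, Prod.mk.injEq, not_and] at *
    split_ifs <;> first | (exfalso; omega) | norm_num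

/-- Moving the zipper vertically past a point not met by the chain. -/
lemma chainProd_zip_succ {p : ℕ → ℤ × ℤ} {m : ℕ} {x y : ℤ}
    (hv : ∀ i ≤ m, p i ≠ (x, y + 1)) :
    chainProd (zip (x - 1) y) p m = chainProd (zip (x - 1) (y + 1)) p m := by
  apply Finset.prod_congr rfl
  intro i hi
  have hi := Finset.mem_range.1 hi
  have h2 := hv i hi.le
  have h3 := hv (i + 1) hi
  generalize p i = u at *
  generalize p (i + 1) = w at *
  obtain ⟨a, b⟩ := u
  obtain ⟨c, d⟩ := w
  simp only [zip, ne_eq, Prod.mk.injEq, not_and] at *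
  congr 1
  rw [eq_iff_iff]
  omega

/-- The number of crossings, up to parity, of the ray left of the point `v`. -/
def crossSign (p : ℕ → ℤ × ℤ) (m : ℕ) (v : ℤ × ℤ) : ℝ := chainProd (zip (v.1 - 1) v.2) p m

lemma crossSign_mul_self (p : ℕ → ℤ × ℤ) (m : ℕ) (v : ℤ × ℤ) :
    crossSign p m v * crossSign p m v = 1 := chainProd_zip_sq _ _ _ _

/-- The change of `crossSign` along a step from `u` to `w` avoiding the chain. -/
lemma crossSign_mul_of_nn {p : ℕ → ℤ × ℤ} {m : ℕ} (hp : ∀ i < m, NN (p i) (p (i + 1)))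
    {u w : ℤ × ℤ} (huw : NN u w) (hu : ∀ i ≤ m, p i ≠ u) (hw : ∀ i ≤ m, p i ≠ w) :
    crossSign p m u * crossSign p m w =
      if u.1 = w.1 then 1 else
        raySign (min u.1 w.1) u.2 (p 0) * raySign (min u.1 w.1) u.2 (p m) := by
  obtain ⟨a, b⟩ := u
  obtain ⟨c, d⟩ := w
  simp only [NN] at huw
  rcases huw with ⟨rfl, rfl | rfl⟩ | ⟨rfl, rfl | rfl⟩
  · rw [if_neg (by simp)]
    have := chainProd_zip_mul_zip hp hu
    simp only [crossSign]
    rw [add_sub_cancel_right, this]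
    simp
  · rw [if_neg (by simp)]
    have := chainProd_zip_mul_zip hp hw
    simp only [crossSign]
    rw [add_sub_cancel_right, mul_comm, this]
    simp
  · simp only [if_true]
    have := chainProd_zip_succ hw
    simp only [crossSign]
    rw [this, chainProd_zip_sq]
  · simp only [if_true]
    have := chainProd_zip_succ hu
    simp only [crossSign]
    rw [this, chainProd_zip_sq]

lemma crossSign_end_mul {p q : ℕ → ℤ × ℤ} {m m' : ℕ} (f : ℤ × ℤ → ℤ × ℤ → ℝ)
    (h : ∀ i < m', crossSign p m (q i) * crossSign p m (q (i + 1)) = f (q i) (q (i + 1))) :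
    crossSign p m (q 0) * crossSign p m (q m') = chainProd f q m' := by
  symm
  apply chainProd_eq_of_telescope (r := crossSign p m)
  · exact crossSign_mul_self p m
  · intro i hi; exact (h i hi).symm

/-- A closed chain inside the strip which avoids a chain running from the boundary of the strip
to the origin has trivial zipper sign. -/
lemma chainProd_zip_closed {c p : ℕ → ℤ × ℤ} {m l : ℕ} {N : ℤ}
    (hc : ∀ i < l, NN (c i) (c (i + 1))) (hcl : c l = c 0) (hcN : ∀ i ≤ l, |(c i).1| < N)
    (hp : ∀ i < m, NN (p i) (p (i + 1))) (hpm : p m = (0, 0))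
    (hp0 : (p 0).1 = N ∨ (p 0).1 = -N) (hcp : ∀ i ≤ l, ∀ j ≤ m, c i ≠ p j) :
    chainProd (zip 0 0) c l = 1 := by
  have h1 := crossSign_end_mul (p := c) (m := l) (q := p) (m' := m) (fun _ _ => 1) (by
    intro i hi
    rw [crossSign_mul_of_nn hc (hp i hi) (fun j hj => hcp j hj i hi.le)
      (fun j hj => hcp j hj (i + 1) hi), hcl]
    split_ifs
    · rfl
    · unfold raySign; split_ifs <;> norm_num)
  have h2 : crossSign c l (p 0) = 1 := by
    apply chainProd_eq_one
    intro i hi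
    have h3 := hcN i hi.le
    have h4 := hcN (i + 1) hi
    rw [abs_lt] at h3 h4
    unfold zip
    rw [if_neg]
    omega
  rw [h2, one_mul, hpm, chainProd_eq_one (fun _ _ => rfl)] at h1
  have h5 := chainProd_zip_mul_zip hc (x := 0) (y := 0) (fun i hi => hpm ▸ hcp i hi m le_rfl)
  rw [crossSign] at h1
  simp only [h1, hcl] at h5
  rw [one_mul] at h5
  rw [h5]
  unfold raySign; split_ifs <;> norm_num

/-- Two disjoint chains from opposite sides of the strip to the two ends of a horizontal segment:
the product of their zipper signs tells which one comes from which side. -/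
lemma chainProd_zip_linked {p q : ℕ → ℤ × ℤ} {m m' k : ℕ} {N : ℤ} (hN : k + 1 < N)
    (hp : ∀ i < m, NN (p i) (p (i + 1))) (hq : ∀ i < m', NN (q i) (q (i + 1)))
    (hpm : p m = (0, 0)) (hqm : q m' = ((k : ℤ) + 1, 0))
    (hpS : ∀ i < m, ∀ j : ℤ, 0 ≤ j → j ≤ k + 1 → p i ≠ (j, 0))
    (hpN : ∀ i ≤ m, 0 < i → |(p i).1| < N) (hqN : ∀ i ≤ m', 0 < i → |(q i).1| < N)
    (hpq : ∀ i ≤ m, ∀ j ≤ m', p i ≠ q j)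
    (h0 : ((p 0).1 = N ∧ (q 0).1 = -N) ∨ ((p 0).1 = -N ∧ (q 0).1 = N)) :
    chainProd (zip 0 0) p m * chainProd (zip 0 0) q m' = if (q 0).1 = -N then -1 else 1 := by
  let down : ℤ × ℤ → ℤ × ℤ → ℝ := fun u w =>
    if u.1 = w.1 then 1 else if min u.1 w.1 = 0 ∧ u.2 < 0 then -1 else 1
  have hqN' : ∀ i ≤ m', |(q i).1| < N ∨ (q i).1 = (q 0).1 := by
    intro i hi
    rcases Nat.eq_zero_or_pos i with rfl | h
    · exact Or.inr rfl
    · exact Or.inl (hqN i hi h)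
  have hpN' : ∀ i ≤ m, |(p i).1| < N ∨ (p i).1 = (p 0).1 := by
    intro i hi
    rcases Nat.eq_zero_or_pos i with rfl | h
    · exact Or.inr rfl
    · exact Or.inl (hpN i hi h)
  have h1 := crossSign_end_mul (p := p) (m := m) (q := q) (m' := m') down (by
    intro i hi
    rw [crossSign_mul_of_nn hp (hq i hi) (fun j hj => hpq j hj i hi.le)
      (fun j hj => hpq j hj (i + 1) hi), hpm]
    have h3 := hqN' i hi.le
    have h4 := hqN' (i + 1) hi
    rw [abs_lt] at h3 h4
    have h5 := hq i hi
    simp only [down, NN] at *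
    by_cases h6 : (q i).1 = (q (i + 1)).1
    · rw [if_pos h6, if_pos h6]
    · rw [if_neg h6, if_neg h6]
      have h7 : raySign (min (q i).1 (q (i + 1)).1) (q i).2 (p 0) = 1 := by
        unfold raySign; rw [if_neg]; omega
      rw [h7, one_mul]
      unfold raySign
      simp only [eq_comm])
  have h2 : crossSign p m (q 0) = 1 := by
    apply chainProd_eq_one
    intro i hi
    have h3 := hpN' i hi.le
    have h4 := hpN' (i + 1) hi
    rw [abs_lt] at h3 h4
    unfold zip
    rw [if_neg]
    omega
  rw [h2, one_mul, hqm] at h1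
  have h3 : ∀ j : ℕ, j ≤ k → chainProd (zip j 0) p m = chainProd (zip 0 0) p m := by
    intro j hj
    induction j with
    | zero => simp
    | succ j ih =>
      rw [← ih (by omega)]
      have h5 := chainProd_zip_mul_zip hp (x := (j : ℤ) + 1) (y := 0) (by
        intro i hi h
        rcases hi.lt_or_eq with h' | rfl
        · exact hpS i h' (j + 1) (by omega) (by omega) h
        · rw [hpm, Prod.mk.injEq] at h; omega)
      have h6 : raySign ((j : ℤ) + 1) 0 (p 0) = 1 := by
        unfold raySign; rw [if_neg]; omega
      have h7 : raySign ((j : ℤ) + 1) 0 (p m) = 1 := by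
        unfold raySign; rw [hpm, if_neg]; simp
      rw [h6, h7, add_sub_cancel_right, mul_one] at h5
      have h8 := chainProd_zip_sq j 0 p m
      push_cast
      linear_combination (chainProd (zip j 0) p m) * h5 - chainProd (zip (j + 1) 0) p m * h8
  have h4 : chainProd (zip 0 0) p m = chainProd down q m' := by
    rw [← h1, ← h3 k le_rfl, crossSign]
    simp
  rw [h4, chainProd_mul, chainProd_eq_of_telescope (r := fun v => if v.1 ≤ 0 then (-1 : ℝ) else 1)]
  · simp only [hqm]
    rw [if_neg (show ¬ ((k : ℤ) + 1 ≤ 0) by omega), mul_one]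
    congr 1
    rw [eq_iff_iff]
    omega
  · intro v; split_ifs <;> norm_num
  · intro i hi
    have h5 := hq i hi
    have h6 : q i ≠ (0, 0) := fun h => hpq m le_rfl i hi.le (hpm.trans h.symm)
    have h7 : q (i + 1) ≠ (0, 0) := fun h => hpq m le_rfl (i + 1) hi (hpm.trans h.symm)
    generalize q i = u at *
    generalize q (i + 1) = w at *
    obtain ⟨a, b⟩ := u
    obtain ⟨c, d⟩ := w
    simp only [NN, zip, down, ne_eq, Prod.mk.injEq, not_and] at *
    clear h1 h2 h3 h4 hpq hqN hpN hpS hp hq hqN' hpN'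
    rcases h5 with ⟨rfl, rfl | rfl⟩ | ⟨rfl, rfl | rfl⟩ <;>
      split_ifs <;> first | (exfalso; omega) | norm_num

end Planarity

section RootedTrees

variable {W : Type*}

/-- Iterating `g` leads from every vertex to the fixed point `o`. -/
def IsRooted (g : W → W) (o : W) : Prop := g o = o ∧ ∀ v, ∃ m, g^[m] v = o

/-- The graph of a parent function. -/
def parentGraph (g : W → W) : SimpleGraph W := SimpleGraph.fromRel fun u v => g u = v

lemma parentGraph_adj {g : W → W} {u v : W} :
    (parentGraph g).Adj u v ↔ u ≠ v ∧ (g u = v ∨ g v = u) := SimpleGraph.fromRel_adj _ _ _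

lemma IsRooted.apply_apply_ne {g : W → W} {o v : W} (hg : IsRooted g o) (hv : v ≠ o) :
    g (g v) ≠ v := by
  intro h
  have h1 : g v ≠ o := fun h' => hv (by rw [← h, h', hg.1])
  have h2 : ∀ m, g^[m] v = v ∨ g^[m] v = g v := by
    intro m
    induction m with
    | zero => exact Or.inl rfl
    | succ m ih =>
      rw [Function.iterate_succ_apply']
      rcases ih with ih | ih <;> rw [ih]
      · exact Or.inr rfl
      · exact Or.inl h
  obtain ⟨m, hm⟩ := hg.2 v
  rcases h2 m with h3 | h3 <;> rw [hm] at h3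
  · exact hv h3.symm
  · exact h1 h3.symm

lemma IsRooted.apply_ne {g : W → W} {o v : W} (hg : IsRooted g o) (hv : v ≠ o) : g v ≠ v :=
  fun h => hg.apply_apply_ne hv (by rw [h, h])

lemma IsRooted.adj {g : W → W} {o v : W} (hg : IsRooted g o) (hv : v ≠ o) :
    (parentGraph g).Adj v (g v) :=
  parentGraph_adj.2 ⟨(hg.apply_ne hv).symm, Or.inl rfl⟩

/-- The orbit of `x` up to its arrival at `v` avoids the edge from `v` to its parent. -/
lemma IsRooted.reachable_deleteEdges {g : W → W} {o : W} (hg : IsRooted g o) {v : W} (x : W)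
    (m : ℕ) (h : ∀ i < m, g^[i] x ≠ v) :
    ((parentGraph g).deleteEdges {s(v, g v)}).Reachable x (g^[m] x) := by
  induction m with
  | zero => rfl
  | succ m ih =>
    refine (ih fun i hi => h i (by omega)).trans ?_
    rw [Function.iterate_succ_apply']
    have h1 := h m (by omega)
    set y := g^[m] x
    by_cases hy : y = o
    · rw [hy, hg.1]
    · apply SimpleGraph.Adj.reachable
      rw [SimpleGraph.deleteEdges_adj]
      refine ⟨hg.adj hy, ?_⟩
      rw [Set.mem_singleton_iff, Sym2.eq_iff]
      rintro (h2 | h2)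
      · exact h1 h2.1
      · exact hg.apply_apply_ne hy (by rw [h2.2, h2.1])

lemma IsRooted.connected {g : W → W} {o : W} (hg : IsRooted g o) : (parentGraph g).Connected := by
  have h : ∀ x, (parentGraph g).Reachable x o := by
    intro x
    obtain ⟨m, hm⟩ := hg.2 x
    rw [← hm]
    clear hm
    induction m with
    | zero => rfl
    | succ m ih =>
      refine ih.trans ?_
      rw [Function.iterate_succ_apply']
      by_cases hy : g^[m] x = o
      · rw [hy, hg.1]
      · exact (hg.adj hy).reachable
  exact { preconnected := fun x y => (h x).trans (h y).symm, nonempty := ⟨o⟩ }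

lemma IsRooted.isTree [Finite W] {g : W → W} {o : W} (hg : IsRooted g o) :
    (parentGraph g).IsTree := by
  classical
  have := Fintype.ofFinite W
  rw [SimpleGraph.isTree_iff_connected_and_card]
  refine ⟨hg.connected, le_antisymm ?_ ?_⟩
  · have h1 : (parentGraph g).edgeSet ⊆
        ((Finset.univ.erase o).image fun v => s(v, g v) : Finset (Sym2 W)) := by
      intro e
      induction e using Sym2.ind with
      | _ u v =>
      rw [SimpleGraph.mem_edgeSet, parentGraph_adj]
      rintro ⟨hne, h | h⟩
      · simp only [Finset.coe_image, Set.mem_image, Finset.mem_coe, Finset.mem_erase]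
        exact ⟨u, ⟨fun h' => hne (by rw [← h, h', hg.1]), Finset.mem_univ _⟩, by rw [h]⟩
      · simp only [Finset.coe_image, Set.mem_image, Finset.mem_coe, Finset.mem_erase]
        exact ⟨v, ⟨fun h' => hne (by rw [← h, h', hg.1]), Finset.mem_univ _⟩,
          by rw [h, Sym2.eq_swap]⟩
    have h2 := Set.ncard_le_ncard h1 (Finset.finite_toSet _)
    rw [Set.ncard_coe_finset] at h2
    have h3 := h2.trans Finset.card_image_le
    rw [Finset.card_erase_of_mem (Finset.mem_univ _), Finset.card_univ] at h3
    have : 0 < Fintype.card W := Fintype.card_pos_iff.2 ⟨o⟩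
    rw [Nat.card_coe_set_eq, Nat.card_eq_fintype_card]
    omega
  · exact hg.connected.card_vert_le_card_edgeSet_add_one

lemma IsRooted.eq_of_parentGraph_eq {g g' : W → W} {o : W} (hg : IsRooted g o)
    (hg' : IsRooted g' o) (h : parentGraph g = parentGraph g') : g = g' := by
  have step : ∀ x, x ≠ o → g x ≠ g' x → g x ≠ o ∧ g (g x) ≠ g' (g x) := by
    intro x hx hne
    have h1 := hg.adj hx
    rw [h, parentGraph_adj] at h1
    have h2 : g' (g x) = x := h1.2.resolve_left fun h' => hne h'.symm
    refine ⟨fun h' => hx (by rw [← h2, h', hg'.1]), ?_⟩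
    rw [h2]
    exact hg.apply_apply_ne hx
  funext v
  by_contra hne
  have hv : v ≠ o := by rintro rfl; exact hne (by rw [hg.1, hg'.1])
  have h1 : ∀ m, g^[m] v ≠ o ∧ g (g^[m] v) ≠ g' (g^[m] v) := by
    intro m
    induction m with
    | zero => exact ⟨hv, hne⟩
    | succ m ih => rw [Function.iterate_succ_apply']; exact step _ ih.1 ih.2
  obtain ⟨m, hm⟩ := hg.2 v
  exact (h1 m).1 hm

lemma exists_isRooted_parentGraph_eq {H : SimpleGraph W} (hH : H.IsTree) (o : W) :
    ∃ g, IsRooted g o ∧ parentGraph g = H := by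
  classical
  have hc := hH.connected
  have h1 : ∀ v, v ≠ o → ∃ w, H.Adj v w ∧ H.dist w o < H.dist v o := by
    intro v hv
    obtain ⟨p, hp⟩ := hc.exists_walk_length_eq_dist v o
    cases p with
    | nil => exact absurd rfl hv
    | cons hadj q =>
      refine ⟨_, hadj, ?_⟩
      have := SimpleGraph.dist_le q
      rw [SimpleGraph.Walk.length_cons] at hp
      omega
  choose! f hf using h1
  let g : W → W := fun v => if v = o then o else f v
  have hgo : g o = o := if_pos rfl
  have hgv : ∀ v, v ≠ o → g v = f v := fun v hv => if_neg hv
  have hg : IsRooted g o := by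
    refine ⟨hgo, ?_⟩
    suffices ∀ d v, H.dist v o ≤ d → ∃ m, g^[m] v = o from fun v => this _ v le_rfl
    intro d
    induction d with
    | zero =>
      intro v hd
      exact ⟨0, hc.dist_eq_zero_iff.1 (Nat.le_zero.1 hd)⟩
    | succ d ih =>
      intro v hd
      by_cases hv : v = o
      · exact ⟨0, hv⟩
      · obtain ⟨m, hm⟩ := ih (g v) (by have := (hf v hv).2; rw [hgv v hv]; omega)
        exact ⟨m + 1, hm⟩
  refine ⟨g, hg, ?_⟩
  have hle : parentGraph g ≤ H := by
    have aux : ∀ u v, u ≠ v → g u = v → H.Adj u v := by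
      intro u v hne he
      have hu : u ≠ o := by rintro rfl; exact hne (hgo.symm.trans he)
      rw [← he, hgv u hu]
      exact (hf u hu).1
    intro u v huv
    rw [parentGraph_adj] at huv
    rcases huv.2 with h | h
    · exact aux u v huv.1 h
    · exact (aux v u huv.1.symm h).symm
  exact le_antisymm hle ((SimpleGraph.isTree_iff_minimal_connected.1 hH).2 hg.connected hle)

/-- An edge from `v` to its parent separates two vertices exactly when precisely one of them is a
descendant of `v`. -/
lemma IsRooted.not_reachable_deleteEdges_iff {g : W → W} {o : W} (hg : IsRooted g o) {v l r : W} :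
    ¬ ((parentGraph g).deleteEdges {s(v, g v)}).Reachable l r ↔
      Xor (∃ m, g^[m] l = v) (∃ m, g^[m] r = v) := by
  classical
  have hadj : ∀ x y, ((parentGraph g).deleteEdges {s(v, g v)}).Adj x y →
      ((∃ m, g^[m] x = v) ↔ (∃ m, g^[m] y = v)) := by
    have aux : ∀ x, s(x, g x) ≠ s(v, g v) → ((∃ m, g^[m] x = v) ↔ (∃ m, g^[m] (g x) = v)) := by
      intro x hx
      constructor
      · rintro ⟨m, hm⟩
        cases m with
        | zero => exact absurd (by rw [← hm]; rfl) hx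
        | succ m => exact ⟨m, hm⟩
      · rintro ⟨m, hm⟩
        exact ⟨m + 1, hm⟩
    intro x y hxy
    rw [SimpleGraph.deleteEdges_adj, parentGraph_adj, Set.mem_singleton_iff] at hxy
    obtain ⟨⟨-, rfl | rfl⟩, h⟩ := hxy
    · exact aux x h
    · exact (aux y (by rwa [Sym2.eq_swap])).symm
  have hreach : ∀ x y, ((parentGraph g).deleteEdges {s(v, g v)}).Reachable x y →
      ((∃ m, g^[m] x = v) ↔ (∃ m, g^[m] y = v)) := by
    intro x y hxy
    rw [SimpleGraph.reachable_iff_reflTransGen] at hxy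
    induction hxy with
    | refl => rfl
    | tail _ h ih => exact ih.trans (hadj _ _ h)
  have hv : ∀ x, (∃ m, g^[m] x = v) →
      ((parentGraph g).deleteEdges {s(v, g v)}).Reachable x v := by
    intro x hx
    have := hg.reachable_deleteEdges (v := v) x (Nat.find hx) (fun i hi => Nat.find_min hx hi)
    rwa [Nat.find_spec hx] at this
  have ho : ∀ x, (¬ ∃ m, g^[m] x = v) →
      ((parentGraph g).deleteEdges {s(v, g v)}).Reachable x o := by
    intro x hx
    obtain ⟨m, hm⟩ := hg.2 x
    have := hg.reachable_deleteEdges (v := v) x m (fun i _ h => hx ⟨i, h⟩)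
    rwa [hm] at this
  by_cases hl : ∃ m, g^[m] l = v <;> by_cases hr : ∃ m, g^[m] r = v
  · simp only [hl, hr, xor_self, iff_false, not_not]
    exact (hv l hl).trans (hv r hr).symm
  · simp only [hl, hr]
    exact iff_of_true (fun h => hr ((hreach _ _ h).1 hl)) (by simp)
  · simp only [hl, hr]
    exact iff_of_true (fun h => hl ((hreach _ _ h).2 hr)) (by simp)
  · simp only [hl, hr, xor_self, iff_false, not_not]
    exact (ho l hl).trans (ho r hr).symm

end RootedTrees

section Segments

variable {W : Type*}

/-- The parent function `g` runs down the segment `σ 0, …, σ (k + 1)`. -/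
def RunsDown (g : W → W) (σ : ℕ → W) (k : ℕ) : Prop :=
  g (σ 0) = σ 0 ∧ ∀ j ≤ k, g (σ (j + 1)) = σ j

lemma RunsDown.iterate {g : W → W} {σ : ℕ → W} {k : ℕ} (h : RunsDown g σ k) (m : ℕ) {j : ℕ}
    (hj : j ≤ k + 1) : g^[m] (σ j) = σ (j - m) := by
  induction m generalizing j with
  | zero => rfl
  | succ m ih =>
    rw [Function.iterate_succ_apply]
    cases j with
    | zero => rw [h.1, ih (by omega)]; congr 1; omega
    | succ j => rw [h.2 j (by omega), ih (by omega)]; congr 1; omega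

variable [DecidableEq W]

/-- The points of the segment `σ 0, …, σ (k + 1)`. -/
def segPoints (σ : ℕ → W) (k : ℕ) : Finset W := (Finset.range (k + 2)).image σ

lemma mem_segPoints {σ : ℕ → W} {k : ℕ} {v : W} :
    v ∈ segPoints σ k ↔ ∃ j ≤ k + 1, σ j = v := by
  simp only [segPoints, Finset.mem_image, Finset.mem_range]
  exact exists_congr fun j => and_congr_left fun _ => by omega

lemma RunsDown.exists_iterate_eq_iff {g : W → W} {σ : ℕ → W} {k : ℕ} (h : RunsDown g σ k)
    (hσ : Set.InjOn σ {j | j ≤ k + 1}) {l : W} {m i : ℕ} (hi : i ≤ k + 1)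
    (hl : HitsAt g (segPoints σ k) l m (σ i)) {j : ℕ} (hj : j ≤ k + 1) :
    (∃ p, g^[p] l = σ j) ↔ j ≤ i := by
  constructor
  · rintro ⟨p, hp⟩
    by_cases hpm : p < m
    · exact absurd (mem_segPoints.2 ⟨j, hj, hp.symm⟩) (hl.1 p hpm)
    · have h1 : g^[p] l = σ (i - (p - m)) := by
        rw [← h.iterate _ hi, ← hl.2.1, ← Function.iterate_add_apply]
        congr 2; omega
      have h2 := hσ (show i - (p - m) ≤ k + 1 by omega) hj (h1.symm.trans hp)
      omega
  · intro hji
    refine ⟨i - j + m, ?_⟩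
    rw [Function.iterate_add_apply, hl.2.1, h.iterate _ hi]
    congr 1; omega

lemma RunsDown.isLinked_iff {g : W → W} {σ : ℕ → W} {k : ℕ} (h : RunsDown g σ k)
    (hσ : Set.InjOn σ {j | j ≤ k + 1}) {l r : W} :
    IsLinked g (segPoints σ k) (σ 0) (σ (k + 1)) l r ↔
      IsRooted g (σ 0) ∧ ∀ j ≤ k, Xor (∃ m, g^[m] l = σ (j + 1)) (∃ m, g^[m] r = σ (j + 1)) := by
  have hroot : (∀ v, ∃ m, g^[m] v ∈ segPoints σ k) ↔ IsRooted g (σ 0) := by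
    constructor
    · intro hv
      refine ⟨h.1, fun v => ?_⟩
      obtain ⟨m, hm⟩ := hv v
      obtain ⟨j, hj, hjm⟩ := mem_segPoints.1 hm
      refine ⟨j + m, ?_⟩
      rw [Function.iterate_add_apply, ← hjm, h.iterate _ hj, Nat.sub_self]
    · intro hg v
      obtain ⟨m, hm⟩ := hg.2 v
      exact ⟨m, mem_segPoints.2 ⟨0, by omega, hm.symm⟩⟩
  rw [IsLinked, hroot]
  refine and_congr_right fun hg => ?_
  obtain ⟨m, e, hl⟩ := exists_hitsAt (hroot.2 hg l)
  obtain ⟨m', f, hr⟩ := exists_hitsAt (hroot.2 hg r)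
  obtain ⟨i, hi, rfl⟩ := mem_segPoints.1 hl.2.2
  obtain ⟨i', hi', rfl⟩ := mem_segPoints.1 hr.2.2
  have h1 : ∀ j ≤ k, (Xor (∃ m, g^[m] l = σ (j + 1)) (∃ m, g^[m] r = σ (j + 1)) ↔
      ((j + 1 ≤ i ∧ ¬ j + 1 ≤ i') ∨ (j + 1 ≤ i' ∧ ¬ j + 1 ≤ i))) := by
    intro j hj
    rw [h.exists_iterate_eq_iff hσ hi hl (by omega), h.exists_iterate_eq_iff hσ hi' hr (by omega)]
    rfl
  constructor
  · intro h2 j hj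
    rw [h1 j hj]
    rcases h2 with ⟨p, q, h3, h4⟩ | ⟨p, q, h3, h4⟩
    · have h5 := hσ hi (show 0 ≤ k + 1 by omega) (hl.unique h3).2
      have h6 := hσ hi' (show k + 1 ≤ k + 1 by omega) (hr.unique h4).2
      omega
    · have h5 := hσ hi (show k + 1 ≤ k + 1 by omega) (hl.unique h3).2
      have h6 := hσ hi' (show 0 ≤ k + 1 by omega) (hr.unique h4).2
      omega
  · intro h2
    have h3 := (h1 0 (by omega)).1 (h2 0 (by omega))
    have h4 := (h1 k (by omega)).1 (h2 k (by omega))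
    have h5 : (i = 0 ∧ i' = k + 1) ∨ (i = k + 1 ∧ i' = 0) := by omega
    rcases h5 with ⟨rfl, rfl⟩ | ⟨rfl, rfl⟩
    · exact Or.inl ⟨m, m', hl, hr⟩
    · exact Or.inr ⟨m, m', hl, hr⟩

end Segments

section GridTrees

/-- The vertices of the wired grid, as a type. -/
abbrev GridW (n : ℕ) : Type := gridVerts n

/-- The wired grid on its own vertex type. -/
def gridW (n : ℕ) : SimpleGraph (GridW n) := (gridGraph n).comap Subtype.val

/-- A spanning subgraph of the wired grid, seen as a subgraph of `gridGraph n`. -/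
def spanningSubgraph {n : ℕ} (H : SimpleGraph (GridW n)) (hH : H ≤ gridW n) :
    (gridGraph n).Subgraph where
  verts := gridVerts n
  Adj u v := ∃ (hu : u ∈ gridVerts n) (hv : v ∈ gridVerts n), H.Adj ⟨u, hu⟩ ⟨v, hv⟩
  adj_sub := by rintro u v ⟨hu, hv, h⟩; exact hH h
  edge_vert := by rintro u v ⟨hu, hv, h⟩; exact hu
  symm := ⟨by rintro u v ⟨hu, hv, h⟩; exact ⟨hv, hu, h.symm⟩⟩

lemma coe_spanningSubgraph {n : ℕ} (H : SimpleGraph (GridW n)) (hH : H ≤ gridW n) :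
    (spanningSubgraph H hH).coe = H := by
  ext u v
  exact ⟨fun ⟨_, _, h⟩ => h, fun h => ⟨u.2, v.2, h⟩⟩

lemma exists_eq_spanningSubgraph {n : ℕ} (T : (gridGraph n).Subgraph) (hT : IsSpanningTree n T) :
    ∃ (H : SimpleGraph (GridW n)) (hH : H ≤ gridW n), H.IsTree ∧ T = spanningSubgraph H hH := by
  obtain ⟨verts, Adj, h1, h2, h3⟩ := T
  obtain ⟨hv, ht⟩ := hT
  simp only at hv
  subst hv
  refine ⟨_, ?_, ht, ?_⟩
  · intro u v huv
    exact h1 huv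
  · apply SimpleGraph.Subgraph.ext
    · rfl
    · funext u v
      simp only [spanningSubgraph, eq_iff_iff]
      exact ⟨fun h => ⟨h2 h, h2 (h3.symm _ _ h), h⟩, fun ⟨_, _, h⟩ => h⟩

lemma trunkContains_spanningSubgraph {n : ℕ} {H : SimpleGraph (GridW n)} (hH : H ≤ gridW n)
    (u v l r : GridW n) (hl : l.1 = Lv) (hr : r.1 = Rv) :
    TrunkContains n (spanningSubgraph H hH) s(u.1, v.1) ↔
      H.Adj u v ∧ ¬ (H.deleteEdges {s(u, v)}).Reachable l r := by
  have hadj : ∀ x y : GridV,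
      ((spanningSubgraph H hH).deleteEdges {s(u.1, v.1)}).spanningCoe.Adj x y ↔
      ∃ hx hy, (H.deleteEdges {s(u, v)}).Adj ⟨x, hx⟩ ⟨y, hy⟩ := by
    intro x y
    rw [SimpleGraph.Subgraph.spanningCoe_adj, SimpleGraph.Subgraph.deleteEdges_adj]
    simp only [spanningSubgraph, SimpleGraph.deleteEdges_adj, Set.mem_singleton_iff, Sym2.eq_iff,
      Subtype.ext_iff]
    exact ⟨fun ⟨⟨a, b, c⟩, d⟩ => ⟨a, b, c, d⟩, fun ⟨a, b, c, d⟩ => ⟨⟨a, b, c⟩, d⟩⟩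
  rw [TrunkContains, ← hl, ← hr]
  clear hl hr
  refine and_congr ?_ (not_congr ?_)
  · rw [SimpleGraph.Subgraph.mem_edgeSet]
    exact ⟨fun ⟨_, _, h⟩ => h, fun h => ⟨u.2, v.2, h⟩⟩
  · constructor
    · intro h
      suffices ∀ y, ((spanningSubgraph H hH).deleteEdges {s(u.1, v.1)}).spanningCoe.Reachable
          l.1 y →
          ∃ hy, (H.deleteEdges {s(u, v)}).Reachable l ⟨y, hy⟩ from (this r.1 h).2
      intro y hy
      rw [SimpleGraph.reachable_iff_reflTransGen] at hy
      induction hy with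
      | refl => exact ⟨l.2, SimpleGraph.Reachable.refl _⟩
      | tail _ h ih =>
        obtain ⟨hb, h1⟩ := ih
        obtain ⟨_, hc, h2⟩ := (hadj _ _).1 h
        exact ⟨hc, h1.trans h2.reachable⟩
    · intro h
      rw [SimpleGraph.reachable_iff_reflTransGen] at h
      induction h with
      | refl => exact SimpleGraph.Reachable.refl _
      | tail _ h ih =>
        exact ih.trans ((hadj _ _).2 ⟨_, _, h⟩).reachable

instance (n : ℕ) : Finite (GridW n) := by
  apply Set.Finite.to_subtype
  apply Set.Finite.union
  · refine ((Set.finite_Icc ((-n : ℤ), (-n : ℤ)) ((n : ℤ), (n : ℤ))).image Sum.inl).subset ?_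
    rintro _ ⟨p, rfl, h1, h2⟩
    rw [abs_le] at h1 h2
    exact ⟨p, ⟨⟨h1.1, h2.1⟩, ⟨h1.2, h2.2⟩⟩, rfl⟩
  · exact Set.toFinite _

/-- Spanning trees whose trunk contains a run of edges correspond to linked parent functions. -/
lemma card_trunkContains_eq {n k : ℕ} (σ : ℕ → GridW n) (hσ : Set.InjOn σ {j | j ≤ k + 1})
    (hadj : ∀ j ≤ k, (gridW n).Adj (σ j) (σ (j + 1)))
    (hσe : ∀ j ≤ k, hEdge j = s((σ j).1, (σ (j + 1)).1)) {l r : GridW n} (hl : l.1 = Lv)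
    (hr : r.1 = Rv) :
    Nat.card {T : (gridGraph n).Subgraph //
      IsSpanningTree n T ∧ ∀ j ≤ k, TrunkContains n T (hEdge j)} =
    Nat.card {g : GridW n → GridW n // (∀ v ∉ segPoints σ k, (gridW n).Adj v (g v)) ∧
      RunsDown g σ k ∧ IsLinked g (segPoints σ k) (σ 0) (σ (k + 1)) l r} := by
  have hle : ∀ g : GridW n → GridW n, (∀ v ∉ segPoints σ k, (gridW n).Adj v (g v)) →
      RunsDown g σ k → parentGraph g ≤ gridW n := by
    intro g h1 h2
    have aux : ∀ u v, u ≠ v → g u = v → (gridW n).Adj u v := by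
      rintro u v hne rfl
      by_cases hu : u ∈ segPoints σ k
      · obtain ⟨j, hj, rfl⟩ := mem_segPoints.1 hu
        cases j with
        | zero => exact absurd h2.1.symm hne
        | succ j =>
          rw [h2.2 j (by omega)]
          exact (hadj j (by omega)).symm
      · exact h1 u hu
    intro u v huv
    rw [parentGraph_adj] at huv
    rcases huv.2 with h | h
    · exact aux u v huv.1 h
    · exact (aux v u huv.1.symm h).symm
  have htrunk : ∀ (g : GridW n → GridW n) (hg : IsRooted g (σ 0)) (hgle : parentGraph g ≤ gridW n),
      RunsDown g σ k →
        ((∀ j ≤ k, TrunkContains n (spanningSubgraph (parentGraph g) hgle) (hEdge j)) ↔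
        ∀ j ≤ k, Xor (∃ m, g^[m] l = σ (j + 1)) (∃ m, g^[m] r = σ (j + 1))) := by
    intro g hg hgle hrun
    refine forall_congr' fun j => imp_congr_right fun hj => ?_
    have hne : σ (j + 1) ≠ σ 0 := fun h => by
      have := hσ (show j + 1 ≤ k + 1 by omega) (show 0 ≤ k + 1 by omega) h
      omega
    have h1 := hg.not_reachable_deleteEdges_iff (v := σ (j + 1)) (l := l) (r := r)
    have h2 := hg.adj hne
    rw [hrun.2 j hj] at h1 h2
    rw [hσe j hj, Sym2.eq_swap, trunkContains_spanningSubgraph hgle _ _ l r hl hr, h1]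
    exact and_iff_right h2
  symm
  refine Nat.card_congr (Equiv.ofBijective (fun g => ⟨spanningSubgraph (parentGraph g.1)
    (hle g.1 g.2.1 g.2.2.1), ⟨rfl, ?_⟩, ?_⟩) ⟨?_, ?_⟩)
  · rw [coe_spanningSubgraph]
    exact ((g.2.2.1.isLinked_iff hσ).1 g.2.2.2).1.isTree
  · have h := (g.2.2.1.isLinked_iff hσ).1 g.2.2.2
    exact (htrunk g.1 h.1 _ g.2.2.1).2 h.2
  · intro g g' h
    have h1 := (g.2.2.1.isLinked_iff hσ).1 g.2.2.2
    have h2 := (g'.2.2.1.isLinked_iff hσ).1 g'.2.2.2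
    apply Subtype.ext
    refine h1.1.eq_of_parentGraph_eq h2.1 ?_
    have h3 := congrArg Subtype.val h
    simp only at h3
    ext u v
    have h4 : (spanningSubgraph (parentGraph g.1) (hle g.1 g.2.1 g.2.2.1)).Adj u v ↔
      (spanningSubgraph (parentGraph g'.1) (hle g'.1 g'.2.1 g'.2.2.1)).Adj u v := by rw [h3]
    exact ⟨fun h => (h4.1 ⟨u.2, v.2, h⟩).2.2, fun h => (h4.2 ⟨u.2, v.2, h⟩).2.2⟩
  · rintro ⟨T, hT, hk⟩
    obtain ⟨H, hH, ht, rfl⟩ := exists_eq_spanningSubgraph T hT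
    obtain ⟨g, hg, rfl⟩ := exists_isRooted_parentGraph_eq ht (σ 0)
    have hrun : RunsDown g σ k := by
      refine ⟨hg.1, fun j => ?_⟩
      induction j with
      | zero =>
        intro hj
        have h1 := hk 0 hj
        rw [hσe 0 hj, trunkContains_spanningSubgraph hH _ _ l r hl hr, parentGraph_adj] at h1
        rcases h1.1.2 with h2 | h2
        · exact absurd (hg.1.symm.trans h2) h1.1.1
        · exact h2
      | succ j ih =>
        intro hj
        have h1 := hk (j + 1) hj
        rw [hσe _ hj, trunkContains_spanningSubgraph hH _ _ l r hl hr, parentGraph_adj] at h1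
        rcases h1.1.2 with h2 | h2
        · rw [ih (by omega)] at h2
          have := hσ (show j ≤ k + 1 by omega) (show j + 1 + 1 ≤ k + 1 by omega) h2
          omega
        · exact h2
    refine ⟨⟨g, fun v hv => ?_, hrun, ?_⟩, rfl⟩
    · exact hH (hg.adj fun h => hv (mem_segPoints.2 ⟨0, by omega, h.symm⟩))
    · rw [hrun.isLinked_iff hσ]
      exact ⟨hg, (htrunk g hg hH hrun).1 hk⟩

end GridTrees

section GridAdjacency

lemma nn_iff {p q : ℤ × ℤ} : (p.1 - q.1) ^ 2 + (p.2 - q.2) ^ 2 = 1 ↔ NN p q := by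
  obtain ⟨a, b⟩ := p
  obtain ⟨c, d⟩ := q
  simp only [NN]
  constructor
  · intro h
    have h1 : (a - c) ^ 2 ≤ 1 := by nlinarith [sq_nonneg (b - d)]
    have h2 : (b - d) ^ 2 ≤ 1 := by nlinarith [sq_nonneg (a - c)]
    have h3 : -1 ≤ a - c ∧ a - c ≤ 1 := abs_le.1 ((sq_le_one_iff_abs_le_one _).1 h1)
    have h4 : -1 ≤ b - d ∧ b - d ≤ 1 := abs_le.1 ((sq_le_one_iff_abs_le_one _).1 h2)
    obtain ⟨e, he⟩ : ∃ e, a - c = e := ⟨_, rfl⟩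
    obtain ⟨f, hf⟩ : ∃ f, b - d = f := ⟨_, rfl⟩
    rw [he, hf] at h
    rw [he] at h3
    rw [hf] at h4
    obtain ⟨h5, h6⟩ := h3
    obtain ⟨h7, h8⟩ := h4
    interval_cases e <;> interval_cases f <;> simp at h <;> omega
  · rintro (⟨rfl, rfl | rfl⟩ | ⟨rfl, rfl | rfl⟩) <;> ring

lemma mem_gridVerts_inl {n : ℕ} {p : ℤ × ℤ} :
    (Sum.inl p : GridV) ∈ gridVerts n ↔ |p.1| ≤ n ∧ |p.2| ≤ n := by
  constructor
  · rintro (⟨q, h, h'⟩ | h | h)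
    · rwa [Sum.inl.inj h]
    · exact absurd h (by simp [Lv])
    · exact absurd h (by simp [Rv])
  · intro h
    exact Or.inl ⟨p, rfl, h⟩

lemma mem_gridVerts_inr {n : ℕ} (b : Bool) : (Sum.inr b : GridV) ∈ gridVerts n := by
  cases b <;> simp [gridVerts, Lv, Rv]

lemma nn_symm {p q : ℤ × ℤ} (h : NN p q) : NN q p := by
  simp only [NN] at *; omega

lemma gridGraph_adj_inl_inl {n : ℕ} {p q : ℤ × ℤ} (hp : (Sum.inl p : GridV) ∈ gridVerts n)
    (hq : (Sum.inl q : GridV) ∈ gridVerts n) :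
    (gridGraph n).Adj (Sum.inl p) (Sum.inl q) ↔ NN p q := by
  rw [mem_gridVerts_inl] at hp hq
  rw [gridGraph, SimpleGraph.fromRel_adj]
  simp only [gridRel, nn_iff, hp, hq, true_and]
  constructor
  · rintro ⟨-, h | h⟩
    · exact h
    · exact nn_symm h
  · intro h
    refine ⟨?_, Or.inl h⟩
    rw [ne_eq, Sum.inl.injEq]
    rintro rfl
    simp only [NN] at h
    omega

/-- The abscissa of the lattice points adjacent to a wired vertex. -/
def wireX (n : ℕ) (b : Bool) : ℤ := if b then n else -n

lemma gridGraph_adj_inr_inl {n : ℕ} {b : Bool} {p : ℤ × ℤ} :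
    (gridGraph n).Adj (Sum.inr b) (Sum.inl p) ↔ |p.2| ≤ n ∧ p.1 = wireX n b := by
  rw [gridGraph, SimpleGraph.fromRel_adj]
  cases b <;> simp [gridRel, wireX]

lemma gridGraph_not_adj_inr_inr {n : ℕ} {b c : Bool} :
    ¬ (gridGraph n).Adj (Sum.inr b) (Sum.inr c) := by
  rw [gridGraph, SimpleGraph.fromRel_adj]
  simp [gridRel]

/-- The wired vertices on the type of grid vertices. -/
def wireW (n : ℕ) (b : Bool) : GridW n := ⟨Sum.inr b, mem_gridVerts_inr b⟩

/-- The point `(j, 0)`, clamped to the grid. -/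
def segW (n : ℕ) (j : ℕ) : GridW n :=
  ⟨Sum.inl ((min j n : ℕ), 0), mem_gridVerts_inl.2
    ⟨by rw [abs_of_nonneg (Int.natCast_nonneg _)]; exact Nat.cast_le.2 (min_le_right _ _), by simp⟩⟩

/-- The edge signs: `-1` on the edges crossing the zipper above the edge from `(0, 0)` to
`(1, 0)`. -/
def edgeSign (n : ℕ) (u v : GridW n) : ℝ :=
  match u.1, v.1 with
  | Sum.inl p, Sum.inl q => zip 0 0 p q
  | _, _ => 1

lemma edgeSign_eq_or {n : ℕ} (u v : GridW n) : edgeSign n u v = 1 ∨ edgeSign n u v = -1 := by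
  unfold edgeSign zip
  split
  · split_ifs <;> simp
  · simp

lemma segW_val {n j : ℕ} (hj : j ≤ n) : (segW n j).1 = Sum.inl ((j : ℤ), 0) := by
  simp [segW, hj]

lemma segW_injOn {n k : ℕ} (hk : k + 1 ≤ n) : Set.InjOn (segW n) {j | j ≤ k + 1} := by
  intro i hi j hj h
  change i ≤ k + 1 at hi
  change j ≤ k + 1 at hj
  have := congrArg Subtype.val h
  rw [segW_val (by omega), segW_val (by omega)] at this
  simpa using this

lemma segW_adj {n k : ℕ} (hk : k + 1 ≤ n) : ∀ j ≤ k, (gridW n).Adj (segW n j) (segW n (j + 1)) := by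
  intro j hj
  have h1 := (segW n j).2
  have h2 := (segW n (j + 1)).2
  change (gridGraph n).Adj (segW n j).1 (segW n (j + 1)).1
  rw [segW_val (by omega)] at h1 ⊢
  rw [segW_val (by omega)] at h2 ⊢
  rw [gridGraph_adj_inl_inl h1 h2]
  simp [NN]

lemma wireW_notMem {n k : ℕ} (b : Bool) : wireW n b ∉ segPoints (segW n) k := by
  rw [mem_segPoints]
  rintro ⟨j, -, h⟩
  have := congrArg Subtype.val h
  simp [segW, wireW] at this

lemma inl_mem_segPoints {n k : ℕ} (hk : k + 1 ≤ n) {v : GridW n} {j : ℤ} (h0 : 0 ≤ j)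
    (hj : j ≤ k + 1) (hv : v.1 = Sum.inl (j, 0)) : v ∈ segPoints (segW n) k := by
  rw [mem_segPoints]
  refine ⟨j.toNat, by omega, ?_⟩
  apply Subtype.ext
  rw [segW_val (by omega), hv, Int.toNat_of_nonneg h0]

end GridAdjacency

section GridChains

variable {W : Type*}

lemma HitsAt.shift {g : W → W} {S : Finset W} {v e : W} {m i : ℕ} (h : HitsAt g S v m e)
    (hi : i ≤ m) : HitsAt g S (g^[i] v) (m - i) e := by
  refine ⟨fun j hj => ?_, ?_, h.2.2⟩
  · rw [← Function.iterate_add_apply]; exact h.1 _ (by omega)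
  · rw [← Function.iterate_add_apply, Nat.sub_add_cancel hi]; exact h.2.1

lemma inl_or_wireW {n : ℕ} (v : GridW n) : (∃ p, v.1 = Sum.inl p) ∨ ∃ b, v = wireW n b := by
  obtain ⟨p | b, hv⟩ := v
  · exact Or.inl ⟨p, rfl⟩
  · exact Or.inr ⟨b, rfl⟩

/-- The lattice point of a grid vertex. -/
def latticePt {n : ℕ} (v : GridW n) : ℤ × ℤ := Sum.elim id (fun _ => 0) v.1

lemma val_eq_latticePt {n : ℕ} {v : GridW n} (h : ∃ p, v.1 = Sum.inl p) :
    v.1 = Sum.inl (latticePt v) := by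
  obtain ⟨p, hp⟩ := h
  simp [latticePt, hp]

lemma latticePt_abs {n : ℕ} (v : GridW n) : |(latticePt v).1| ≤ n ∧ |(latticePt v).2| ≤ n := by
  obtain ⟨p | b, hv⟩ := v
  · exact mem_gridVerts_inl.1 hv
  · simp [latticePt]

lemma nn_of_adj {n : ℕ} {u v : GridW n} (h : (gridW n).Adj u v) (hu : ∃ p, u.1 = Sum.inl p)
    (hv : ∃ p, v.1 = Sum.inl p) :
    NN (latticePt u) (latticePt v) ∧ edgeSign n u v = zip 0 0 (latticePt u) (latticePt v) := by
  obtain ⟨u, hu'⟩ := u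
  obtain ⟨v, hv'⟩ := v
  obtain ⟨p, hp⟩ := hu
  obtain ⟨q, hq⟩ := hv
  simp only at hp hq
  subst hp hq
  exact ⟨(gridGraph_adj_inl_inl hu' hv').1 h, rfl⟩

/-- The orbit of a wired vertex up to its first hit, as a chain of lattice points. -/
lemma exists_chain {n k : ℕ} (hn : 1 ≤ n) {g : GridW n → GridW n}
    (hg : ∀ v ∉ segPoints (segW n) k, (gridW n).Adj v (g v)) {b : Bool} {m : ℕ} {e : GridW n}
    (h : HitsAt g (segPoints (segW n) k) (wireW n b) m e)
    (hpt : ∀ i ≤ m, 0 < i → ∃ p, (g^[i] (wireW n b)).1 = Sum.inl p) :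
    ∃ P : ℕ → ℤ × ℤ, (∀ i < m, NN (P i) (P (i + 1))) ∧ (P 0).1 = wireX (n + 1) b ∧
      (∀ i ≤ m, 0 < i → (g^[i] (wireW n b)).1 = Sum.inl (P i)) ∧
      (∀ i ≤ m, 0 < i → |(P i).1| < (n : ℤ) + 1) ∧
      holonomy (edgeSign n) g (wireW n b) m = chainProd (zip 0 0) P m ∧ 0 < m := by
  have hm : 0 < m := by
    rw [Nat.pos_iff_ne_zero]
    rintro rfl
    exact wireW_notMem b (show wireW n b ∈ _ from h.2.1 ▸ h.2.2)
  let P : ℕ → ℤ × ℤ := fun i => if i = 0 then (wireX (n + 1) b, (latticePt (g (wireW n b))).2) else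
    latticePt (g^[i] (wireW n b))
  have hP : ∀ i, 0 < i → P i = latticePt (g^[i] (wireW n b)) := fun i hi => if_neg hi.ne'
  have hP0 : P 0 = (wireX (n + 1) b, (latticePt (g (wireW n b))).2) := if_pos rfl
  have hstep : ∀ i < m, NN (P i) (P (i + 1)) ∧
      edgeSign n (g^[i] (wireW n b)) (g^[i + 1] (wireW n b)) = zip 0 0 (P i) (P (i + 1)) := by
    intro i hi
    have hadj := hg _ (h.1 i hi)
    rw [← Function.iterate_succ_apply' g i] at hadj
    rcases Nat.eq_zero_or_pos i with rfl | hi0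
    · have hv := val_eq_latticePt (hpt 1 hm (by omega))
      change (gridGraph n).Adj (Sum.inr b) (g^[1] (wireW n b)).1 at hadj
      rw [hv, gridGraph_adj_inr_inl] at hadj
      rw [hP0, hP (0 + 1) (by omega)]
      simp only [Function.iterate_succ, Function.iterate_zero, Function.comp_apply, id_eq,
        zero_add] at hadj ⊢
      have h1 : edgeSign n (wireW n b) (g (wireW n b)) = 1 := rfl
      rw [h1]
      obtain ⟨-, h2⟩ := hadj
      generalize latticePt (g (wireW n b)) = q at h2
      obtain ⟨q1, q2⟩ := q
      simp only [NN, zip]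
      cases b <;> simp only [wireX, Bool.false_eq_true, if_true, if_false] at h2 ⊢ <;>
        push_cast <;> refine ⟨Or.inl ⟨trivial, by omega⟩, (if_neg ?_).symm⟩ <;>
          rintro ⟨-, h⟩ <;> omega
    · rw [hP i hi0, hP (i + 1) (by omega)]
      exact nn_of_adj hadj (hpt i hi.le hi0) (hpt (i + 1) hi (by omega))
  refine ⟨P, fun i hi => (hstep i hi).1, by rw [hP0], fun i hi h0 => ?_, fun i hi h0 => ?_, ?_, hm⟩
  · rw [hP i h0]; exact val_eq_latticePt (hpt i hi h0)
  · rw [hP i h0]; exact lt_of_le_of_lt (latticePt_abs _).1 (by omega)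
  · exact Finset.prod_congr rfl fun i hi => (hstep i (Finset.mem_range.1 hi)).2

/-- The planarity relations for the orbits of the two wired vertices of the grid. -/
lemma holonomy_of_hits {n k : ℕ} (hk : k + 1 ≤ n) {g : GridW n → GridW n}
    (hg : ∀ v ∉ segPoints (segW n) k, (gridW n).Adj v (g v)) {b : Bool} {m m' : ℕ}
    (h : HitsAt g (segPoints (segW n) k) (wireW n b) m (segW n 0))
    (h' : HitsAt g (segPoints (segW n) k) (wireW n !b) m' (segW n (k + 1))) :
    holonomy (edgeSign n) g (wireW n b) m * holonomy (edgeSign n) g (wireW n !b) m' =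
      (if b then -1 else 1) ∧
    ∀ c, (∀ i, g^[i] c ∉ segPoints (segW n) k) → 0 < Function.minimalPeriod g c →
      holonomy (edgeSign n) g c (Function.minimalPeriod g c) = 1 := by
  have hne : segW n 0 ≠ segW n (k + 1) := fun h => by
    have := segW_injOn hk (show 0 ≤ k + 1 by omega) (show k + 1 ≤ k + 1 by omega) h
    omega
  have hpt : ∀ i ≤ m, 0 < i → ∃ p, (g^[i] (wireW n b)).1 = Sum.inl p := by
    intro i hi h0
    rcases inl_or_wireW (g^[i] (wireW n b)) with h1 | ⟨c, h1⟩
    · exact h1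
    · have h2 := h.shift hi
      rw [h1] at h2
      by_cases hcb : c = b
      · subst hcb
        have := (h.unique h2).1
        omega
      · have : c = !b := by cases b <;> cases c <;> simp_all
        subst this
        exact absurd (h2.unique h').2 hne
  have hpt' : ∀ i ≤ m', 0 < i → ∃ p, (g^[i] (wireW n !b)).1 = Sum.inl p := by
    intro i hi h0
    rcases inl_or_wireW (g^[i] (wireW n !b)) with h1 | ⟨c, h1⟩
    · exact h1
    · have h2 := h'.shift hi
      rw [h1] at h2
      by_cases hcb : c = b
      · subst hcb
        exact absurd (h.unique h2).2 hne
      · have : c = !b := by cases b <;> cases c <;> simp_all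
        subst this
        have := (h'.unique h2).1
        omega
  obtain ⟨P, hP1, hP2, hP3, hP4, hP5, hm⟩ := exists_chain (by omega) hg h hpt
  obtain ⟨Q, hQ1, hQ2, hQ3, hQ4, hQ5, hm'⟩ := exists_chain (by omega) hg h' hpt'
  have hPm : P m = (0, 0) := by
    have := hP3 m le_rfl hm
    rw [h.2.1, segW_val (by omega)] at this
    simpa using this.symm
  have hQm : Q m' = ((k : ℤ) + 1, 0) := by
    have := hQ3 m' le_rfl hm'
    rw [h'.2.1, segW_val (by omega)] at this
    simpa using this.symm
  constructor
  · rw [hP5, hQ5, chainProd_zip_linked (N := (n : ℤ) + 1) (by omega) hP1 hQ1 hPm hQm _ hP4 hQ4 _ _,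
      hQ2]
    · cases b
      · simp only [wireX, Bool.not_false, if_true, Bool.false_eq_true, if_false]
        rw [if_neg]; push_cast; omega
      · simp [wireX]
    · intro i hi j hj0 hj1 hij
      rcases Nat.eq_zero_or_pos i with rfl | h0
      · rw [hij] at hP2
        cases b <;> simp only [wireX, Bool.false_eq_true, if_true, if_false] at hP2 <;>
          push_cast at hP2 <;> omega
      · have := hP3 i hi.le h0
        rw [hij] at this
        exact h.1 i hi (inl_mem_segPoints hk hj0 hj1 this)
    · intro i hi j hj hij
      rcases Nat.eq_zero_or_pos i with rfl | h0 <;> rcases Nat.eq_zero_or_pos j with rfl | h1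
      · rw [hij, hQ2] at hP2
        cases b <;> simp only [wireX, Bool.not_false, Bool.not_true, Bool.false_eq_true,
          if_true, if_false] at hP2 <;> push_cast at hP2 <;> omega
      · have := hQ4 j hj h1
        rw [← hij, hP2, abs_lt] at this
        cases b <;> simp only [wireX, Bool.false_eq_true, if_true, if_false] at this <;>
          push_cast at this <;> omega
      · have := hP4 i hi h0
        rw [hij, hQ2, abs_lt] at this
        cases b <;> simp only [wireX, Bool.not_false, Bool.not_true, Bool.false_eq_true,
          if_true, if_false] at this <;> push_cast at this <;> omega
      · have h2 := hP3 i hi h0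
        rw [hij, ← hQ3 j hj h1] at h2
        have h3 := h.shift hi
        rw [Subtype.ext h2] at h3
        exact hne (h3.unique (h'.shift hj)).2
    · rw [hP2, hQ2]
      cases b <;> simp [wireX]
  · intro c hc hcp
    have hnb : ∀ i d, g^[i] c ≠ wireW n d := by
      intro i d hd
      by_cases hdb : d = b
      · subst hdb
        apply hc (m + i)
        rw [Function.iterate_add_apply, hd, h.2.1]
        exact h.2.2
      · have : d = !b := by cases b <;> cases d <;> simp_all
        subst this
        apply hc (m' + i)
        rw [Function.iterate_add_apply, hd, h'.2.1]
        exact h'.2.2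
    have hcl : ∀ i, ∃ p, (g^[i] c).1 = Sum.inl p := fun i =>
      (inl_or_wireW _).resolve_right fun ⟨d, hd⟩ => hnb i d hd
    have hstep : ∀ i, NN (latticePt (g^[i] c)) (latticePt (g^[i + 1] c)) ∧
        edgeSign n (g^[i] c) (g^[i + 1] c) =
          zip 0 0 (latticePt (g^[i] c)) (latticePt (g^[i + 1] c)) := by
      intro i
      refine nn_of_adj ?_ (hcl i) (hcl (i + 1))
      rw [Function.iterate_succ_apply']
      exact hg _ (hc i)
    have h1 : holonomy (edgeSign n) g c (Function.minimalPeriod g c) =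
        chainProd (zip 0 0) (fun i => latticePt (g^[i] c)) (Function.minimalPeriod g c) :=
      Finset.prod_congr rfl fun i _ => (hstep i).2
    rw [h1]
    refine chainProd_zip_closed (N := (n : ℤ) + 1) (fun i _ => (hstep i).1) ?_ (fun i _ => ?_) hP1
      hPm ?_ ?_
    · simp only [Function.iterate_minimalPeriod, Function.iterate_zero, id_eq]
    · exact lt_of_le_of_lt (latticePt_abs _).1 (by omega)
    · rw [hP2]; cases b <;> simp [wireX]
    · intro i _ j hj hij
      rcases Nat.eq_zero_or_pos j with rfl | h0
      · have h2 := (latticePt_abs (g^[i] c)).1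
        rw [hij, hP2, abs_le] at h2
        cases b <;> simp only [wireX, Bool.false_eq_true, if_true, if_false] at h2 <;>
          push_cast at h2 <;> omega
      · have h2 := val_eq_latticePt (hcl i)
        rw [hij, ← hP3 j hj h0] at h2
        have h3 := h.shift hj
        rw [← Subtype.ext h2] at h3
        apply hc (m - j + i)
        rw [Function.iterate_add_apply, h3.2.1]
        exact h3.2.2

end GridChains

section Expansion

variable {W : Type*} [DecidableEq W] [Fintype W]

/-- The signed Laplacian of `H`, with the rows of the run `σ 0, …, σ (k + 1)` replaced by
coordinate rows, the extreme ones being rerouted to `l` and `r`. -/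
def runMatrix (H : SimpleGraph W) [DecidableRel H.Adj] (s : W → W → ℝ) (σ : ℕ → W) (k : ℕ)
    (l r : W) : Matrix W W ℝ := fun v =>
  if v = σ 0 then Pi.single l 1 else if v = σ (k + 1) then Pi.single r 1 else
    if v ∈ segPoints σ k then Pi.single v 1 else
      ∑ w ∈ Finset.univ.filter (H.Adj v), (Pi.single v 1 - s v w • Pi.single w 1)

lemma card_linked_eq_det {H : SimpleGraph W} [DecidableRel H.Adj] {s : W → W → ℝ}
    (hs : ∀ u v, s u v = 1 ∨ s u v = -1) {σ : ℕ → W} {k : ℕ}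
    (hσ : Set.InjOn σ {j | j ≤ k + 1}) {l r : W}
    (hdir : ∀ g : W → W, (∀ v ∉ segPoints σ k, H.Adj v (g v)) → ∀ m m',
      HitsAt g (segPoints σ k) l m (σ 0) → HitsAt g (segPoints σ k) r m' (σ (k + 1)) →
      holonomy s g l m * holonomy s g r m' = 1 ∧
      ∀ c, (∀ i, g^[i] c ∉ segPoints σ k) → 0 < Function.minimalPeriod g c →
        holonomy s g c (Function.minimalPeriod g c) = 1)
    (hswap : ∀ g : W → W, (∀ v ∉ segPoints σ k, H.Adj v (g v)) → ∀ m m',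
      HitsAt g (segPoints σ k) l m (σ (k + 1)) → HitsAt g (segPoints σ k) r m' (σ 0) →
      holonomy s g l m * holonomy s g r m' = -1 ∧
      ∀ c, (∀ i, g^[i] c ∉ segPoints σ k) → 0 < Function.minimalPeriod g c →
        holonomy s g c (Function.minimalPeriod g c) = 1) :
    (Nat.card {g : W → W // (∀ v ∉ segPoints σ k, H.Adj v (g v)) ∧
      RunsDown g σ k ∧ IsLinked g (segPoints σ k) (σ 0) (σ (k + 1)) l r} : ℝ) =
    (runMatrix H s σ k l r).det := by
  classical
  have h0 : σ 0 ∈ segPoints σ k := mem_segPoints.2 ⟨0, by omega, rfl⟩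
  have hk1 : σ (k + 1) ∈ segPoints σ k := mem_segPoints.2 ⟨k + 1, le_rfl, rfl⟩
  have hne : σ 0 ≠ σ (k + 1) := fun h => by
    have := hσ (show 0 ≤ k + 1 by omega) (show k + 1 ≤ k + 1 from le_rfl) h
    omega
  have hpred : ∀ v ∈ segPoints σ k, ∃ j ≤ k + 1, σ j = v := fun v hv => mem_segPoints.1 hv
  choose! idx hidx1 hidx2 using hpred
  have hidx : ∀ j ≤ k + 1, idx (σ j) = j := fun j hj =>
    hσ (hidx1 _ (mem_segPoints.2 ⟨j, hj, rfl⟩)) hj (hidx2 _ (mem_segPoints.2 ⟨j, hj, rfl⟩))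
  let A : W → Finset W := fun v =>
    if v ∈ segPoints σ k then {σ (idx v - 1)} else Finset.univ.filter (H.Adj v)
  let f : W → W → W → ℝ := fun v w =>
    if v = σ 0 then Pi.single l 1 else if v = σ (k + 1) then Pi.single r 1 else
      if v ∈ segPoints σ k then Pi.single v 1 else Pi.single v 1 - s v w • Pi.single w 1
  have hM : runMatrix H s σ k l r = fun v => ∑ w ∈ A v, f v w := by
    funext v
    by_cases hv : v ∈ segPoints σ k
    · simp only [runMatrix, A, f, if_pos hv, Finset.sum_singleton]
    · have h1 : v ≠ σ 0 := fun h => hv (h ▸ h0)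
      have h2 : v ≠ σ (k + 1) := fun h => hv (h ▸ hk1)
      simp only [runMatrix, A, f, if_neg hv, if_neg h1, if_neg h2]
  have hA : ∀ g : W → W, g ∈ Fintype.piFinset A ↔
      (∀ v ∉ segPoints σ k, H.Adj v (g v)) ∧ RunsDown g σ k := by
    intro g
    rw [Fintype.mem_piFinset]
    constructor
    · intro h
      have hS : ∀ j ≤ k + 1, g (σ j) = σ (j - 1) := by
        intro j hj
        have := h (σ j)
        simp only [A, if_pos (mem_segPoints.2 ⟨j, hj, rfl⟩), hidx j hj] at this
        exact Finset.mem_singleton.1 this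
      refine ⟨fun v hv => ?_, hS 0 (by omega), fun j hj => hS (j + 1) (by omega)⟩
      have := h v
      simp only [A, if_neg hv] at this
      simpa using this
    · rintro ⟨h1, h2, h3⟩ v
      by_cases hv : v ∈ segPoints σ k
      · simp only [A, if_pos hv]
        obtain ⟨j, hj, rfl⟩ := mem_segPoints.1 hv
        rw [hidx j hj, Finset.mem_singleton]
        cases j with
        | zero => exact h2
        | succ j => exact h3 j (by omega)
      · simp only [A, if_neg hv]
        simpa using h1 v hv
  have hdet : (runMatrix H s σ k l r).det =
      ∑ g ∈ Fintype.piFinset A, Matrix.det (fun v => f v (g v)) := by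
    rw [hM]
    exact (Matrix.detRowAlternating (R := ℝ) (n := W)).toMultilinearMap.map_sum_finset f A
  have hterm : ∀ g ∈ Fintype.piFinset A, Matrix.det (fun v => f v (g v)) =
      if IsLinked g (segPoints σ k) (σ 0) (σ (k + 1)) l r then 1 else 0 := by
    intro g hg
    have hg1 := ((hA g).1 hg).1
    refine det_eq_ite_isLinked (K := Matrix.of fun v => f v (g v)) hs hne h0 hk1 ?_ ?_ ?_ ?_
      (hdir g hg1) (hswap g hg1)
    · intro v hv
      have h1 : v ≠ σ 0 := fun h => hv (h ▸ h0)
      have h2 : v ≠ σ (k + 1) := fun h => hv (h ▸ hk1)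
      change f v (g v) = _
      simp only [f, if_neg hv, if_neg h1, if_neg h2, stepRow]
    · intro v hv h1 h2
      change f v (g v) = _
      simp only [f, if_pos hv, if_neg h1, if_neg h2]
    · change f _ _ = _
      simp only [f, if_true]
    · change f _ _ = _
      simp only [f, if_true, if_neg hne.symm]
  rw [hdet, Finset.sum_congr rfl hterm, Finset.sum_boole, Nat.card_eq_fintype_card,
    Fintype.card_subtype]
  congr 2
  ext g
  simp only [Finset.mem_filter, Finset.mem_univ, true_and, hA]
  tauto

end Expansion

section GridExpansion

noncomputable instance (n : ℕ) : Fintype (GridW n) := Fintype.ofFinite _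

open Classical in
/-- The number of spanning trees whose trunk contains a run of edges, as a determinant. -/
lemma card_trunkContains_eq_det {n k : ℕ} (hk : k + 1 ≤ n) :
    (Nat.card {T : (gridGraph n).Subgraph //
      IsSpanningTree n T ∧ ∀ j ≤ k, TrunkContains n T (hEdge j)} : ℝ) =
    (runMatrix (gridW n) (edgeSign n) (segW n) k (wireW n false) (wireW n true)).det := by
  rw [card_trunkContains_eq (segW n) (segW_injOn hk) (segW_adj hk) (l := wireW n false)
    (r := wireW n true) _ rfl rfl]
  · rw [card_linked_eq_det edgeSign_eq_or (segW_injOn hk)]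
    · intro g hg m m' h h'
      exact holonomy_of_hits (b := false) hk hg h h'
    · intro g hg m m' h h'
      have := holonomy_of_hits (b := true) hk hg h' h
      rw [mul_comm]
      exact this
  · intro j hj
    rw [segW_val (by omega), segW_val (by omega), hEdge]
    push_cast
    rfl

end GridExpansion

section Cramer

variable {W : Type*} [DecidableEq W] [Fintype W]

lemma sum_mulVec_mul_det_updateRow (J : Matrix W W ℝ) (b X : W → ℝ) :
    ∑ i, (J.mulVec X) i * (J.updateRow i b).det = J.det * (b ⬝ᵥ X) := by
  have h : ∀ i, (J.updateRow i b).det = Matrix.cramer J.transpose b i := fun i =>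
    (Matrix.cramer_transpose_apply J b i).symm
  simp only [h]
  change (J.mulVec X) ⬝ᵥ (Matrix.cramer J.transpose b) = _
  rw [← Matrix.vecMul_transpose, ← Matrix.dotProduct_mulVec, Matrix.mulVec_cramer,
    Matrix.det_transpose, dotProduct_smul, dotProduct_comm, smul_eq_mul]

lemma det_eq_neg_det_updateRow {J M : Matrix W W ℝ} {u r : W} (hur : u ≠ r) (hu : M u = J r)
    (h : ∀ v, v ≠ u → v ≠ r → M v = J v) : M.det = -(J.updateRow u (M r)).det := by
  have h1 : M = (J.updateRow u (M r)).submatrix (Equiv.swap u r) id := by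
    ext v w
    rw [Matrix.submatrix_apply, id]
    by_cases hvu : v = u
    · subst hvu
      rw [Equiv.swap_apply_left, Matrix.updateRow_ne hur.symm, hu]
    · by_cases hvr : v = r
      · subst hvr
        rw [Equiv.swap_apply_right, Matrix.updateRow_self]
      · rw [Equiv.swap_apply_of_ne_of_ne hvu hvr, Matrix.updateRow_ne hvu, h v hvu hvr]
  conv_lhs => rw [h1]
  rw [Matrix.det_permute, Equiv.Perm.sign_swap hur]
  simp

end Cramer

section SignedLaplacian

open Classical in
/-- The Laplacian of the wired grid. -/
noncomputable def lapW (n : ℕ) (f : GridW n → ℝ) (v : GridW n) : ℝ :=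
  ∑ w ∈ Finset.univ.filter ((gridW n).Adj v), (f v - f w)

open Classical in
/-- The rows of the signed Laplacian of the wired grid. -/
noncomputable def lapRow (n : ℕ) (v : GridW n) : GridW n → ℝ :=
  ∑ w ∈ Finset.univ.filter ((gridW n).Adj v), (Pi.single v 1 - edgeSign n v w • Pi.single w 1)

open Classical in
lemma lapRow_dotProduct {n : ℕ} (v : GridW n) (X : GridW n → ℝ) :
    lapRow n v ⬝ᵥ X =
      ∑ w ∈ Finset.univ.filter ((gridW n).Adj v), (X v - edgeSign n v w * X w) := by
  rw [lapRow, sum_dotProduct]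
  refine Finset.sum_congr rfl fun w _ => ?_
  rw [sub_dotProduct, smul_dotProduct, single_dotProduct, single_dotProduct, one_mul, one_mul,
    smul_eq_mul]

/-- The sign that is `1` on the upper left quadrant and `-1` elsewhere. -/
noncomputable def quadSign (n : ℕ) (v : GridW n) : ℝ :=
  match v.1 with
  | Sum.inl p => if p.1 ≤ 0 ∧ 0 ≤ p.2 then 1 else -1
  | _ => -1

/-- The reflection of the wired grid in the horizontal axis. -/
def reflW (n : ℕ) (v : GridW n) : GridW n :=
  ⟨Sum.map (fun p => (p.1, -p.2)) id v.1, by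
    obtain ⟨p | b, hv⟩ := v
    · change (Sum.inl (p.1, -p.2) : GridV) ∈ _
      rw [mem_gridVerts_inl] at hv ⊢
      simpa using hv
    · exact mem_gridVerts_inr b⟩

lemma reflW_reflW {n : ℕ} (v : GridW n) : reflW n (reflW n v) = v := by
  obtain ⟨p | b, hv⟩ := v <;> simp [reflW]

lemma adj_reflW {n : ℕ} {u v : GridW n} (h : (gridW n).Adj u v) :
    (gridW n).Adj (reflW n u) (reflW n v) := by
  have hu := (reflW n u).2
  have hv := (reflW n v).2
  obtain ⟨p | b, hu'⟩ := u <;> obtain ⟨q | c, hv'⟩ := v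
  · change (gridGraph n).Adj (Sum.inl p) (Sum.inl q) at h
    change (gridGraph n).Adj (Sum.inl (p.1, -p.2)) (Sum.inl (q.1, -q.2))
    rw [gridGraph_adj_inl_inl hu' hv'] at h
    rw [gridGraph_adj_inl_inl hu hv]
    simp only [NN] at *
    omega
  · change (gridGraph n).Adj (Sum.inl p) (Sum.inr c) at h
    change (gridGraph n).Adj (Sum.inl (p.1, -p.2)) (Sum.inr c)
    rw [SimpleGraph.adj_comm, gridGraph_adj_inr_inl] at h ⊢
    simpa using h
  · change (gridGraph n).Adj (Sum.inr b) (Sum.inl q) at h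
    change (gridGraph n).Adj (Sum.inr b) (Sum.inl (q.1, -q.2))
    rw [gridGraph_adj_inr_inl] at h ⊢
    simpa using h
  · exact absurd h gridGraph_not_adj_inr_inr

open Classical in
lemma sum_adj_eq_zero {n : ℕ} {v : GridW n} (hv : reflW n v = v) {t : GridW n → ℝ}
    (ht : ∀ w, (gridW n).Adj v w → t (reflW n w) = -t w) :
    ∑ w ∈ Finset.univ.filter ((gridW n).Adj v), t w = 0 := by
  have h : ∑ w ∈ Finset.univ.filter ((gridW n).Adj v), t w =
      ∑ w ∈ Finset.univ.filter ((gridW n).Adj v), -t w := by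
    refine Finset.sum_nbij' (reflW n) (reflW n) ?_ ?_ (fun w _ => reflW_reflW w)
      (fun w _ => reflW_reflW w) ?_
    · intro w hw
      simp only [Finset.mem_filter, Finset.mem_univ, true_and] at hw ⊢
      exact hv ▸ adj_reflW hw
    · intro w hw
      simp only [Finset.mem_filter, Finset.mem_univ, true_and] at hw ⊢
      exact hv ▸ adj_reflW hw
    · intro w hw
      simp only [Finset.mem_filter, Finset.mem_univ, true_and] at hw
      rw [ht w hw, neg_neg]
  rw [Finset.sum_neg_distrib] at h
  linarith

/-- A function symmetric about the horizontal axis that vanishes on the wired vertices and on the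
slit `{(x, 0) : x ≤ k}`. -/
structure SlitFun (n k : ℕ) (f : GridW n → ℝ) : Prop where
  refl : ∀ v, f (reflW n v) = f v
  wire : ∀ b, f (wireW n b) = 0
  slit : ∀ (v : GridW n) (x : ℤ), v.1 = Sum.inl (x, 0) → x ≤ k → f v = 0

variable {n k : ℕ} {f : GridW n → ℝ}

lemma SlitFun.apply_reflW_mul (hf : SlitFun n k f) {v : GridW n}
    (hv : ∀ p, v.1 = Sum.inl p → p.1 ≤ 0) :
    quadSign n (reflW n v) * f (reflW n v) = -(quadSign n v * f v) := by
  rw [hf.refl]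
  obtain ⟨⟨x, y⟩ | b, hv'⟩ := v
  · have hx : x ≤ 0 := hv (x, y) rfl
    rcases eq_or_ne y 0 with rfl | hy
    · rw [hf.slit _ x rfl (by omega)]; simp
    · simp only [quadSign, reflW, Sum.map_inl, hx, true_and]
      split_ifs <;> first | (exfalso; omega) | ring
  · rw [show (⟨Sum.inr b, hv'⟩ : GridW n) = wireW n b from rfl, hf.wire]; simp

/-- Off the slit, the sign twist conjugates the signed Laplacian to the plain one. -/
lemma SlitFun.twist (hf : SlitFun n k f) {v w : GridW n} {x y : ℤ} (hv : v.1 = Sum.inl (x, y))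
    (hxy : y = 0 → (k : ℤ) + 1 < x) (h : (gridW n).Adj v w) :
    quadSign n v * f v - edgeSign n v w * (quadSign n w * f w) = quadSign n v * (f v - f w) := by
  rcases inl_or_wireW w with ⟨⟨a, b⟩, hw⟩ | ⟨b, rfl⟩
  · by_cases hs : b = 0 ∧ a ≤ k
    · obtain ⟨rfl, ha⟩ := hs
      rw [hf.slit w a hw ha]; ring
    · have hnn : NN (x, y) (a, b) := by
        have h1 := v.2
        have h2 := w.2
        change (gridGraph n).Adj v.1 w.1 at h
        rw [hv] at h1 h
        rw [hw] at h2 h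
        exact (gridGraph_adj_inl_inl h1 h2).1 h
      have : edgeSign n v w * quadSign n w = quadSign n v := by
        simp only [edgeSign, quadSign, hv, hw, zip]
        simp only [NN] at hnn
        split_ifs <;> first | (exfalso; omega) | norm_num
      rw [← mul_assoc, this]; ring
  · rw [hf.wire]; ring

end SignedLaplacian

section RunRecursion

open Classical in
/-- The number of spanning trees whose trunk contains `e_0, …, e_k`. -/
noncomputable def runCount (n k : ℕ) : ℝ :=
  (runMatrix (gridW n) (edgeSign n) (segW n) k (wireW n false) (wireW n true)).det

open Classical in
/-- The matrix comparing the runs of lengths `k` and `k + 1`. -/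
noncomputable def pivotMatrix (n k : ℕ) : Matrix (GridW n) (GridW n) ℝ := fun v =>
  if v = segW n 0 then Pi.single (wireW n false) 1 else
    if v = wireW n true then Pi.single v 1 else
      if v ∈ segPoints (segW n) k then Pi.single v 1 else lapRow n v

lemma wireW_ne_segW {n : ℕ} (b : Bool) (j : ℕ) : wireW n b ≠ segW n j := by
  intro h
  have := congrArg Subtype.val h
  simp [segW, wireW] at this

lemma segW_ne {n i j : ℕ} (hi : i ≤ n) (hj : j ≤ n) (h : i ≠ j) : segW n i ≠ segW n j := by
  intro h'
  have := congrArg Subtype.val h'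
  rw [segW_val hi, segW_val hj] at this
  simp at this
  exact h this

lemma segW_mem {n i k : ℕ} (hi : i ≤ k + 1) : segW n i ∈ segPoints (segW n) k :=
  mem_segPoints.2 ⟨i, hi, rfl⟩

lemma runCount_eq {n k : ℕ} (hk : k + 1 ≤ n) :
    runCount n k =
      -((pivotMatrix n k).updateRow (segW n (k + 1)) (lapRow n (wireW n true))).det := by
  classical
  have hr : runMatrix (gridW n) (edgeSign n) (segW n) k (wireW n false) (wireW n true)
      (wireW n true) = lapRow n (wireW n true) := by
    rw [runMatrix, if_neg (wireW_ne_segW _ _), if_neg (wireW_ne_segW _ _), if_neg (wireW_notMem _),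
      lapRow]
  rw [runCount, det_eq_neg_det_updateRow (J := pivotMatrix n k)
    (wireW_ne_segW true (k + 1)).symm, hr]
  · rw [runMatrix, pivotMatrix, if_neg (segW_ne hk (by omega) (by omega)), if_pos rfl,
      if_neg (wireW_ne_segW _ _), if_pos rfl]
  · intro v h1 h2
    rw [runMatrix, pivotMatrix, if_neg h1, if_neg h2]
    rfl

lemma runCount_succ_eq {n k : ℕ} (hk : k + 2 ≤ n) :
    runCount n (k + 1) =
      -((pivotMatrix n k).updateRow (segW n (k + 2)) (lapRow n (wireW n true))).det := by
  classical
  have hr : runMatrix (gridW n) (edgeSign n) (segW n) (k + 1) (wireW n false) (wireW n true)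
      (wireW n true) = lapRow n (wireW n true) := by
    rw [runMatrix, if_neg (wireW_ne_segW _ _), if_neg (wireW_ne_segW _ _), if_neg (wireW_notMem _),
      lapRow]
  rw [runCount, det_eq_neg_det_updateRow (J := pivotMatrix n k)
    (wireW_ne_segW true (k + 2)).symm, hr]
  · rw [runMatrix, pivotMatrix, if_neg (segW_ne hk (by omega) (by omega)), if_pos rfl,
      if_neg (wireW_ne_segW _ _), if_pos rfl]
  · intro v h1 h2
    have : v ∈ segPoints (segW n) (k + 1) ↔ v ∈ segPoints (segW n) k := by
      rw [mem_segPoints, mem_segPoints]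
      constructor
      · rintro ⟨j, hj, rfl⟩
        refine ⟨j, ?_, rfl⟩
        by_contra h
        exact h1 (by rw [show j = k + 2 by omega])
      · rintro ⟨j, hj, rfl⟩
        exact ⟨j, by omega, rfl⟩
    rw [runMatrix, pivotMatrix, if_neg h1, if_neg h2]
    simp only [this]
    rfl

/-- A function harmonic off the slit gives a linear relation between consecutive run counts. -/
lemma SlitFun.runCount_relation {n k : ℕ} (hk : k + 2 ≤ n) {f : GridW n → ℝ} (hf : SlitFun n k f)
    (hlap : ∀ (v : GridW n) (x y : ℤ), v.1 = Sum.inl (x, y) → (y = 0 → (k : ℤ) + 2 < x) →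
      lapW n f v = 0) :
    f (segW n (k + 1)) * runCount n k + lapW n f (segW n (k + 2)) * runCount n (k + 1) =
      -((pivotMatrix n k).det * lapW n f (wireW n true)) := by
  classical
  set X : GridW n → ℝ := fun v => -(quadSign n v * f v) with hX
  have hXw : ∀ b, X (wireW n b) = 0 := fun b => by simp only [hX, hf.wire, mul_zero, neg_zero]
  have hlapRow : ∀ v, v ∉ segPoints (segW n) k → v ≠ wireW n true →
      lapRow n v ⬝ᵥ X = if v = segW n (k + 2) then lapW n f v else 0 := by
    intro v hv hvt
    rw [lapRow_dotProduct]
    rcases inl_or_wireW v with ⟨⟨x, y⟩, hxy⟩ | ⟨b, rfl⟩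
    · by_cases hslit : y = 0 → (k : ℤ) + 1 < x
      · have h1 : ∀ w ∈ Finset.univ.filter ((gridW n).Adj v),
            X v - edgeSign n v w * X w = -quadSign n v * (f v - f w) := by
          intro w hw
          have := hf.twist hxy hslit (by simpa using hw)
          simp only [hX]
          linear_combination -this
        rw [Finset.sum_congr rfl h1, ← Finset.mul_sum]
        change -quadSign n v * lapW n f v = _
        split_ifs with h2
        · have : quadSign n v = -1 := by
            rw [h2]
            simp only [quadSign, segW_val hk]
            rw [if_neg]
            push_cast
            omega
          rw [this]; ring
        · rw [hlap v x y hxy, mul_zero]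
          intro hy
          have := hslit hy
          by_contra h3
          apply h2
          apply Subtype.ext
          rw [hxy, segW_val hk, hy]
          push_cast
          rw [show x = (k : ℤ) + 2 by omega]
      · push Not at hslit
        obtain ⟨rfl, hx⟩ := hslit
        have hx0 : x < 0 := by
          by_contra h
          exact hv (inl_mem_segPoints (by omega) (by omega) hx hxy)
        rw [if_neg]
        · have hXv : X v = 0 := by simp only [hX, hf.slit v x hxy (by omega), mul_zero, neg_zero]
          simp only [hXv, zero_sub]
          have hvr : reflW n v = v := by
            apply Subtype.ext
            simp [reflW, hxy]
          refine sum_adj_eq_zero hvr fun w hw => ?_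
          have hsign : ∀ w, edgeSign n v w = 1 := by
            intro w
            unfold edgeSign zip
            rw [hxy]
            rcases h : w.1 with q | b
            · simp
            · simp
          rw [hsign, hsign]
          simp only [hX]
          rw [hf.apply_reflW_mul]
          · ring
          · rintro ⟨a, c⟩ hac
            have h1 := v.2
            have h2 := w.2
            change (gridGraph n).Adj v.1 w.1 at hw
            rw [hxy] at h1 hw
            rw [hac] at h2 hw
            have := (gridGraph_adj_inl_inl h1 h2).1 hw
            simp only [NN] at this ⊢
            omega
        · rintro rfl
          rw [segW_val hk] at hxy
          simp at hxy
          omega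
    · have hb : b = false := by cases b <;> simp_all
      subst hb
      rw [if_neg (wireW_ne_segW _ _)]
      simp only [hXw, zero_sub]
      refine sum_adj_eq_zero rfl fun w hw => ?_
      rw [show ∀ w, edgeSign n (wireW n false) w = 1 from fun w => rfl,
        show ∀ w, edgeSign n (wireW n false) w = 1 from fun w => rfl]
      simp only [hX]
      rw [hf.apply_reflW_mul]
      · ring
      · rintro ⟨a, c⟩ hac
        change (gridGraph n).Adj (Sum.inr false) w.1 at hw
        rw [hac, gridGraph_adj_inr_inl] at hw
        simp only [wireX] at hw ⊢
        have := hw.2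
        simp at this
        omega
  have hJ : ∀ v, (pivotMatrix n k).mulVec X v =
      if v = segW n (k + 1) then f v else if v = segW n (k + 2) then lapW n f v else 0 := by
    intro v
    change pivotMatrix n k v ⬝ᵥ X = _
    rw [pivotMatrix]
    by_cases h1 : v = segW n 0
    · subst h1
      rw [if_pos rfl, if_neg (segW_ne (by omega) (by omega) (by omega)),
        if_neg (segW_ne (by omega) (by omega) (by omega)), single_dotProduct, hXw, mul_zero]
    rw [if_neg h1]
    by_cases h2 : v = wireW n true
    · subst h2
      rw [if_pos rfl, if_neg (wireW_ne_segW _ _), if_neg (wireW_ne_segW _ _), single_dotProduct,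
        hXw, mul_zero]
    rw [if_neg h2]
    by_cases h3 : v ∈ segPoints (segW n) k
    · rw [if_pos h3, single_dotProduct, one_mul]
      obtain ⟨j, hj, rfl⟩ := mem_segPoints.1 h3
      have hj0 : j ≠ 0 := fun h => h1 (by rw [h])
      have hval : (segW n j).1 = Sum.inl ((j : ℤ), 0) := segW_val (by omega)
      rcases Nat.lt_or_ge k j with hkj | hkj
      · obtain rfl : j = k + 1 := by omega
        have : quadSign n (segW n (k + 1)) = -1 := by
          simp only [quadSign, hval]
          rw [if_neg]
          push_cast
          omega
        rw [if_pos rfl]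
        simp only [hX, this]
        ring
      · rw [if_neg (segW_ne (by omega) (by omega) (by omega)),
          if_neg (segW_ne (by omega) (by omega) (by omega))]
        simp only [hX, hf.slit _ _ hval (by omega), mul_zero, neg_zero]
    · rw [if_neg h3, hlapRow v h3 h2, if_neg fun h : v = segW n (k + 1) => h3 (h ▸ segW_mem le_rfl)]
  have hR : lapRow n (wireW n true) ⬝ᵥ X = lapW n f (wireW n true) := by
    rw [lapRow_dotProduct, lapW]
    refine Finset.sum_congr rfl fun w hw => ?_
    rw [show edgeSign n (wireW n true) w = 1 from rfl, hXw, hf.wire, one_mul]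
    have hw' : (gridW n).Adj (wireW n true) w := by simpa using hw
    rcases inl_or_wireW w with ⟨⟨a, b⟩, hab⟩ | ⟨b, rfl⟩
    · change (gridGraph n).Adj (Sum.inr true) w.1 at hw'
      rw [hab, gridGraph_adj_inr_inl] at hw'
      have h1 := hw'.2
      simp only [wireX, if_true] at h1
      have : quadSign n w = -1 := by
        simp only [quadSign, hab]
        rw [if_neg]
        omega
      simp only [hX, this]; ring
    · rw [hXw, hf.wire]
  have h := sum_mulVec_mul_det_updateRow (pivotMatrix n k) (lapRow n (wireW n true)) X
  rw [hR] at h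
  rw [runCount_eq (by omega), runCount_succ_eq hk, ← h]
  have hne : segW n (k + 1) ≠ segW n (k + 2) := segW_ne (by omega) hk (by omega)
  rw [← Finset.sum_subset (Finset.subset_univ {segW n (k + 1), segW n (k + 2)}),
    Finset.sum_pair hne, hJ, hJ, if_pos rfl, if_neg hne.symm, if_pos rfl]
  · ring
  · intro v _ hv
    simp only [Finset.mem_insert, Finset.mem_singleton, not_or] at hv
    rw [hJ, if_neg hv.1, if_neg hv.2, zero_mul]

end RunRecursion

section DirichletProblem

/-- The Laplacian at `(x, y)` on the strip `|y| ≤ N` with free top and bottom. -/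
noncomputable def stripLap (N : ℤ) (F : ℤ → ℤ → ℝ) (x y : ℤ) : ℝ :=
  (F x y - F (x - 1) y) + (F x y - F (x + 1) y) + (if y < N then F x y - F x (y + 1) else 0) +
    (if -N < y then F x y - F x (y - 1) else 0)

/-- The box with walls at the columns `a` and `b`, slit along `{(x, 0) : x ≤ t}`. -/
noncomputable def slitDomain (N a b t : ℤ) : Finset (ℤ × ℤ) :=
  (Finset.Ioo a b ×ˢ Finset.Icc (-N) N).filter fun p => p.2 = 0 → t < p.1

variable {N a b t : ℤ}

lemma mem_slitDomain {x y : ℤ} : (x, y) ∈ slitDomain N a b t ↔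
    (a < x ∧ x < b) ∧ (-N ≤ y ∧ y ≤ N) ∧ (y = 0 → t < x) := by
  simp [slitDomain, and_assoc]

lemma stripLap_sub (F G : ℤ → ℤ → ℝ) (x y : ℤ) :
    stripLap N (fun x y => F x y - G x y) x y = stripLap N F x y - stripLap N G x y := by
  unfold stripLap; split_ifs <;> ring

lemma stripLap_add (F G : ℤ → ℤ → ℝ) (x y : ℤ) :
    stripLap N (fun x y => F x y + G x y) x y = stripLap N F x y + stripLap N G x y := by
  unfold stripLap; split_ifs <;> ring

lemma stripLap_smul (c : ℝ) (F : ℤ → ℤ → ℝ) (x y : ℤ) :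
    stripLap N (fun x y => c * F x y) x y = c * stripLap N F x y := by
  unfold stripLap; split_ifs <;> ring

lemma stripLap_shift (F : ℤ → ℤ → ℝ) (c x y : ℤ) :
    stripLap N (fun x y => F (x + c) y) x y = stripLap N F (x + c) y := by
  simp only [stripLap]
  rw [show x - 1 + c = x + c - 1 by ring, show x + 1 + c = x + c + 1 by ring]

/-- The minimum principle on slit boxes. -/
lemma nonneg_of_stripLap {F : ℤ → ℤ → ℝ}
    (hlap : ∀ x y, (x, y) ∈ slitDomain N a b t → 0 ≤ stripLap N F x y)
    (hbd : ∀ x y, a ≤ x → x ≤ b → -N ≤ y → y ≤ N → (x, y) ∉ slitDomain N a b t → 0 ≤ F x y)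
    {x y : ℤ} (hax : a ≤ x) (hxb : x ≤ b) (hy : -N ≤ y) (hy' : y ≤ N) : 0 ≤ F x y := by
  by_contra hneg
  push Not at hneg
  set B : Finset (ℤ × ℤ) := Finset.Icc a b ×ˢ Finset.Icc (-N) N with hB
  have hmemB : ∀ x y, (x, y) ∈ B ↔ (a ≤ x ∧ x ≤ b) ∧ (-N ≤ y ∧ y ≤ N) := by simp [hB]
  obtain ⟨p, hpB, hp⟩ := B.exists_min_image (fun p => F p.1 p.2)
    ⟨(x, y), (hmemB _ _).2 ⟨⟨hax, hxb⟩, hy, hy'⟩⟩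
  obtain ⟨q, hqM, hq⟩ := (B.filter fun q => F q.1 q.2 ≤ F p.1 p.2).exists_min_image Prod.fst
    ⟨p, by simp [hpB]⟩
  obtain ⟨u, v⟩ := q
  rw [Finset.mem_filter, hmemB] at hqM
  obtain ⟨⟨⟨h1, h2⟩, h3, h4⟩, h5⟩ := hqM
  have hpneg : F p.1 p.2 < 0 :=
    lt_of_le_of_lt (hp (x, y) ((hmemB _ _).2 ⟨⟨hax, hxb⟩, hy, hy'⟩)) hneg
  have hmin : ∀ x y, a ≤ x → x ≤ b → -N ≤ y → y ≤ N → F u v ≤ F x y := fun x y h h' h'' h''' =>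
    h5.trans (hp (x, y) ((hmemB _ _).2 ⟨⟨h, h'⟩, h'', h'''⟩))
  have hD : (u, v) ∈ slitDomain N a b t := by
    by_contra h
    exact absurd (hbd u v h1 h2 h3 h4 h) (not_le.2 (lt_of_le_of_lt h5 hpneg))
  have hl := hlap u v hD
  rw [mem_slitDomain] at hD
  have e1 := hmin (u + 1) v (by omega) (by omega) h3 h4
  have e2 := hmin (u - 1) v (by omega) (by omega) h3 h4
  have e3 : (if v < N then F u v - F u (v + 1) else 0) ≤ 0 := by
    split_ifs with h
    · linarith [hmin u (v + 1) h1 h2 (by omega) (by omega)]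
    · exact le_rfl
  have e4 : (if -N < v then F u v - F u (v - 1) else 0) ≤ 0 := by
    split_ifs with h
    · linarith [hmin u (v - 1) h1 h2 (by omega) (by omega)]
    · exact le_rfl
  unfold stripLap at hl
  have h6 := hq (u - 1, v) (by
    rw [Finset.mem_filter, hmemB]
    exact ⟨⟨⟨by omega, by omega⟩, h3, h4⟩, by linarith⟩)
  simp at h6

lemma le_of_stripLap_le {F G : ℤ → ℤ → ℝ}
    (hlap : ∀ x y, (x, y) ∈ slitDomain N a b t → stripLap N F x y ≤ stripLap N G x y)
    (hbd : ∀ x y, a ≤ x → x ≤ b → -N ≤ y → y ≤ N → (x, y) ∉ slitDomain N a b t → F x y ≤ G x y)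
    {x y : ℤ} (hax : a ≤ x) (hxb : x ≤ b) (hy : -N ≤ y) (hy' : y ≤ N) : F x y ≤ G x y := by
  have := nonneg_of_stripLap (N := N) (a := a) (b := b) (t := t) (F := fun x y => G x y - F x y)
    (fun x y h => by rw [stripLap_sub]; linarith [hlap x y h])
    (fun x y h1 h2 h3 h4 h5 => by linarith [hbd x y h1 h2 h3 h4 h5]) hax hxb hy hy'
  linarith

/-- Solvability of the Dirichlet problem on slit boxes. -/
lemma exists_dirichlet (N a b t : ℤ) (φ s : ℤ → ℤ → ℝ) : ∃ F : ℤ → ℤ → ℝ,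
    (∀ x y, (x, y) ∈ slitDomain N a b t → stripLap N F x y = s x y) ∧
      ∀ x y, (x, y) ∉ slitDomain N a b t → F x y = φ x y := by
  classical
  set D := slitDomain N a b t with hD
  let ext : (D → ℝ) → ℤ → ℤ → ℝ := fun u x y => if h : (x, y) ∈ D then u ⟨(x, y), h⟩ else 0
  have hadd : ∀ u v, ext (u + v) = fun x y => ext u x y + ext v x y := by
    intro u v; funext x y; simp only [ext]; split_ifs <;> simp
  have hsmul : ∀ (c : ℝ) u, ext (c • u) = fun x y => c * ext u x y := by
    intro c u; funext x y; simp only [ext]; split_ifs <;> simp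
  let T : (D → ℝ) →ₗ[ℝ] (D → ℝ) :=
    { toFun := fun u p => stripLap N (ext u) p.1.1 p.1.2
      map_add' := fun u v => by
        funext p; rw [hadd, stripLap_add]; rfl
      map_smul' := fun c u => by
        funext p; rw [hsmul, stripLap_smul]; rfl }
  have hinj : Function.Injective T := by
    rw [← LinearMap.ker_eq_bot, LinearMap.ker_eq_bot']
    intro u hu
    have hlap : ∀ x y, (x, y) ∈ D → stripLap N (ext u) x y = 0 := fun x y h =>
      congrFun hu ⟨(x, y), h⟩
    have hz : ∀ x y, (x, y) ∉ D → ext u x y = 0 := fun x y h => dif_neg h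
    have hzero : stripLap N (fun _ _ => 0) = fun _ _ => 0 := by
      funext x y; simp [stripLap]
    funext p
    obtain ⟨⟨x, y⟩, hp⟩ := p
    have hmem := mem_slitDomain.1 hp
    have h1 := le_of_stripLap_le (N := N) (a := a) (b := b) (t := t) (F := fun _ _ => 0)
      (G := ext u)
      (fun x y h => by rw [hlap x y h, hzero])
      (fun x y _ _ _ _ h => (hz x y h).ge) (x := x) (y := y) (by omega) (by omega) (by omega)
      (by omega)
    have h2 := le_of_stripLap_le (N := N) (a := a) (b := b) (t := t) (G := fun _ _ => 0)
      (F := ext u)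
      (fun x y h => by rw [hlap x y h, hzero])
      (fun x y _ _ _ _ h => (hz x y h).le) (x := x) (y := y) (by omega) (by omega) (by omega)
      (by omega)
    have h3 : ext u x y = u ⟨(x, y), hp⟩ := dif_pos hp
    rw [← h3]
    exact le_antisymm h2 h1
  let ψ : ℤ → ℤ → ℝ := fun x y => if (x, y) ∈ D then 0 else φ x y
  obtain ⟨u, hu⟩ := (LinearMap.injective_iff_surjective.1 hinj)
    (fun p => s p.1.1 p.1.2 - stripLap N ψ p.1.1 p.1.2)
  refine ⟨fun x y => ext u x y + ψ x y, fun x y h => ?_, fun x y h => ?_⟩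
  · have := congrFun hu ⟨(x, y), h⟩
    change stripLap N (ext u) x y = s x y - stripLap N ψ x y at this
    rw [stripLap_add, this]; ring
  · simp only [ext, ψ, dif_neg h, if_neg h, zero_add]

lemma stripLap_refl (F : ℤ → ℤ → ℝ) (x y : ℤ) :
    stripLap N (fun x y => F x (-y)) x y = stripLap N F x (-y) := by
  simp only [stripLap]
  rw [show -(y + 1) = -y - 1 by ring, show -(y - 1) = -y + 1 by ring]
  have h1 : (y < N) = (-N < -y) := by rw [neg_lt_neg_iff]
  have h2 : (-N < y) = (-y < N) := by rw [neg_lt]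
  simp only [h1, h2]
  ring

lemma dirichlet_refl {F : ℤ → ℤ → ℝ}
    (hlap : ∀ x y, (x, y) ∈ slitDomain N a b t → stripLap N F x (-y) = stripLap N F x y)
    (hbd : ∀ x y, (x, y) ∉ slitDomain N a b t → F x (-y) = F x y) (x y : ℤ) :
    F x (-y) = F x y := by
  by_cases h : (x, y) ∈ slitDomain N a b t
  · have hmem := mem_slitDomain.1 h
    apply le_antisymm
    · exact le_of_stripLap_le (N := N) (a := a) (b := b) (t := t)
        (F := fun x y => F x (-y)) (G := F)
        (fun x y h => by rw [stripLap_refl, hlap x y h])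
        (fun x y _ _ _ _ h => (hbd x y h).le) (by omega) (by omega) (by omega) (by omega)
    · exact le_of_stripLap_le (N := N) (a := a) (b := b) (t := t)
        (G := fun x y => F x (-y)) (F := F)
        (fun x y h => by rw [stripLap_refl, hlap x y h])
        (fun x y _ _ _ _ h => (hbd x y h).ge) (by omega) (by omega) (by omega) (by omega)
  · exact hbd x y h

/-- The Green function of the slit box with pole at the tip of the slit. -/
noncomputable def tipGreen (N a b t : ℤ) : ℤ → ℤ → ℝ :=
  (exists_dirichlet N a b t (fun _ _ => 0) fun x y => if x = t + 1 ∧ y = 0 then 1 else 0).choose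

lemma stripLap_tipGreen {x y : ℤ} (h : (x, y) ∈ slitDomain N a b t) :
    stripLap N (tipGreen N a b t) x y = if x = t + 1 ∧ y = 0 then 1 else 0 :=
  (exists_dirichlet N a b t _ _).choose_spec.1 x y h

lemma tipGreen_of_notMem {x y : ℤ} (h : (x, y) ∉ slitDomain N a b t) :
    tipGreen N a b t x y = 0 :=
  (exists_dirichlet N a b t _ _).choose_spec.2 x y h

lemma neg_mem_slitDomain {x y : ℤ} :
    (x, -y) ∈ slitDomain N a b t ↔ (x, y) ∈ slitDomain N a b t := by
  rw [mem_slitDomain, mem_slitDomain]; omega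

lemma tipGreen_neg (x y : ℤ) : tipGreen N a b t x (-y) = tipGreen N a b t x y := by
  refine dirichlet_refl (N := N) (a := a) (b := b) (t := t) (fun x y h => ?_) (fun x y h => ?_) x y
  · rw [stripLap_tipGreen h, stripLap_tipGreen (neg_mem_slitDomain.2 h)]
    simp
  · rw [tipGreen_of_notMem h, tipGreen_of_notMem (neg_mem_slitDomain.not.2 h)]

/-- The harmonic measure of the right wall in the slit box. -/
noncomputable def wallMeasure (N a b t : ℤ) : ℤ → ℤ → ℝ :=
  (exists_dirichlet N a b t (fun x _ => if b ≤ x then 1 else 0) fun _ _ => 0).choose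

lemma stripLap_wallMeasure {x y : ℤ} (h : (x, y) ∈ slitDomain N a b t) :
    stripLap N (wallMeasure N a b t) x y = 0 :=
  (exists_dirichlet N a b t _ _).choose_spec.1 x y h

lemma wallMeasure_of_notMem {x y : ℤ} (h : (x, y) ∉ slitDomain N a b t) :
    wallMeasure N a b t x y = if b ≤ x then 1 else 0 :=
  (exists_dirichlet N a b t _ _).choose_spec.2 x y h

end DirichletProblem

section WallRatio

variable {N a b t : ℤ}

lemma stripLap_affine (N : ℤ) (c d : ℝ) (x y : ℤ) :
    stripLap N (fun x _ => c * x + d) x y = 0 := by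
  simp only [stripLap]
  push_cast
  split_ifs <;> ring

lemma wallMeasure_nonneg {x y : ℤ} (hax : a ≤ x) (hxb : x ≤ b) (hy : -N ≤ y)
    (hy' : y ≤ N) : 0 ≤ wallMeasure N a b t x y := by
  refine nonneg_of_stripLap (fun x y h => (stripLap_wallMeasure h).ge) (fun x y _ _ _ _ h => ?_)
    hax hxb hy hy'
  rw [wallMeasure_of_notMem h]
  split_ifs <;> norm_num

lemma wallMeasure_le_one {x y : ℤ} (hax : a ≤ x) (hxb : x ≤ b) (hy : -N ≤ y)
    (hy' : y ≤ N) : wallMeasure N a b t x y ≤ 1 := by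
  refine le_of_stripLap_le (N := N) (a := a) (b := b) (t := t) (F := wallMeasure N a b t)
    (G := fun _ _ => 1) (fun x y h => ?_) (fun x y _ _ _ _ h => ?_) hax hxb hy hy'
  · rw [stripLap_wallMeasure h]
    simp [stripLap]
  · rw [wallMeasure_of_notMem h]
    split_ifs <;> norm_num

lemma le_wallMeasure (hat : a ≤ t) (htb : t < b) {x y : ℤ} (hax : a ≤ x) (hxb : x ≤ b)
    (hy : -N ≤ y) (hy' : y ≤ N) : ((x : ℝ) - t) / (b - t) ≤ wallMeasure N a b t x y := by
  have hbt : (0 : ℝ) < b - t := by rw [sub_pos]; exact_mod_cast htb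
  have key := le_of_stripLap_le (N := N) (a := a) (b := b) (t := t) (G := wallMeasure N a b t)
    (F := fun x _ => (1 / ((b : ℝ) - t)) * x + (-t / (b - t))) (fun x y h => ?_)
    (fun x y h1 h2 h3 h4 h => ?_) hax hxb hy hy'
  · convert key using 1
    ring
  · rw [stripLap_wallMeasure h, stripLap_affine]
  · rw [wallMeasure_of_notMem h]
    have e : (1 / ((b : ℝ) - t)) * x + (-t / (b - t)) = (x - t) / (b - t) := by ring
    change (1 / ((b : ℝ) - t)) * x + (-t / (b - t)) ≤ _
    rw [e]
    split_ifs with hb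
    · rw [div_le_one hbt]
      have : (x : ℝ) ≤ b := by exact_mod_cast h2
      linarith
    · apply div_nonpos_of_nonpos_of_nonneg _ hbt.le
      have : x ≤ t := by
        rw [mem_slitDomain] at h
        by_contra h5
        apply h
        omega
      have : (x : ℝ) ≤ t := by exact_mod_cast this
      linarith

lemma wallMeasure_le (hab : a < b) {x y : ℤ} (hax : a ≤ x) (hxb : x ≤ b) (hy : -N ≤ y)
    (hy' : y ≤ N) : wallMeasure N a b t x y ≤ ((x : ℝ) - a) / (b - a) := by
  have hba : (0 : ℝ) < b - a := by rw [sub_pos]; exact_mod_cast hab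
  have key := le_of_stripLap_le (N := N) (a := a) (b := b) (t := t) (F := wallMeasure N a b t)
    (G := fun x _ => (1 / ((b : ℝ) - a)) * x + (-a / (b - a))) (fun x y h => ?_)
    (fun x y h1 h2 h3 h4 h => ?_) hax hxb hy hy'
  · convert key using 1
    ring
  · rw [stripLap_wallMeasure h, stripLap_affine]
  · rw [wallMeasure_of_notMem h]
    have e : (1 / ((b : ℝ) - a)) * x + (-a / (b - a)) = (x - a) / (b - a) := by ring
    change _ ≤ (1 / ((b : ℝ) - a)) * x + (-a / (b - a))
    rw [e]
    have ha : (a : ℝ) ≤ x := by exact_mod_cast h1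
    split_ifs with hb
    · rw [one_le_div hba]
      have : (b : ℝ) ≤ x := by exact_mod_cast hb
      linarith
    · exact div_nonneg (by linarith) hba.le

lemma mem_slitDomain_shift {x y : ℤ} :
    (x + 1, y) ∈ slitDomain N a b (t + 1) ↔ (x, y) ∈ slitDomain N (a - 1) (b - 1) t := by
  rw [mem_slitDomain, mem_slitDomain]; omega

lemma stripLap_wallMeasure_shift {x y : ℤ} (h : (x, y) ∈ slitDomain N (a - 1) (b - 1) t) :
    stripLap N (fun x y => wallMeasure N a b (t + 1) (x + 1) y) x y = 0 := by
  rw [stripLap_shift, stripLap_wallMeasure (mem_slitDomain_shift.2 h)]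

lemma wallMeasure_tip_pos (hN : 0 ≤ N) (hat : a ≤ t) (htb : t < b) :
    0 < wallMeasure N a b t (t + 1) 0 := by
  refine lt_of_lt_of_le ?_ (le_wallMeasure hat htb (by omega) (by omega) (by omega) hN)
  have hbt : (0 : ℝ) < b - t := by rw [sub_pos]; exact_mod_cast htb
  push_cast
  apply div_pos _ hbt
  linarith

/-- Moving the slit to the right increases the harmonic measure at its tip. -/
lemma wallMeasure_tip_le (hN : 0 ≤ N) (hat : a < t) (htb : t + 2 ≤ b) :
    wallMeasure N a b t (t + 1) 0 ≤ wallMeasure N a b (t + 1) (t + 1 + 1) 0 := by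
  refine le_of_stripLap_le (N := N) (a := a) (b := b - 1) (t := t) (F := wallMeasure N a b t)
    (G := fun x y => wallMeasure N a b (t + 1) (x + 1) y) (fun x y h => ?_)
    (fun x y h1 h2 h3 h4 h => ?_) (by omega) (by omega) (by omega) hN
  · rw [stripLap_wallMeasure_shift, stripLap_wallMeasure] <;> rw [mem_slitDomain] at * <;> omega
  · rcases eq_or_lt_of_le h2 with rfl | h2'
    · have : wallMeasure N a b (t + 1) (b - 1 + 1) y = 1 := by
        rw [wallMeasure_of_notMem (by rw [mem_slitDomain]; omega), if_pos (by omega)]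
      rw [this]
      exact wallMeasure_le_one (by omega) (by omega) h3 h4
    · rw [wallMeasure_of_notMem (by rw [mem_slitDomain] at *; omega), if_neg (by omega)]
      exact wallMeasure_nonneg (by omega) (by omega) h3 h4

/-- Moving the slit to the right increases the harmonic measure at its tip only slightly. -/
lemma wallMeasure_tip_shift_le (hN : 0 ≤ N) (hat : a < t) (htb : t + 2 ≤ b) :
    wallMeasure N a b (t + 1) (t + 1 + 1) 0 ≤
      ((b - t : ℝ) / (b - 1 - t) * (1 + (b - 1 - t) / ((b - a) * (t - a)))) *
        wallMeasure N a b t (t + 1) 0 := by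
  have e1 : (0 : ℝ) < t - a := by rw [sub_pos]; exact_mod_cast hat
  have e2 : (1 : ℝ) ≤ b - 1 - t := by
    have : (t : ℝ) + 2 ≤ b := by exact_mod_cast htb
    linarith
  set B : ℝ := 1 / ((b - a) * (t - a)) with hB
  have hBpos : 0 < B := by
    apply one_div_pos.2
    apply mul_pos _ e1
    linarith
  set A : ℝ := (b - t : ℝ) / (b - 1 - t) * (1 + B * (b - 1 - t)) with hA
  have hAeq : (b - t : ℝ) / (b - 1 - t) * (1 + (b - 1 - t) / ((b - a) * (t - a))) = A := by
    rw [hA, hB]; ring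
  rw [hAeq]
  have hApos : 0 < A := by
    apply mul_pos (div_pos _ _) <;> nlinarith
  have key := le_of_stripLap_le (N := N) (a := a) (b := b - 1) (t := t)
    (F := fun x y => wallMeasure N a b (t + 1) (x + 1) y)
    (G := fun x y => A * wallMeasure N a b t x y + (-B * x + B * t)) (fun x y h => ?_)
    (fun x y h1 h2 h3 h4 h => ?_) (x := t + 1) (y := 0) (by omega) (by omega) (by omega) hN
  · refine key.trans ?_
    push_cast
    linarith
  · rw [stripLap_wallMeasure_shift (by rw [mem_slitDomain] at *; omega),
      stripLap_add (fun x y => A * wallMeasure N a b t x y) (fun x y => -B * x + B * t),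
      stripLap_smul, stripLap_wallMeasure (by rw [mem_slitDomain] at *; omega), stripLap_affine]
    simp
  · have hnn := wallMeasure_nonneg (N := N) (a := a) (b := b) (t := t) h1
      (show x ≤ b by omega) h3 h4
    rcases eq_or_lt_of_le h2 with rfl | h2'
    · have h5 := wallMeasure_le_one (N := N) (a := a) (b := b) (t := t + 1)
        (show a ≤ b - 1 + 1 by omega) (by omega) h3 h4
      have h6 := le_wallMeasure (N := N) (a := a) (b := b) (t := t) hat.le (by omega) h1
        (show b - 1 ≤ b by omega) h3 h4
      have h7 : A * (((b - 1 : ℤ) : ℝ) - t) / (b - t) = 1 + B * (b - 1 - t) := by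
        rw [hA]; push_cast
        have : (b : ℝ) - t ≠ 0 := by linarith
        have : (b : ℝ) - 1 - t ≠ 0 := by linarith
        field_simp
      have h8 := mul_le_mul_of_nonneg_left h6 hApos.le
      rw [← mul_div_assoc, h7] at h8
      push_cast
      linarith
    · rcases eq_or_lt_of_le h1 with rfl | h1'
      · have h5 := wallMeasure_le (N := N) (a := a) (b := b) (t := t + 1) (by omega)
          (show a ≤ a + 1 by omega) (by omega) h3 h4
        have h6 : (((a + 1 : ℤ) : ℝ) - a) / (b - a) = B * (t - a) := by
          rw [hB]; push_cast
          have : (b : ℝ) - a ≠ 0 := by linarith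
          field_simp
          ring
        rw [h6] at h5
        have := mul_nonneg hApos.le hnn
        linarith
      · have h5 : y = 0 ∧ x ≤ t := by rw [mem_slitDomain] at h; omega
        have h6 : (x : ℝ) ≤ t := by exact_mod_cast h5.2
        rw [wallMeasure_of_notMem (by rw [mem_slitDomain]; omega), if_neg (by omega)]
        have := mul_nonneg hApos.le hnn
        nlinarith

lemma tendsto_wallMeasure_ratio (t : ℤ) :
    Filter.Tendsto (fun n : ℕ => wallMeasure n (-n - 1) (n + 1) (t + 1) (t + 1 + 1) 0 /
      wallMeasure n (-n - 1) (n + 1) t (t + 1) 0) Filter.atTop (nhds 1) := by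
  have hup : Filter.Tendsto (fun n : ℕ => ((n + 1 - t : ℝ) / (n - t) *
      (1 + (n - t) / ((2 * n + 2) * (n + 1 + t))))) Filter.atTop (nhds 1) := by
    have hcast : Filter.Tendsto (fun n : ℕ => (n : ℝ)) Filter.atTop Filter.atTop :=
      tendsto_natCast_atTop_atTop
    have h1 : Filter.Tendsto (fun n : ℕ => ((n : ℝ) + -t)⁻¹) Filter.atTop (nhds 0) :=
      (Filter.tendsto_atTop_add_const_right _ _ hcast).inv_tendsto_atTop
    have h2 : Filter.Tendsto (fun n : ℕ => (n + (1 + t) : ℝ)⁻¹) Filter.atTop (nhds 0) :=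
      (Filter.tendsto_atTop_add_const_right _ _ hcast).inv_tendsto_atTop
    have h3 : Filter.Tendsto (fun n : ℕ => (2 * n + 2 : ℝ)⁻¹) Filter.atTop (nhds 0) :=
      (Filter.tendsto_atTop_add_const_right _ _
        (hcast.const_mul_atTop two_pos)).inv_tendsto_atTop
    have h4 := (h1.const_add 1).mul
      ((h3.mul ((h2.const_mul (2 * t + 1 : ℝ)).const_sub 1)).const_add 1)
    simp only [mul_zero, sub_zero, add_zero, mul_one] at h4
    refine h4.congr' ?_
    filter_upwards [Filter.eventually_ge_atTop (t.natAbs + 2)] with n hn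
    have e1 : (0 : ℝ) < n - t := by
      have : t < n := by omega
      rw [sub_pos]; exact_mod_cast this
    have e2 : (0 : ℝ) < n + 1 + t := by
      have : 0 < (n : ℤ) + 1 + t := by omega
      exact_mod_cast this
    have e3 : (0 : ℝ) < 2 * n + 2 := by positivity
    rw [← sub_eq_add_neg, ← add_assoc]
    field_simp
    ring
  refine tendsto_of_tendsto_of_tendsto_of_le_of_le' tendsto_const_nhds hup ?_ ?_
  · filter_upwards [Filter.eventually_ge_atTop (t.natAbs + 2)] with n hn
    rw [one_le_div (wallMeasure_tip_pos (by omega) (by omega) (by omega))]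
    exact wallMeasure_tip_le (by omega) (by omega) (by omega)
  · filter_upwards [Filter.eventually_ge_atTop (t.natAbs + 2)] with n hn
    rw [div_le_iff₀ (wallMeasure_tip_pos (by omega) (by omega) (by omega))]
    refine (wallMeasure_tip_shift_le (by omega) (by omega) (by omega)).trans (le_of_eq ?_)
    push_cast
    congr 1
    ring

end WallRatio

section Bridge

lemma sum_mul_lapW_comm {n : ℕ} (f g : GridW n → ℝ) :
    ∑ v, g v * lapW n f v = ∑ v, f v * lapW n g v := by
  classical
  have h : ∀ f g : GridW n → ℝ, ∑ v, g v * lapW n f v =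
      ∑ v, ∑ w, (if (gridW n).Adj v w then g v * f v else 0) -
        ∑ v, ∑ w, (if (gridW n).Adj v w then g v * f w else 0) := by
    intro f g
    rw [← Finset.sum_sub_distrib]
    refine Finset.sum_congr rfl fun v _ => ?_
    rw [lapW, Finset.sum_filter, Finset.mul_sum, ← Finset.sum_sub_distrib]
    refine Finset.sum_congr rfl fun w _ => ?_
    split_ifs <;> ring
  rw [h f g, h g f]
  congr 1
  · simp only [mul_comm]
  · rw [Finset.sum_comm]
    refine Finset.sum_congr rfl fun v _ => Finset.sum_congr rfl fun w _ => ?_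
    simp only [(gridW n).adj_comm w v, mul_comm]

/-- The function on the wired grid given by a function on the lattice that is constant on the
columns `± (n + 1)`. -/
def toW (n : ℕ) (F : ℤ → ℤ → ℝ) (v : GridW n) : ℝ :=
  match v.1 with
  | Sum.inl p => F p.1 p.2
  | Sum.inr b => F (wireX (n + 1) b) 0

/-- The grid vertex at a lattice point of `{-n-1,…,n+1} × {-n,…,n}`, the extreme columns being
collapsed to the wired vertices. -/
noncomputable def ofPt (n : ℕ) (p : ℤ × ℤ) : GridW n :=
  open Classical in
  if h : (Sum.inl p : GridV) ∈ gridVerts n then ⟨Sum.inl p, h⟩ else wireW n (decide (0 < p.1))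

lemma ofPt_of_abs_le {n : ℕ} {x y : ℤ} (hx : |x| ≤ n) (hy : |y| ≤ n) :
    (ofPt n (x, y)).1 = Sum.inl (x, y) := by
  rw [ofPt, dif_pos (mem_gridVerts_inl.2 ⟨hx, hy⟩)]

lemma ofPt_wireX {n : ℕ} (b : Bool) (y : ℤ) : ofPt n (wireX (n + 1) b, y) = wireW n b := by
  rw [ofPt, dif_neg]
  · congr 1
    cases b <;> simp [wireX]
  · rw [mem_gridVerts_inl]
    cases b <;> simp [wireX] <;> intro h <;> exfalso
    · rw [abs_le] at h; omega
    · rw [abs_le] at h; omega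

lemma sum_adj_lattice {n : ℕ} {v : GridW n} {x y : ℤ} (hv : v.1 = Sum.inl (x, y))
    (φ : GridW n → ℝ) : open Classical in ∑ w ∈ Finset.univ.filter ((gridW n).Adj v), φ w =
      φ (ofPt n (x - 1, y)) + φ (ofPt n (x + 1, y)) +
        (if y < n then φ (ofPt n (x, y + 1)) else 0) +
        (if -(n : ℤ) < y then φ (ofPt n (x, y - 1)) else 0) := by
  classical
  have hv' := v.2
  rw [hv, mem_gridVerts_inl, abs_le, abs_le] at hv'
  set Q : Finset (ℤ × ℤ) := (({(x - 1, y), (x + 1, y), (x, y + 1), (x, y - 1)} :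
    Finset (ℤ × ℤ)).filter fun p => -(n : ℤ) ≤ p.2 ∧ p.2 ≤ n) with hQ
  have hQm : ∀ a b, (a, b) ∈ Q ↔ (-(n : ℤ) ≤ b ∧ b ≤ n) ∧ NN (x, y) (a, b) := by
    intro a b
    simp only [hQ, Finset.mem_filter, Finset.mem_insert, Finset.mem_singleton, Prod.mk.injEq, NN]
    omega
  have hcase : ∀ a b, (a, b) ∈ Q → (|a| ≤ n ∧ |b| ≤ n) ∨ ∃ c, a = wireX (n + 1) c := by
    intro a b h
    rw [hQm] at h
    rw [abs_le, abs_le]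
    by_cases ha : -(n : ℤ) ≤ a ∧ a ≤ n
    · exact Or.inl ⟨ha, h.1⟩
    · right
      simp only [NN] at h
      by_cases h0 : a = n + 1
      · exact ⟨true, by simp [wireX, h0]⟩
      · exact ⟨false, by simp [wireX]; omega⟩
  have himg : Finset.univ.filter ((gridW n).Adj v) = Q.image (ofPt n) := by
    ext w
    simp only [Finset.mem_filter, Finset.mem_univ, true_and, Finset.mem_image]
    constructor
    · intro h
      change (gridGraph n).Adj v.1 w.1 at h
      rcases inl_or_wireW w with ⟨⟨a, b⟩, hw⟩ | ⟨b, rfl⟩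
      · have h1 := v.2
        have h2 := w.2
        rw [hv] at h1 h
        rw [hw] at h2 h
        rw [gridGraph_adj_inl_inl h1 h2] at h
        rw [mem_gridVerts_inl] at h2
        refine ⟨(a, b), (hQm a b).2 ⟨abs_le.1 h2.2, h⟩, ?_⟩
        apply Subtype.ext
        rw [ofPt_of_abs_le h2.1 h2.2, hw]
      · rw [hv] at h
        change (gridGraph n).Adj _ (Sum.inr b) at h
        rw [SimpleGraph.adj_comm, gridGraph_adj_inr_inl] at h
        refine ⟨(wireX (n + 1) b, y), (hQm _ _).2 ⟨hv'.2, ?_⟩, ofPt_wireX b y⟩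
        have := h.2
        simp only [NN]
        cases b <;> simp [wireX] at this ⊢ <;> omega
    · rintro ⟨⟨a, b⟩, hab, rfl⟩
      change (gridGraph n).Adj v.1 (ofPt n (a, b)).1
      have h1 := v.2
      have h2 := (ofPt n (a, b)).2
      rw [hv] at h1 ⊢
      rcases hcase a b hab with ⟨ha, hb⟩ | ⟨c, rfl⟩
      · rw [ofPt_of_abs_le ha hb] at h2 ⊢
        rw [gridGraph_adj_inl_inl h1 h2]
        exact ((hQm _ _).1 hab).2
      · rw [ofPt_wireX]
        change (gridGraph n).Adj _ (Sum.inr c)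
        rw [SimpleGraph.adj_comm, gridGraph_adj_inr_inl, abs_le]
        have := ((hQm _ _).1 hab).2
        simp only [NN] at this
        refine ⟨hv'.2, ?_⟩
        cases c <;> simp [wireX] at this ⊢ <;> omega
  have hinj : Set.InjOn (ofPt n) Q := by
    rintro ⟨a, b⟩ hab ⟨a', b'⟩ hab' h
    rcases hcase a b hab with ⟨ha, hb⟩ | ⟨c, rfl⟩ <;>
      rcases hcase a' b' hab' with ⟨ha', hb'⟩ | ⟨c', rfl⟩
    · have := congrArg Subtype.val h
      rw [ofPt_of_abs_le ha hb, ofPt_of_abs_le ha' hb'] at this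
      exact Sum.inl.inj this
    · have := congrArg Subtype.val h
      rw [ofPt_of_abs_le ha hb, ofPt_wireX] at this
      simp [wireW] at this
    · have := congrArg Subtype.val h
      rw [ofPt_of_abs_le ha' hb', ofPt_wireX] at this
      simp [wireW] at this
    · rw [ofPt_wireX, ofPt_wireX] at h
      have := congrArg Subtype.val h
      simp only [wireW, Sum.inr.injEq] at this
      subst this
      have h1 := ((hQm _ _).1 hab).2
      have h2 := ((hQm _ _).1 hab').2
      simp only [NN] at h1 h2
      rw [Prod.mk.injEq]
      refine ⟨rfl, ?_⟩
      cases c <;> simp [wireX] at h1 h2 <;> omega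
  rw [himg, Finset.sum_image hinj, hQ, Finset.sum_filter, Finset.sum_insert, Finset.sum_insert,
    Finset.sum_insert, Finset.sum_singleton]
  · simp only [hv'.2, and_self, if_true]
    have e1 : (-(n : ℤ) ≤ y + 1 ∧ y + 1 ≤ n) ↔ y < n := by omega
    have e2 : (-(n : ℤ) ≤ y - 1 ∧ y - 1 ≤ n) ↔ -(n : ℤ) < y := by omega
    simp only [e1, e2]
    ring
  · simp; omega
  · simp
  · simp; omega

lemma toW_ofPt {n : ℕ} {F : ℤ → ℤ → ℝ}
    (hF : ∀ (b : Bool) (y : ℤ), |y| ≤ n → F (wireX (n + 1) b) y = F (wireX (n + 1) b) 0) {x y : ℤ}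
    (hx : |x| ≤ n + 1) (hy : |y| ≤ n) : toW n F (ofPt n (x, y)) = F x y := by
  by_cases h : |x| ≤ n
  · rw [toW, ofPt_of_abs_le h hy]
  · have : ∃ b, x = wireX (n + 1) b := by
      rw [abs_le] at h hx
      by_cases h0 : x = n + 1
      · exact ⟨true, by simp [wireX, h0]⟩
      · exact ⟨false, by simp [wireX]; omega⟩
    obtain ⟨b, rfl⟩ := this
    rw [ofPt_wireX, hF b y hy]
    rfl

lemma lapW_toW {n : ℕ} {F : ℤ → ℤ → ℝ}
    (hF : ∀ (b : Bool) (y : ℤ), |y| ≤ n → F (wireX (n + 1) b) y = F (wireX (n + 1) b) 0)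
    {v : GridW n} {x y : ℤ}
    (hv : v.1 = Sum.inl (x, y)) : lapW n (toW n F) v = stripLap n F x y := by
  have hv' := v.2
  rw [hv, mem_gridVerts_inl, abs_le, abs_le] at hv'
  have hFv : toW n F v = F x y := by rw [toW, hv]
  rw [lapW, sum_adj_lattice hv, toW_ofPt hF, toW_ofPt hF, hFv, stripLap]
  · congr 1
    · congr 1
      split_ifs with h
      · rw [toW_ofPt hF]
        · rw [abs_le]; omega
        · rw [abs_le]; omega
      · rfl
    · split_ifs with h
      · rw [toW_ofPt hF]
        · rw [abs_le]; omega
        · rw [abs_le]; omega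
      · rfl
  all_goals (rw [abs_le]; omega)

end Bridge

section BridgeGreen

variable {n k : ℕ}

lemma wireX_notMem_slitDomain (b : Bool) (y t : ℤ) :
    (wireX (n + 1) b, y) ∉ slitDomain n (-n - 1) (n + 1) t := by
  rw [mem_slitDomain]
  cases b <;> simp [wireX]; omega

lemma inl_abs {v : GridW n} {x y : ℤ} (hv : v.1 = Sum.inl (x, y)) :
    (-(n : ℤ) ≤ x ∧ x ≤ n) ∧ -(n : ℤ) ≤ y ∧ y ≤ n := by
  have hv' := v.2
  rwa [hv, mem_gridVerts_inl, abs_le, abs_le] at hv'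

lemma mem_slitDomain_of_inl {v : GridW n} {x y t : ℤ} (hv : v.1 = Sum.inl (x, y))
    (h : y = 0 → t < x) : (x, y) ∈ slitDomain n (-n - 1) (n + 1) t := by
  have := inl_abs hv
  rw [mem_slitDomain]; omega

lemma lapW_tipGreen {t : ℤ} {v : GridW n} {x y : ℤ} (hv : v.1 = Sum.inl (x, y))
    (h : y = 0 → t < x) : lapW n (toW n (tipGreen n (-n - 1) (n + 1) t)) v =
      if x = t + 1 ∧ y = 0 then 1 else 0 := by
  rw [lapW_toW _ hv, stripLap_tipGreen (mem_slitDomain_of_inl hv h)]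
  intro b y _
  rw [tipGreen_of_notMem (wireX_notMem_slitDomain b y t),
    tipGreen_of_notMem (wireX_notMem_slitDomain b 0 t)]

lemma lapW_wallMeasure {t : ℤ} {v : GridW n} {x y : ℤ} (hv : v.1 = Sum.inl (x, y))
    (h : y = 0 → t < x) : lapW n (toW n (wallMeasure n (-n - 1) (n + 1) t)) v = 0 := by
  rw [lapW_toW _ hv, stripLap_wallMeasure (mem_slitDomain_of_inl hv h)]
  intro b y _
  rw [wallMeasure_of_notMem (wireX_notMem_slitDomain b y t),
    wallMeasure_of_notMem (wireX_notMem_slitDomain b 0 t)]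

lemma toW_tipGreen_wireW (b : Bool) (t : ℤ) :
    toW n (tipGreen n (-n - 1) (n + 1) t) (wireW n b) = 0 :=
  tipGreen_of_notMem (wireX_notMem_slitDomain b 0 t)

lemma toW_wallMeasure_wireW (b : Bool) (t : ℤ) :
    toW n (wallMeasure n (-n - 1) (n + 1) t) (wireW n b) = if b then 1 else 0 := by
  refine (wallMeasure_of_notMem (wireX_notMem_slitDomain b 0 t)).trans ?_
  cases b <;> simp [wireX]
  omega

lemma slitFun_tipGreen {t : ℤ} (h : (k : ℤ) ≤ t) :
    SlitFun n k (toW n (tipGreen n (-n - 1) (n + 1) t)) where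
  refl := by
    intro v
    obtain ⟨⟨x, y⟩ | b, hv⟩ := v
    · exact tipGreen_neg x y
    · rfl
  wire b := toW_tipGreen_wireW b t
  slit := by
    intro v x hv hx
    rw [toW, hv]
    exact tipGreen_of_notMem (by rw [mem_slitDomain]; omega)

lemma lapW_tipGreen_wireW {j : ℕ} (hj : j + 1 ≤ n) :
    lapW n (toW n (tipGreen n (-n - 1) (n + 1) j)) (wireW n true) =
      -wallMeasure n (-n - 1) (n + 1) j (j + 1) 0 := by
  classical
  set G := toW n (tipGreen n (-n - 1) (n + 1) j) with hG
  set h := toW n (wallMeasure n (-n - 1) (n + 1) j) with hh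
  have hgreen := sum_mul_lapW_comm G h
  have h0 : ∑ v, G v * lapW n h v = 0 := by
    refine Finset.sum_eq_zero fun v _ => ?_
    rcases inl_or_wireW v with ⟨⟨x, y⟩, hv⟩ | ⟨b, rfl⟩
    · by_cases hxy : y = 0 → (j : ℤ) < x
      · rw [hh, lapW_wallMeasure hv hxy, mul_zero]
      · push Not at hxy
        obtain ⟨rfl, hx⟩ := hxy
        rw [hG, (slitFun_tipGreen (n := n) (k := j) le_rfl).slit v x hv hx, zero_mul]
    · rw [hG, toW_tipGreen_wireW, zero_mul]
  have hne : wireW n true ≠ segW n (j + 1) := wireW_ne_segW _ _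
  have hval := segW_val hj
  push_cast at hval
  have h1 : ∑ v, h v * lapW n G v =
      lapW n G (wireW n true) + wallMeasure n (-n - 1) (n + 1) j (j + 1) 0 := by
    rw [← Finset.sum_subset (Finset.subset_univ {wireW n true, segW n (j + 1)}),
      Finset.sum_pair hne]
    · congr 1
      · rw [hh, toW_wallMeasure_wireW, if_pos rfl, one_mul]
      · rw [hG, lapW_tipGreen hval (by omega), if_pos ⟨rfl, rfl⟩, mul_one, hh, toW, hval]
    · intro v _ hv
      simp only [Finset.mem_insert, Finset.mem_singleton, not_or] at hv
      rcases inl_or_wireW v with ⟨⟨x, y⟩, hxy⟩ | ⟨b, rfl⟩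
      · by_cases hslit : y = 0 → (j : ℤ) < x
        · rw [hG, lapW_tipGreen hxy hslit, if_neg, mul_zero]
          rintro ⟨rfl, rfl⟩
          exact hv.2 (Subtype.ext (hxy.trans hval.symm))
        · push Not at hslit
          obtain ⟨rfl, hx⟩ := hslit
          have := inl_abs hxy
          rw [hh, toW, hxy]
          simp only
          rw [wallMeasure_of_notMem (by rw [mem_slitDomain]; omega), if_neg (by omega), zero_mul]
      · cases b
        · rw [hh, toW_wallMeasure_wireW, if_neg (by simp), zero_mul]
        · exact absurd rfl hv.1
  linarith

/-- The ratio of consecutive run counts in terms of the tip Green function and the harmonic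
measure of the right wall. -/
lemma runCount_succ_mul (hk : k + 2 ≤ n) :
    runCount n (k + 1) * wallMeasure n (-n - 1) (n + 1) k (k + 1) 0 =
      runCount n k * (tipGreen n (-n - 1) (n + 1) k (k + 1) 0 *
        wallMeasure n (-n - 1) (n + 1) (k + 1) (k + 1 + 1) 0) := by
  have hv1 := segW_val (show k + 1 ≤ n by omega)
  have hv2 := segW_val hk
  push_cast at hv1 hv2
  have h1 := (slitFun_tipGreen (n := n) (k := k) (t := k) le_rfl).runCount_relation hk
    (fun v x y hv h => by
      rw [lapW_tipGreen hv (by omega), if_neg (by omega)])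
  rw [lapW_tipGreen_wireW (by omega), lapW_tipGreen hv2 (by omega), if_neg (by omega),
    toW, hv1] at h1
  have h2 := (slitFun_tipGreen (n := n) (k := k) (t := (k + 1 : ℕ)) (by omega)).runCount_relation hk
    (fun v x y hv h => by
      rw [lapW_tipGreen hv (by omega), if_neg (by omega)])
  rw [lapW_tipGreen_wireW hk, lapW_tipGreen hv2 (by omega), if_pos (by omega),
    toW, hv1] at h2
  simp only at h1 h2
  rw [tipGreen_of_notMem (by rw [mem_slitDomain]; omega)] at h2
  push_cast at h1 h2
  linear_combination (wallMeasure n (-n - 1) (n + 1) k (k + 1) 0) * h2 -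
    (wallMeasure n (-n - 1) (n + 1) (k + 1) (k + 1 + 1) 0) * h1

end BridgeGreen

section Positivity

/-- The parent map of the comb: vertical teeth lead to the horizontal axis, which leads to the
origin. -/
def combParent (n : ℕ) : GridV → GridV
  | Sum.inl p => Sum.inl (if p.2 = 0 then (p.1 - p.1.sign, 0) else (p.1, p.2 - p.2.sign))
  | Sum.inr b => Sum.inl (wireX n b, 0)

lemma sign_cases (x : ℤ) : (x = 0 ∧ x.sign = 0) ∨ (0 < x ∧ x.sign = 1) ∨ (x < 0 ∧ x.sign = -1) := by
  rcases lt_trichotomy x 0 with h | h | h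
  · exact Or.inr (Or.inr ⟨h, Int.sign_eq_neg_one_of_neg h⟩)
  · exact Or.inl ⟨h, by rw [h]; rfl⟩
  · exact Or.inr (Or.inl ⟨h, Int.sign_eq_one_of_pos h⟩)

lemma combParent_mem {n : ℕ} (v : GridW n) : combParent n v.1 ∈ gridVerts n := by
  obtain ⟨⟨x, y⟩ | b, hv⟩ := v
  · rw [mem_gridVerts_inl, abs_le, abs_le] at hv
    have hx := sign_cases x
    have hy := sign_cases y
    simp only [combParent]
    split_ifs <;> rw [mem_gridVerts_inl, abs_le, abs_le] <;> simp only at * <;> omega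
  · simp only [combParent]
    rw [mem_gridVerts_inl, abs_le, abs_le]
    cases b <;> simp [wireX]

/-- The comb as a parent function on the wired grid. -/
def comb (n : ℕ) (v : GridW n) : GridW n := ⟨combParent n v.1, combParent_mem v⟩

lemma comb_segW_zero (n : ℕ) : comb n (segW n 0) = segW n 0 := by
  apply Subtype.ext
  change combParent n (segW n 0).1 = _
  rw [segW_val (Nat.zero_le _)]
  rfl

lemma comb_segW_succ {n j : ℕ} (hj : j + 1 ≤ n) : comb n (segW n (j + 1)) = segW n j := by
  apply Subtype.ext
  change combParent n (segW n (j + 1)).1 = _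
  rw [segW_val hj, segW_val (by omega)]
  have := sign_cases ((j + 1 : ℕ) : ℤ)
  simp only [combParent, if_true, Sum.inl.injEq, Prod.mk.injEq, and_true]
  omega

lemma comb_adj {n : ℕ} {v : GridW n} (hv : v ≠ segW n 0) : (gridW n).Adj v (comb n v) := by
  change (gridGraph n).Adj v.1 (combParent n v.1)
  have h2 := combParent_mem v
  obtain ⟨⟨x, y⟩ | b, hv1⟩ := v
  · change (gridGraph n).Adj (Sum.inl _) (Sum.inl _)
    rw [gridGraph_adj_inl_inl hv1 h2]
    have hx := sign_cases x
    have hy := sign_cases y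
    have h0 : ¬ (x = 0 ∧ y = 0) := by
      rintro ⟨rfl, rfl⟩
      exact hv (Subtype.ext (segW_val (Nat.zero_le _)).symm)
    by_cases hy0 : y = 0
    · simp only [NN, hy0, if_true, true_and]; omega
    · simp only [NN, hy0, if_false, true_and]; omega
  · change (gridGraph n).Adj (Sum.inr _) (Sum.inl _)
    rw [gridGraph_adj_inr_inl]
    simp

lemma comb_isRooted (n : ℕ) : IsRooted (comb n) (segW n 0) := by
  refine ⟨comb_segW_zero n, ?_⟩
  have hlat : ∀ (N : ℕ) (v : GridW n) (x y : ℤ), v.1 = Sum.inl (x, y) → x.natAbs + y.natAbs ≤ N →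
      ∃ m, (comb n)^[m] v = segW n 0 := by
    intro N
    induction N with
    | zero =>
      intro v x y hv h
      refine ⟨0, Subtype.ext ?_⟩
      rw [segW_val (Nat.zero_le _)]
      change v.1 = _
      rw [hv]
      simp only [Sum.inl.injEq, Prod.mk.injEq]
      omega
    | succ N ih =>
      intro v x y hv h
      have hx := sign_cases x
      have hy := sign_cases y
      have hc : (comb n v).1 = Sum.inl (if y = 0 then (x - x.sign, 0) else (x, y - y.sign)) := by
        change combParent n v.1 = _
        rw [hv, combParent]
      by_cases h0 : y = 0
      · rw [if_pos h0] at hc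
        obtain ⟨m, hm⟩ := ih _ _ _ hc (by omega)
        exact ⟨m + 1, hm⟩
      · rw [if_neg h0] at hc
        obtain ⟨m, hm⟩ := ih _ _ _ hc (by omega)
        exact ⟨m + 1, hm⟩
  intro v
  rcases inl_or_wireW v with ⟨⟨x, y⟩, hv⟩ | ⟨b, rfl⟩
  · exact hlat _ v x y hv le_rfl
  · obtain ⟨m, hm⟩ := hlat _ (comb n (wireW n b)) _ _ rfl le_rfl
    exact ⟨m + 1, hm⟩

lemma runCount_zero_pos {n : ℕ} (hn : 1 ≤ n) : 0 < runCount n 0 := by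
  classical
  rw [runCount, ← card_trunkContains_eq_det (by omega),
    card_trunkContains_eq (segW n) (segW_injOn (by omega)) (segW_adj (by omega))
      (l := wireW n false) (r := wireW n true) _ rfl rfl]
  swap
  · intro j hj
    rw [segW_val (by omega), segW_val (by omega), hEdge]
    push_cast
    rfl
  have hruns : ∀ k, k + 1 ≤ n → RunsDown (comb n) (segW n) k := fun k hk =>
    ⟨comb_segW_zero n, fun j hj => comb_segW_succ (by omega)⟩
  have hleft : ∀ m, (comb n)^[m] (wireW n false) ≠ segW n 1 := by
    have key : ∀ m, ((comb n)^[m] (wireW n false)).1 = Sum.inr false ∨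
        ∃ x : ℤ, x ≤ 0 ∧ ((comb n)^[m] (wireW n false)).1 = Sum.inl (x, 0) := by
      intro m
      induction m with
      | zero => exact Or.inl rfl
      | succ m ih =>
        rw [Function.iterate_succ_apply']
        change combParent n _ = _ ∨ ∃ x : ℤ, x ≤ 0 ∧ combParent n _ = _
        right
        rcases ih with h | ⟨x, hx, h⟩
        · exact ⟨wireX n false, by simp [wireX], by rw [h]; rfl⟩
        · have := sign_cases x
          exact ⟨x - x.sign, by omega, by rw [h]; rfl⟩
    intro m h
    have h1 := segW_val hn
    rcases key m with h2 | ⟨x, hx, h2⟩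
    · rw [h, h1] at h2
      exact absurd h2 (by simp)
    · rw [h, h1] at h2
      simp only [Sum.inl.injEq, Prod.mk.injEq] at h2
      omega
  have hright : ∃ m, (comb n)^[m] (wireW n true) = segW n 1 := by
    refine ⟨(n - 1) + 1, ?_⟩
    rw [Function.iterate_succ_apply]
    have h1 : comb n (wireW n true) = segW n n := by
      apply Subtype.ext
      rw [segW_val le_rfl]
      change Sum.inl _ = _
      simp [wireX]
    rw [h1, (hruns (n - 1) (by omega)).iterate (n - 1) (by omega)]
    congr 1
    omega
  have : Nonempty {g : GridW n → GridW n // (∀ v ∉ segPoints (segW n) 0, (gridW n).Adj v (g v)) ∧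
      RunsDown g (segW n) 0 ∧
      IsLinked g (segPoints (segW n) 0) (segW n 0) (segW n (0 + 1)) (wireW n false)
        (wireW n true)} := by
    refine ⟨comb n, fun v hv => comb_adj ?_, hruns 0 hn, ?_⟩
    · rintro rfl
      exact hv (mem_segPoints.2 ⟨0, by omega, rfl⟩)
    · rw [(hruns 0 hn).isLinked_iff (segW_injOn hn)]
      refine ⟨comb_isRooted n, fun j hj => ?_⟩
      obtain rfl : j = 0 := by omega
      exact Or.inr ⟨hright, fun ⟨m, hm⟩ => hleft m hm⟩
  exact Nat.cast_pos.2 Nat.card_pos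

end Positivity

section SlitGreen

open Complex (I)
open scoped ComplexConjugate FourierTransform

/-- The point of the unit circle at angle `θ`. -/
noncomputable def unitPt (θ : ℝ) : ℂ := Complex.exp (θ * I)

/-- The constant `√2 - 1`. -/
noncomputable def sqrtTwoSubOne : ℝ := Real.sqrt 2 - 1

local notation "β" => sqrtTwoSubOne
local notation "J" => Set.Ioo (0 : ℝ) (2 * Real.pi)

lemma sqrtTwoSubOne_sq : β ^ 2 = 1 - 2 * β := by
  have := Real.sq_sqrt (show (0 : ℝ) ≤ 2 by norm_num)
  rw [sqrtTwoSubOne]; linarith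

lemma sqrtTwoSubOne_pos : 0 < β := by
  rw [sqrtTwoSubOne, sub_pos]
  exact Real.lt_sqrt_of_sq_lt (by norm_num)

lemma sqrtTwoSubOne_lt : β < 1 / 2 := by
  nlinarith [sqrtTwoSubOne_sq, sqrtTwoSubOne_pos]

lemma norm_unitPt (θ : ℝ) : ‖unitPt θ‖ = 1 := Complex.norm_exp_ofReal_mul_I θ

lemma unitPt_ne_zero (θ : ℝ) : unitPt θ ≠ 0 := Complex.exp_ne_zero _

lemma continuous_unitPt : Continuous unitPt := by unfold unitPt; fun_prop

lemma conj_unitPt (θ : ℝ) : conj (unitPt θ) = (unitPt θ)⁻¹ := by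
  rw [Complex.inv_def, Complex.normSq_eq_norm_sq, norm_unitPt]; simp

lemma unitPt_add_inv (θ : ℝ) : unitPt θ + (unitPt θ)⁻¹ = 2 * Real.cos θ := by
  rw [unitPt, ← Complex.exp_neg, Complex.ofReal_cos, Complex.cos]; ring_nf

lemma norm_one_sub_smul_sq (c θ : ℝ) :
    ‖1 - (c : ℂ) * unitPt θ‖ ^ 2 = 1 + c ^ 2 - 2 * c * Real.cos θ := by
  rw [← Complex.normSq_eq_norm_sq, unitPt, Complex.exp_mul_I, Complex.normSq_apply,
    ← Complex.ofReal_cos, ← Complex.ofReal_sin]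
  simp only [Complex.sub_re, Complex.sub_im, Complex.mul_re, Complex.mul_im, Complex.add_re,
    Complex.add_im, Complex.ofReal_re, Complex.ofReal_im, Complex.I_re, Complex.I_im,
    Complex.one_re, Complex.one_im]
  linear_combination c ^ 2 * Real.sin_sq_add_cos_sq θ

lemma norm_one_sub_unitPt_sq (θ : ℝ) : ‖1 - unitPt θ‖ ^ 2 = 2 - 2 * Real.cos θ := by
  have := norm_one_sub_smul_sq 1 θ
  rw [Complex.ofReal_one, one_mul] at this
  rw [this]; ring

lemma cos_lt_one_of_mem {θ : ℝ} (h : θ ∈ J) : Real.cos θ < 1 := by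
  refine lt_of_le_of_ne (Real.cos_le_one θ) fun h1 => ?_
  rw [Real.cos_eq_one_iff_of_lt_of_lt (by linarith [h.1, Real.pi_pos]) h.2] at h1
  exact h.1.ne' h1

lemma norm_one_sub_unitPt_pos {θ : ℝ} (h : θ ∈ J) : 0 < ‖1 - unitPt θ‖ := by
  have h1 := norm_one_sub_unitPt_sq θ
  have h2 := cos_lt_one_of_mem h
  refine lt_of_le_of_ne (norm_nonneg _) fun h0 => ?_
  rw [← h0] at h1
  linarith

/-- The decay rate of the lattice harmonic functions of horizontal frequency `θ`. -/
noncomputable def decay (θ : ℝ) : ℝ := 2 - Real.cos θ - Real.sqrt ((2 - Real.cos θ) ^ 2 - 1)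

lemma decay_aux (θ : ℝ) : Real.sqrt ((2 - Real.cos θ) ^ 2 - 1) ^ 2 = (2 - Real.cos θ) ^ 2 - 1 :=
  Real.sq_sqrt (by nlinarith [Real.cos_le_one θ])

lemma decay_sq (θ : ℝ) : decay θ ^ 2 = (4 - 2 * Real.cos θ) * decay θ - 1 := by
  have := decay_aux θ
  rw [decay]; linarith

lemma decay_pos (θ : ℝ) : 0 < decay θ := by
  rw [decay, sub_pos]
  refine (Real.sqrt_lt' (by linarith [Real.cos_le_one θ])).2 (by linarith)

lemma decay_le_one (θ : ℝ) : decay θ ≤ 1 := by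
  have h := decay_aux θ
  have := Real.sqrt_nonneg ((2 - Real.cos θ) ^ 2 - 1)
  have := Real.cos_le_one θ
  rw [decay]
  nlinarith

lemma decay_lt_one {θ : ℝ} (h : θ ∈ J) : decay θ < 1 := by
  refine lt_of_le_of_ne (decay_le_one θ) fun h1 => ?_
  have := decay_sq θ
  rw [h1] at this
  linarith [cos_lt_one_of_mem h]

lemma continuous_decay : Continuous decay := by unfold decay; fun_prop

lemma sqrtTwoSubOne_mul_decay (θ : ℝ) : β * (4 - 2 * Real.cos θ - 2 * decay θ) =
    ‖1 - unitPt θ‖ * ‖1 - ((β ^ 2 : ℝ) : ℂ) * unitPt θ‖ := by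
  have hs := Real.sqrt_nonneg ((2 - Real.cos θ) ^ 2 - 1)
  have hβ := sqrtTwoSubOne_pos
  have e : 4 - 2 * Real.cos θ - 2 * decay θ = 2 * Real.sqrt ((2 - Real.cos θ) ^ 2 - 1) := by
    rw [decay]; ring
  rw [e]
  rw [← sq_eq_sq₀ (by positivity) (by positivity), mul_pow, mul_pow, mul_pow, decay_aux,
    norm_one_sub_unitPt_sq, norm_one_sub_smul_sq]
  have h4 : 1 + (β ^ 2) ^ 2 = 6 * β ^ 2 := by
    nlinarith [sqrtTwoSubOne_sq]
  rw [h4]; ring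

/-- The function `((1 - z) (1 - β² z)) ^ c` on the unit disc. -/
noncomputable def slitPow (c : ℝ) (z : ℂ) : ℂ :=
  (1 - z) ^ (c : ℂ) * (1 - ((β ^ 2 : ℝ) : ℂ) * z) ^ (c : ℂ)

lemma slitPow_zero (c : ℝ) : slitPow c 0 = 1 := by simp [slitPow]

lemma one_sub_mem_slitPlane {z : ℂ} (h : ‖z‖ ≤ 1) (h1 : z ≠ 1) : 1 - z ∈ Complex.slitPlane := by
  rw [Complex.mem_slitPlane_iff]
  by_contra! h2
  simp at h2
  have h3 := Complex.abs_re_le_norm z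
  have h4 : z.re = 1 := le_antisymm ((le_abs_self _).trans (h3.trans h)) h2.1
  exact h1 (Complex.ext (by simpa using h4) (by simpa using h2.2))

lemma sqrtTwoSubOne_mul_ne {z : ℂ} (h : ‖z‖ ≤ 1) :
    ‖((β ^ 2 : ℝ) : ℂ) * z‖ ≤ 1 / 2 := by
  have := sqrtTwoSubOne_pos
  have := sqrtTwoSubOne_lt
  have h2 : β ^ 2 ≤ 1 / 2 := by nlinarith
  rw [norm_mul, Complex.norm_real, Real.norm_of_nonneg (by positivity)]
  nlinarith [norm_nonneg z]

lemma one_sub_mul_mem_slitPlane {z : ℂ} (h : ‖z‖ ≤ 1) :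
    1 - ((β ^ 2 : ℝ) : ℂ) * z ∈ Complex.slitPlane := by
  have := sqrtTwoSubOne_mul_ne h
  refine one_sub_mem_slitPlane (by linarith) fun h1 => ?_
  rw [h1] at this
  norm_num at this

lemma differentiableAt_slitPow (c : ℝ) {z : ℂ} (h : ‖z‖ ≤ 1) (h1 : z ≠ 1) :
    DifferentiableAt ℂ (slitPow c) z := by
  unfold slitPow
  refine DifferentiableAt.mul ?_ ?_
  · exact DifferentiableAt.cpow (by fun_prop) (by fun_prop) (one_sub_mem_slitPlane h h1)
  · exact DifferentiableAt.cpow (by fun_prop) (by fun_prop) (one_sub_mul_mem_slitPlane h)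

lemma norm_slitPow (c : ℝ) (z : ℂ) :
    ‖slitPow c z‖ = ‖1 - z‖ ^ c * ‖1 - ((β ^ 2 : ℝ) : ℂ) * z‖ ^ c := by
  rw [slitPow, norm_mul, Complex.norm_cpow_real, Complex.norm_cpow_real]

lemma cpow_neg_half_mul_norm {z : ℂ} (hz : z ≠ 0) :
    z ^ ((-(1 / 2) : ℝ) : ℂ) * ‖z‖ = conj (z ^ ((1 / 2 : ℝ) : ℂ)) := by
  have h1 : z ^ ((1 / 2 : ℝ) : ℂ) * conj (z ^ ((1 / 2 : ℝ) : ℂ)) = ‖z‖ := by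
    rw [Complex.mul_conj, Complex.normSq_eq_norm_sq, Complex.norm_cpow_real, ← Real.sqrt_eq_rpow,
      Real.sq_sqrt (norm_nonneg _)]
  have h2 : z ^ ((-(1 / 2) : ℝ) : ℂ) * z ^ ((1 / 2 : ℝ) : ℂ) = 1 := by
    rw [← Complex.cpow_add _ _ hz]; simp
  rw [← h1, ← mul_assoc, h2, one_mul]

lemma slitPow_neg_half_mul {θ : ℝ} (h : θ ∈ J) :
    slitPow (-(1 / 2)) (unitPt θ) * (β * (4 - 2 * Real.cos θ - 2 * decay θ) : ℝ) =
      conj (slitPow (1 / 2) (unitPt θ)) := by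
  have h1 : 1 - unitPt θ ≠ 0 := norm_pos_iff.1 (norm_one_sub_unitPt_pos h)
  have h2 := Complex.slitPlane_ne_zero (one_sub_mul_mem_slitPlane (norm_unitPt θ).le)
  rw [sqrtTwoSubOne_mul_decay, slitPow, slitPow, map_mul, ← cpow_neg_half_mul_norm h1,
    ← cpow_neg_half_mul_norm h2]
  push_cast
  ring

lemma norm_one_sub_unitPt_le {ρ : ℝ} (h0 : 0 ≤ ρ) (h1 : ρ ≤ 1) (θ : ℝ) :
    ‖1 - unitPt θ‖ ≤ 2 * ‖1 - ρ * unitPt θ‖ := by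
  have e : 1 - unitPt θ = (1 - ρ * unitPt θ) - (1 - ρ : ℝ) * unitPt θ := by push_cast; ring
  have a1 : ‖1 - unitPt θ‖ ≤ ‖1 - ρ * unitPt θ‖ + (1 - ρ) := by
    rw [e]
    refine (norm_sub_le _ _).trans ?_
    rw [norm_mul, norm_unitPt, Complex.norm_real, Real.norm_of_nonneg (by linarith), mul_one]
  have a2 := norm_sub_norm_le (1 : ℂ) (ρ * unitPt θ)
  rw [norm_mul, norm_unitPt, Complex.norm_real, Real.norm_of_nonneg h0, norm_one] at a2
  linarith

lemma norm_mul_unitPt {ρ : ℝ} (h0 : 0 ≤ ρ) (θ : ℝ) : ‖(ρ : ℂ) * unitPt θ‖ = ρ := by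
  rw [norm_mul, norm_unitPt, Complex.norm_real, Real.norm_of_nonneg h0, mul_one]

/-- An integrable majorant of `slitPow (-1/2)` near the unit circle. -/
noncomputable def slitBound (θ : ℝ) : ℝ :=
  (‖1 - unitPt θ‖ / 2) ^ (-(1 / 2) : ℝ) * (1 / 2) ^ (-(1 / 2) : ℝ)

lemma slitBound_nonneg (θ : ℝ) : 0 ≤ slitBound θ := by unfold slitBound; positivity

lemma norm_slitPow_neg_le {ρ θ : ℝ} (h0 : 0 ≤ ρ) (h1 : ρ ≤ 1) (h : θ ∈ J) :
    ‖slitPow (-(1 / 2)) (ρ * unitPt θ)‖ ≤ slitBound θ := by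
  have hp := norm_one_sub_unitPt_pos h
  have h2 := norm_one_sub_unitPt_le h0 h1 θ
  have h3 := sqrtTwoSubOne_mul_ne (z := ρ * unitPt θ) (by rwa [norm_mul_unitPt h0])
  have h4 := norm_sub_norm_le (1 : ℂ) (((β ^ 2 : ℝ) : ℂ) * (ρ * unitPt θ))
  rw [norm_one] at h4
  rw [norm_slitPow, slitBound]
  refine mul_le_mul ?_ ?_ (by positivity) (by positivity)
  · exact Real.rpow_le_rpow_of_nonpos (by linarith) (by linarith) (by norm_num)
  · exact Real.rpow_le_rpow_of_nonpos (by norm_num) (by linarith) (by norm_num)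

lemma norm_slitPow_half_le {ρ θ : ℝ} (h0 : 0 ≤ ρ) (h1 : ρ ≤ 1) :
    ‖slitPow (1 / 2) (ρ * unitPt θ)‖ ≤ 2 ^ (1 / 2 : ℝ) * 2 ^ (1 / 2 : ℝ) := by
  have h3 := sqrtTwoSubOne_mul_ne (z := ρ * unitPt θ) (by rwa [norm_mul_unitPt h0])
  have h4 := norm_sub_le (1 : ℂ) (((β ^ 2 : ℝ) : ℂ) * (ρ * unitPt θ))
  have h5 := norm_sub_le (1 : ℂ) (ρ * unitPt θ)
  rw [norm_one] at h4 h5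
  rw [norm_mul_unitPt h0] at h5
  rw [norm_slitPow]
  refine mul_le_mul ?_ ?_ (by positivity) (by positivity)
  · exact Real.rpow_le_rpow (by positivity) (by linarith) (by norm_num)
  · exact Real.rpow_le_rpow (by positivity) (by linarith) (by norm_num)

lemma integrableOn_slitBound : MeasureTheory.IntegrableOn slitBound J := by
  have hpi := Real.pi_pos
  unfold slitBound
  refine MeasureTheory.Integrable.mul_const ?_ _
  have hI : MeasureTheory.IntegrableOn
      (fun θ : ℝ => (1 / Real.pi) ^ (-(1 / 2) : ℝ) *
        (θ ^ (-(1 / 2) : ℝ) + (2 * Real.pi - θ) ^ (-(1 / 2) : ℝ))) J := by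
    refine MeasureTheory.Integrable.const_mul ?_ _
    have i1 : IntervalIntegrable (fun θ : ℝ => θ ^ (-(1 / 2) : ℝ)) MeasureTheory.volume 0
      (2 * Real.pi) := intervalIntegral.intervalIntegrable_rpow' (by norm_num)
    have i2 := i1.comp_sub_left (2 * Real.pi)
    rw [sub_zero, sub_self] at i2
    have i2 := i2.symm
    rw [intervalIntegrable_iff_integrableOn_Ioo_of_le (by positivity)] at i1 i2
    exact i1.add i2
  refine MeasureTheory.Integrable.mono' hI ?_ ?_
  · have := continuous_unitPt
    refine Measurable.aestronglyMeasurable ?_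
    refine Measurable.pow_const (Continuous.measurable ?_) _
    fun_prop
  · refine MeasureTheory.ae_restrict_of_forall_mem measurableSet_Ioo fun θ h => ?_
    have hp := norm_one_sub_unitPt_pos h
    have h1 := h.1
    have h2 : 0 < 2 * Real.pi - θ := by linarith [h.2]
    rw [Real.norm_of_nonneg (by positivity)]
    have key : ∀ t : ℝ, 0 < t → t ≤ Real.pi → Real.cos t = Real.cos θ →
        (‖1 - unitPt θ‖ / 2) ^ (-(1 / 2) : ℝ) ≤
          (1 / Real.pi) ^ (-(1 / 2) : ℝ) * t ^ (-(1 / 2) : ℝ) := by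
      intro t ht ht' hc
      rw [← Real.mul_rpow (by positivity) ht.le]
      refine Real.rpow_le_rpow_of_nonpos (by positivity) ?_ (by norm_num)
      have h3 := Real.cos_le_one_sub_mul_cos_sq (x := t) (by rwa [abs_of_pos ht])
      have h4 := norm_one_sub_unitPt_sq θ
      rw [← hc] at h4
      rw [← sq_le_sq₀ (by positivity) (by positivity), div_pow, h4, mul_pow, div_pow]
      rw [show 2 / Real.pi ^ 2 * t ^ 2 = 2 * (1 ^ 2 / Real.pi ^ 2 * t ^ 2) by ring] at h3
      linarith
    have n1 : 0 ≤ (1 / Real.pi) ^ (-(1 / 2) : ℝ) := by positivity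
    have n2 : 0 ≤ θ ^ (-(1 / 2) : ℝ) := by positivity
    have n3 : 0 ≤ (2 * Real.pi - θ) ^ (-(1 / 2) : ℝ) := by positivity
    rcases le_total θ Real.pi with h5 | h5
    · refine (key θ h1 h5 rfl).trans ?_
      gcongr
      linarith
    · refine (key (2 * Real.pi - θ) h2 (by linarith) (Real.cos_two_pi_sub θ)).trans ?_
      gcongr
      linarith

/-- The mean value property up to the unit circle. -/
lemma integral_unitPt_eq {f : ℂ → ℂ} {bound : ℝ → ℝ} (hf : ∀ z, ‖z‖ < 1 → DifferentiableAt ℂ f z)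
    (hb : ∀ ρ θ : ℝ, 0 ≤ ρ → ρ ≤ 1 → θ ∈ J → ‖f (ρ * unitPt θ)‖ ≤ bound θ)
    (hbound_int : MeasureTheory.IntegrableOn bound J)
    (hc : ∀ θ ∈ J, ContinuousAt f (unitPt θ)) :
    ∫ θ in J, f (unitPt θ) = 2 * Real.pi * f 0 := by
  have hpi := Real.pi_pos
  have havg : ∀ ρ : ℝ, 0 < ρ → ρ < 1 → ∫ θ in J, f (ρ * unitPt θ) = 2 * Real.pi * f 0 := by
    intro ρ h0 h1
    have h2 : DiffContOnCl ℂ f (Metric.ball 0 |ρ|) := by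
      refine DifferentiableOn.diffContOnCl fun z hz => (hf z ?_).differentiableWithinAt
      rw [abs_of_pos h0, closure_ball _ h0.ne', mem_closedBall_zero_iff] at hz
      linarith
    have h3 := h2.circleAverage
    rw [Real.circleAverage_def, intervalIntegral.integral_of_le (by positivity),
      MeasureTheory.integral_Ioc_eq_integral_Ioo] at h3
    have h4 : ∀ θ, circleMap 0 ρ θ = ρ * unitPt θ := fun θ => by
      rw [circleMap, zero_add]; rfl
    simp only [h4] at h3
    rw [← h3, Complex.real_smul]
    push_cast
    field_simp
  have hlim : Filter.Tendsto (fun ρ : ℝ => ∫ θ in J, f (ρ * unitPt θ)) (nhdsWithin 1 (Set.Iio 1))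
      (nhds (∫ θ in J, f (unitPt θ))) := by
    have hev : ∀ᶠ ρ : ℝ in nhdsWithin 1 (Set.Iio 1), 0 < ρ ∧ ρ < 1 :=
      (Filter.Eventually.filter_mono nhdsWithin_le_nhds (lt_mem_nhds zero_lt_one)).and
        self_mem_nhdsWithin
    refine MeasureTheory.tendsto_integral_filter_of_dominated_convergence bound ?_ ?_ hbound_int ?_
    · filter_upwards [hev] with ρ hρ
      refine Continuous.aestronglyMeasurable ?_
      rw [continuous_iff_continuousAt]
      intro θ
      refine ContinuousAt.comp (g := f) (f := fun θ : ℝ => (ρ : ℂ) * unitPt θ) ?_ ?_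
      · exact (hf _ (by rw [norm_mul_unitPt hρ.1.le]; exact hρ.2)).continuousAt
      · exact (continuous_const.mul continuous_unitPt).continuousAt
    · filter_upwards [hev] with ρ hρ
      exact MeasureTheory.ae_restrict_of_forall_mem measurableSet_Ioo fun θ h =>
        hb ρ θ hρ.1.le hρ.2.le h
    · refine MeasureTheory.ae_restrict_of_forall_mem measurableSet_Ioo fun θ h => ?_
      refine (hc θ h).tendsto.comp (Filter.Tendsto.mono_left ?_ nhdsWithin_le_nhds)
      have : ContinuousAt (fun ρ : ℝ => (ρ : ℂ) * unitPt θ) 1 := by fun_prop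
      simpa using this.tendsto
  refine tendsto_nhds_unique hlim (tendsto_const_nhds.congr' ?_)
  filter_upwards [(Filter.Eventually.filter_mono nhdsWithin_le_nhds
    (lt_mem_nhds (zero_lt_one (α := ℝ)))), self_mem_nhdsWithin] with ρ h0 h1
  exact (havg ρ h0 h1).symm

lemma integral_slitPow_neg_mul_pow (m : ℕ) :
    ∫ θ in J, slitPow (-(1 / 2)) (unitPt θ) * unitPt θ ^ m = 2 * Real.pi * 0 ^ m := by
  have := integral_unitPt_eq (f := fun z => slitPow (-(1 / 2)) z * z ^ m) (bound := slitBound)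
    (fun z hz => (differentiableAt_slitPow _ hz.le (by rintro rfl; simp at hz)).mul (by fun_prop))
    (fun ρ θ h0 h1 h => ?_) integrableOn_slitBound fun θ h =>
      ((differentiableAt_slitPow _ (norm_unitPt θ).le ?_).mul (by fun_prop)).continuousAt
  · rw [this, slitPow_zero, one_mul]
  · rw [norm_mul, norm_pow, norm_mul_unitPt h0]
    exact (mul_le_of_le_one_right (norm_nonneg _) (pow_le_one₀ h0 h1)).trans
      (norm_slitPow_neg_le h0 h1 h)
  · intro h1
    have := norm_one_sub_unitPt_pos h
    simp [h1] at this

lemma integral_slitPow_half_mul_pow (m : ℕ) :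
    ∫ θ in J, slitPow (1 / 2) (unitPt θ) * unitPt θ ^ m = 2 * Real.pi * 0 ^ m := by
  have := integral_unitPt_eq (f := fun z => slitPow (1 / 2) z * z ^ m)
    (bound := fun _ => 2 ^ (1 / 2 : ℝ) * 2 ^ (1 / 2 : ℝ))
    (fun z hz => (differentiableAt_slitPow _ hz.le (by rintro rfl; simp at hz)).mul (by fun_prop))
    (fun ρ θ h0 h1 h => ?_) (MeasureTheory.integrableOn_const measure_Ioo_lt_top.ne) fun θ h =>
      ((differentiableAt_slitPow _ (norm_unitPt θ).le ?_).mul (by fun_prop)).continuousAt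
  · rw [this, slitPow_zero, one_mul]
  · rw [norm_mul, norm_pow, norm_mul_unitPt h0]
    exact (mul_le_of_le_one_right (norm_nonneg _) (pow_le_one₀ h0 h1)).trans
      (norm_slitPow_half_le h0 h1)
  · intro h1
    have := norm_one_sub_unitPt_pos h
    simp [h1] at this

/-- The Fourier integrand of the Green function of the plane slit along the negative axis. -/
noncomputable def slitKernel (x y : ℤ) (θ : ℝ) : ℂ :=
  slitPow (-(1 / 2)) (unitPt θ) * (decay θ : ℂ) ^ y.natAbs * unitPt θ ^ (1 - x)

/-- The Green function with pole at `(1, 0)` of the plane slit along `{(x, 0) : x ≤ 0}`. -/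
noncomputable def slitGreen (x y : ℤ) : ℝ := β / (2 * Real.pi) * (∫ θ in J, slitKernel x y θ).re

lemma measurable_slitPow_unitPt (c : ℝ) : Measurable fun θ => slitPow c (unitPt θ) := by
  have := continuous_unitPt.measurable
  unfold slitPow
  fun_prop

lemma measurable_slitKernel (x y : ℤ) : Measurable (slitKernel x y) := by
  have h1 := continuous_unitPt.measurable
  have h2 := continuous_decay.measurable
  have h3 := measurable_slitPow_unitPt (-(1 / 2))
  have h4 : Measurable fun θ => unitPt θ ^ (1 - x) :=
    (continuous_unitPt.zpow₀ _ fun θ => Or.inl (unitPt_ne_zero θ)).measurable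
  unfold slitKernel
  fun_prop

lemma norm_slitPow_unitPt_le {θ : ℝ} (h : θ ∈ J) :
    ‖slitPow (-(1 / 2)) (unitPt θ)‖ ≤ slitBound θ := by
  simpa using norm_slitPow_neg_le zero_le_one le_rfl h

lemma norm_slitKernel_le {x y : ℤ} {θ : ℝ} (h : θ ∈ J) :
    ‖slitKernel x y θ‖ ≤ slitBound θ * decay θ ^ y.natAbs := by
  rw [slitKernel, norm_mul, norm_mul, norm_zpow, norm_unitPt, one_zpow, mul_one, norm_pow,
    Complex.norm_real, Real.norm_of_nonneg (decay_pos θ).le]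
  exact mul_le_mul_of_nonneg_right (norm_slitPow_unitPt_le h) (pow_nonneg (decay_pos θ).le _)

lemma integrableOn_slitBound_mul {f : ℝ → ℝ} (hf : Measurable f) (h0 : ∀ θ, |f θ| ≤ 1) :
    MeasureTheory.IntegrableOn (fun θ => slitBound θ * f θ) J := by
  refine MeasureTheory.Integrable.mul_bdd (c := 1) integrableOn_slitBound hf.aestronglyMeasurable ?_
  exact Filter.Eventually.of_forall h0

lemma abs_decay_pow_le (n : ℕ) (θ : ℝ) : |decay θ ^ n| ≤ 1 := by
  have := decay_pos θ
  rw [abs_of_nonneg (by positivity)]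
  exact pow_le_one₀ this.le (decay_le_one θ)

lemma integrableOn_slitBound_mul_pow (n : ℕ) :
    MeasureTheory.IntegrableOn (fun θ => slitBound θ * decay θ ^ n) J :=
  integrableOn_slitBound_mul (continuous_decay.measurable.pow_const n) (abs_decay_pow_le n)

lemma integrableOn_slitKernel (x y : ℤ) : MeasureTheory.IntegrableOn (slitKernel x y) J :=
  (integrableOn_slitBound_mul_pow y.natAbs).mono' (measurable_slitKernel x y).aestronglyMeasurable
    (MeasureTheory.ae_restrict_of_forall_mem measurableSet_Ioo fun _ h => norm_slitKernel_le h)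

lemma slitGreen_of_nonpos {x : ℤ} (hx : x ≤ 0) : slitGreen x 0 = 0 := by
  obtain ⟨m, hm⟩ : ∃ m : ℕ, 1 - x = (m + 1 : ℕ) := ⟨(-x).toNat, by omega⟩
  have : ∫ θ in J, slitKernel x 0 θ = 0 := by
    have := integral_slitPow_neg_mul_pow (m + 1)
    simp only [slitKernel, hm, zpow_natCast, Int.natAbs_zero, pow_zero, mul_one]
    rw [this]; simp
  rw [slitGreen, this]; simp

lemma slitGreen_tip : slitGreen 1 0 = β := by
  have hpi := Real.pi_pos
  have : ∫ θ in J, slitKernel 1 0 θ = (2 * Real.pi : ℝ) := by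
    have := integral_slitPow_neg_mul_pow 0
    simp only [slitKernel, sub_self, zpow_zero, Int.natAbs_zero, pow_zero, mul_one] at this ⊢
    rw [this]; push_cast; ring
  rw [slitGreen, this, Complex.ofReal_re]
  field_simp

lemma slitGreen_neg (x y : ℤ) : slitGreen x (-y) = slitGreen x y := by
  simp only [slitGreen, slitKernel, Int.natAbs_neg]

lemma slitGreen_lap_eq (x y : ℤ) :
    4 * slitGreen x y - slitGreen (x - 1) y - slitGreen (x + 1) y - slitGreen x (y + 1) -
      slitGreen x (y - 1) = β / (2 * Real.pi) * (∫ θ in J,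
        (4 * slitKernel x y θ - slitKernel (x - 1) y θ - slitKernel (x + 1) y θ -
          slitKernel x (y + 1) θ - slitKernel x (y - 1) θ)).re := by
  have i := integrableOn_slitKernel
  rw [MeasureTheory.integral_sub _ (i _ _), MeasureTheory.integral_sub _ (i _ _),
    MeasureTheory.integral_sub _ (i _ _), MeasureTheory.integral_sub _ (i _ _),
    MeasureTheory.integral_const_mul]
  · simp only [Complex.sub_re, slitGreen]
    have : (4 * ∫ θ in J, slitKernel x y θ).re = 4 * (∫ θ in J, slitKernel x y θ).re := by
      simp
    rw [this]; ring
  · exact (i _ _).const_mul 4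
  · exact ((i _ _).const_mul 4).sub (i _ _)
  · exact (((i _ _).const_mul 4).sub (i _ _)).sub (i _ _)
  · exact ((((i _ _).const_mul 4).sub (i _ _)).sub (i _ _)).sub (i _ _)

lemma slitKernel_horizontal (x y : ℤ) (θ : ℝ) :
    slitKernel (x - 1) y θ + slitKernel (x + 1) y θ = 2 * Real.cos θ * slitKernel x y θ := by
  have h0 := unitPt_ne_zero θ
  rw [slitKernel, slitKernel, slitKernel, ← unitPt_add_inv,
    show 1 - (x - 1) = (1 - x) + 1 by ring, show 1 - (x + 1) = (1 - x) - 1 by ring,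
    zpow_add_one₀ h0, zpow_sub_one₀ h0]
  ring

lemma decay_sq' (θ : ℝ) : (decay θ : ℂ) ^ 2 = (4 - 2 * Real.cos θ) * decay θ - 1 := by
  have := decay_sq θ
  exact_mod_cast congrArg (fun t : ℝ => (t : ℂ)) this

/-- `slitGreen` is the Green function of the simple random walk killed on the slit. -/
lemma slitGreen_lap {x y : ℤ} (h : y = 0 → 0 < x) :
    4 * slitGreen x y - slitGreen (x - 1) y - slitGreen (x + 1) y - slitGreen x (y + 1) -
      slitGreen x (y - 1) = if x = 1 ∧ y = 0 then 1 else 0 := by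
  have hpi := Real.pi_pos
  have hβ := sqrtTwoSubOne_pos
  rw [slitGreen_lap_eq]
  by_cases hy : y = 0
  · subst hy
    obtain ⟨m, hm⟩ : ∃ m : ℕ, x = m + 1 := ⟨(x - 1).toNat, by have := h rfl; omega⟩
    have e : ∫ θ in J, (4 * slitKernel x 0 θ - slitKernel (x - 1) 0 θ - slitKernel (x + 1) 0 θ -
          slitKernel x (0 + 1) θ - slitKernel x (0 - 1) θ) =
        ∫ θ in J, (β : ℂ)⁻¹ * conj (slitPow (1 / 2) (unitPt θ) * unitPt θ ^ m) := by
      refine MeasureTheory.setIntegral_congr_fun measurableSet_Ioo fun θ hθ => ?_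
      have h1 := slitKernel_horizontal x 0 θ
      have h2 := slitPow_neg_half_mul hθ
      have h3 : slitKernel x 0 θ = slitPow (-(1 / 2)) (unitPt θ) * unitPt θ ^ (-(m : ℤ)) := by
        rw [slitKernel, hm, show 1 - ((m : ℤ) + 1) = -m by ring]; simp
      have h4 : slitKernel x (0 + 1) θ = decay θ * slitKernel x 0 θ := by
        simp [slitKernel]; ring
      have h5 : slitKernel x (0 - 1) θ = decay θ * slitKernel x 0 θ := by
        simp [slitKernel]; ring
      have hβ' : (β : ℂ) ≠ 0 := by exact_mod_cast hβ.ne'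
      rw [map_mul, ← h2, map_pow, conj_unitPt, h4, h5, inv_pow, ← zpow_natCast, ← zpow_neg]
      have h6 : 4 * slitKernel x 0 θ - slitKernel (x - 1) 0 θ - slitKernel (x + 1) 0 θ =
        (4 - 2 * Real.cos θ) * slitKernel x 0 θ := by linear_combination -h1
      rw [h6, h3]
      push_cast
      field_simp
      ring
    rw [e, MeasureTheory.integral_const_mul, integral_conj, integral_slitPow_half_mul_pow]
    by_cases hm0 : m = 0
    · subst hm0
      rw [if_pos ⟨by omega, rfl⟩, pow_zero, mul_one]
      have : (β : ℂ)⁻¹ * conj (2 * (Real.pi : ℂ)) = ((β⁻¹ * (2 * Real.pi) : ℝ) : ℂ) := by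
        rw [map_mul, Complex.conj_ofReal, map_ofNat]; push_cast; simp
      rw [this, Complex.ofReal_re]
      field_simp
    · rw [if_neg (by omega)]
      simp [hm0]
  · rw [if_neg (by tauto)]
    have e : ∀ θ, 4 * slitKernel x y θ - slitKernel (x - 1) y θ - slitKernel (x + 1) y θ -
          slitKernel x (y + 1) θ - slitKernel x (y - 1) θ = 0 := by
      intro θ
      have h1 := slitKernel_horizontal x y θ
      have h6 : 4 * slitKernel x y θ - slitKernel (x - 1) y θ - slitKernel (x + 1) y θ =
        (4 - 2 * Real.cos θ) * slitKernel x y θ := by linear_combination -h1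
      have hd := decay_sq' θ
      obtain ⟨m, hm⟩ : ∃ m : ℕ, y.natAbs = m + 1 := ⟨y.natAbs - 1, by omega⟩
      have h7 : ((y + 1).natAbs = m + 2 ∧ (y - 1).natAbs = m) ∨
          ((y + 1).natAbs = m ∧ (y - 1).natAbs = m + 2) := by omega
      rw [h6]
      unfold slitKernel
      rw [hm]
      rcases h7 with ⟨h7, h8⟩ | ⟨h7, h8⟩ <;> rw [h7, h8] <;>
        linear_combination -(slitPow (-(1 / 2)) (unitPt θ) * (decay θ : ℂ) ^ m *
          unitPt θ ^ (1 - x)) * hd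
    simp [e]

lemma abs_slitGreen_le {x y : ℤ} {n : ℕ} (hn : n ≤ y.natAbs) :
    |slitGreen x y| ≤ ∫ θ in J, slitBound θ * decay θ ^ n := by
  have hpi := Real.pi_gt_three
  have hβ := sqrtTwoSubOne_pos
  have hβ2 := sqrtTwoSubOne_lt
  have h1 : ‖∫ θ in J, slitKernel x y θ‖ ≤ ∫ θ in J, slitBound θ * decay θ ^ n := by
    refine MeasureTheory.norm_integral_le_of_norm_le (integrableOn_slitBound_mul_pow n)
      (MeasureTheory.ae_restrict_of_forall_mem measurableSet_Ioo fun θ hθ =>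
        (norm_slitKernel_le hθ).trans ?_)
    exact mul_le_mul_of_nonneg_left
      (pow_le_pow_of_le_one (decay_pos θ).le (decay_le_one θ) hn) (slitBound_nonneg θ)
  have h2 := Complex.abs_re_le_norm (∫ θ in J, slitKernel x y θ)
  have h3 : β / (2 * Real.pi) ≤ 1 := by
    rw [div_le_one (by positivity)]; linarith
  rw [slitGreen, abs_mul, abs_of_pos (by positivity)]
  exact (mul_le_of_le_one_left (abs_nonneg _) h3).trans (h2.trans h1)

lemma tendsto_integral_slitBound_mul {f : ℕ → ℝ → ℝ} (hf : ∀ n, Measurable (f n))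
    (h0 : ∀ n θ, |f n θ| ≤ 1)
    (h1 : ∀ θ ∈ J, Filter.Tendsto (fun n => f n θ) Filter.atTop (nhds 0)) :
    Filter.Tendsto (fun n => ∫ θ in J, slitBound θ * f n θ) Filter.atTop (nhds 0) := by
  have h2 : ∫ θ in J, slitBound θ * 0 = 0 := by simp
  refine (congrArg nhds h2) ▸ MeasureTheory.tendsto_integral_of_dominated_convergence slitBound
    (fun n => (integrableOn_slitBound_mul (hf n) (h0 n)).aestronglyMeasurable)
    integrableOn_slitBound ?_ ?_
  · intro n
    refine Filter.Eventually.of_forall fun θ => ?_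
    rw [norm_mul, Real.norm_of_nonneg (slitBound_nonneg θ)]
    exact mul_le_of_le_one_right (slitBound_nonneg θ) (h0 n θ)
  · exact MeasureTheory.ae_restrict_of_forall_mem measurableSet_Ioo fun θ hθ =>
      (h1 θ hθ).const_mul _

lemma tendsto_slitGreen_row (y : ℤ) :
    Filter.Tendsto (fun x => slitGreen x y) Filter.cofinite (nhds 0) := by
  have hpi := Real.pi_pos
  set g : ℝ → ℂ := Set.indicator J (slitKernel 0 y) with hg
  have h1 := Real.tendsto_integral_exp_smul_cocompact g
  have h2 : Filter.Tendsto (fun x : ℤ => (x : ℝ) * (2 * Real.pi)⁻¹) Filter.cofinite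
      (Filter.cocompact ℝ) :=
    (Filter.tendsto_cocompact_mul_right₀ (by positivity)).comp Int.tendsto_coe_cofinite
  have h3 : ∀ x : ℤ, ∫ v : ℝ, 𝐞 (-(v * ((x : ℝ) * (2 * Real.pi)⁻¹))) • g v =
      ∫ θ in J, slitKernel x y θ := by
    intro x
    rw [← MeasureTheory.integral_indicator measurableSet_Ioo]
    congr 1
    funext θ
    by_cases hθ : θ ∈ J
    · rw [hg, Set.indicator_of_mem hθ, Set.indicator_of_mem hθ, Circle.smul_def,
        Real.fourierChar_apply,
        slitKernel, slitKernel, sub_eq_add_neg 1 x, zpow_add₀ (unitPt_ne_zero θ), sub_zero]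
      have : unitPt θ ^ (-x) =
          Complex.exp (((2 * Real.pi * -(θ * ((x : ℝ) * (2 * Real.pi)⁻¹)) : ℝ) : ℂ) * I) := by
        rw [unitPt, ← Complex.exp_int_mul]
        congr 1
        have : (Real.pi : ℂ) ≠ 0 := by exact_mod_cast hpi.ne'
        push_cast
        field_simp
      rw [← this, smul_eq_mul]
      ring
    · rw [hg, Set.indicator_of_notMem hθ, Set.indicator_of_notMem hθ, smul_zero]
  have h4 := h1.comp h2
  simp only [Function.comp_def, h3] at h4
  have h5 := ((Complex.continuous_re.tendsto 0).comp h4).const_mul (β / (2 * Real.pi))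
  rw [Complex.zero_re, mul_zero] at h5
  exact h5

/-- `slitGreen` tends to zero along columns, uniformly. -/
lemma slitGreen_eventually_le {ε : ℝ} (hε : 0 < ε) :
    ∀ᶠ x : ℤ in Filter.cofinite, ∀ y, |slitGreen x y| ≤ ε := by
  have h1 := tendsto_integral_slitBound_mul (f := fun n θ => decay θ ^ n)
    (fun n => continuous_decay.measurable.pow_const n) abs_decay_pow_le
    fun θ hθ => tendsto_pow_atTop_nhds_zero_of_lt_one (decay_pos θ).le (decay_lt_one hθ)
  obtain ⟨Y, hY⟩ := (h1.eventually (gt_mem_nhds hε)).exists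
  have h2 : ∀ᶠ x : ℤ in Filter.cofinite, ∀ y ∈ Finset.range Y, |slitGreen x (y : ℕ)| ≤ ε := by
    rw [Filter.eventually_all_finset]
    intro y _
    have := (tendsto_slitGreen_row y).abs
    rw [abs_zero] at this
    exact (this.eventually (gt_mem_nhds hε)).mono fun _ h => h.le
  filter_upwards [h2] with x hx y
  by_cases hy : Y ≤ y.natAbs
  · exact (abs_slitGreen_le hy).trans hY.le
  · have h3 := hx y.natAbs (by simpa using hy)
    rcases Int.natAbs_eq y with h | h
    · rw [h]; exact h3
    · rw [h, slitGreen_neg]; exact h3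

/-- A bound on the vertical differences of `slitGreen`. -/
noncomputable def slitFlux (n : ℕ) : ℝ := ∫ θ in J, slitBound θ * (decay θ ^ n * (1 - decay θ))

lemma abs_slitGreen_sub_le (x : ℤ) (n : ℕ) :
    |slitGreen x (n + 1) - slitGreen x n| ≤ slitFlux n := by
  have hpi := Real.pi_gt_three
  have hβ := sqrtTwoSubOne_pos
  have hβ2 := sqrtTwoSubOne_lt
  have h3 : β / (2 * Real.pi) ≤ 1 := by
    rw [div_le_one (by positivity)]; linarith
  rw [slitGreen, slitGreen, ← mul_sub, ← Complex.sub_re, ← MeasureTheory.integral_sub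
    (integrableOn_slitKernel _ _) (integrableOn_slitKernel _ _), abs_mul,
    abs_of_pos (by positivity)]
  refine (mul_le_of_le_one_left (abs_nonneg _) h3).trans ((Complex.abs_re_le_norm _).trans ?_)
  have hm : ∀ θ, |decay θ ^ n * (1 - decay θ)| ≤ 1 := by
    intro θ
    have := decay_pos θ
    have := decay_le_one θ
    rw [abs_mul, abs_of_nonneg (show 0 ≤ 1 - decay θ by linarith)]
    exact mul_le_one₀ (abs_decay_pow_le n θ) (by linarith) (by linarith)
  refine MeasureTheory.norm_integral_le_of_norm_le (integrableOn_slitBound_mul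
    ((continuous_decay.pow n).mul (continuous_const.sub continuous_decay)).measurable hm)
    (MeasureTheory.ae_restrict_of_forall_mem measurableSet_Ioo fun θ hθ => ?_)
  have e : slitKernel x (n + 1) θ - slitKernel x n θ =
      slitKernel x n θ * ((decay θ - 1 : ℝ) : ℂ) := by
    have : ((n : ℤ) + 1).natAbs = n + 1 := by omega
    rw [slitKernel, slitKernel, this, Int.natAbs_natCast]
    push_cast; ring
  rw [e, norm_mul, Complex.norm_real, Real.norm_of_nonpos (by linarith [decay_le_one θ]), neg_sub,
    ← mul_assoc]
  exact mul_le_mul_of_nonneg_right (norm_slitKernel_le hθ) (by linarith [decay_le_one θ])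

lemma tendsto_slitFlux :
    Filter.Tendsto (fun n : ℕ => (n : ℝ) * slitFlux n) Filter.atTop (nhds 0) := by
  have h := tendsto_integral_slitBound_mul (f := fun n θ => n * (decay θ ^ n * (1 - decay θ)))
    (fun n => (continuous_const.mul
      ((continuous_decay.pow n).mul (continuous_const.sub continuous_decay))).measurable) ?_ ?_
  · refine h.congr fun n => ?_
    rw [slitFlux, ← MeasureTheory.integral_const_mul]
    congr 1
    funext θ
    ring
  · intro n θ
    have h0 := decay_pos θ
    have h1 := decay_le_one θ
    rw [abs_of_nonneg (mul_nonneg (by positivity) (mul_nonneg (by positivity) (by linarith)))]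
    have h2 : n * decay θ ^ n ≤ ∑ i ∈ Finset.range n, decay θ ^ i := by
      have := Finset.card_nsmul_le_sum (Finset.range n) (fun i => decay θ ^ i) (decay θ ^ n)
        fun i hi => pow_le_pow_of_le_one h0.le h1 (Finset.mem_range.1 hi).le
      simpa using this
    have h3 := mul_neg_geom_sum (decay θ) n
    have h4 := pow_pos h0 n
    nlinarith
  · intro θ hθ
    have := tendsto_self_mul_const_pow_of_lt_one (decay_pos θ).le (decay_lt_one hθ)
    have := this.mul_const (1 - decay θ)
    simpa [mul_assoc] using this

end SlitGreen

section TipLimit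

lemma slitFlux_nonneg (n : ℕ) : 0 ≤ slitFlux n :=
  (abs_nonneg _).trans (abs_slitGreen_sub_le 0 n)

lemma abs_stripLap_slitGreen_le {n : ℕ} (t x y : ℤ) (hy : -(n : ℤ) ≤ y) (hy' : y ≤ n) (hn : 1 ≤ n)
    (h : y = 0 → t < x) :
    |stripLap n (fun x y => slitGreen (x - t) y) x y - (if x = t + 1 ∧ y = 0 then 1 else 0)| ≤
      if y = n ∨ y = -(n : ℤ) then slitFlux n else 0 := by
  have h1 := slitGreen_lap (x := x - t) (y := y) (fun h0 => by have := h h0; omega)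
  have h2 : (x - t = 1 ∧ y = 0) ↔ (x = t + 1 ∧ y = 0) := by omega
  simp only [h2] at h1
  rw [← h1, stripLap, show x - 1 - t = x - t - 1 by ring, show x + 1 - t = x - t + 1 by ring]
  by_cases hN : y = n
  · subst hN
    have h3 := abs_slitGreen_sub_le (x - t) n
    rw [if_neg (lt_irrefl _), if_pos (by omega), if_pos (Or.inl rfl)]
    convert h3 using 2
    ring
  · by_cases hN' : y = -(n : ℤ)
    · subst hN'
      have h3 := abs_slitGreen_sub_le (x - t) n
      rw [if_pos (by omega), if_neg (lt_irrefl _), if_pos (Or.inr rfl)]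
      rw [show -(n : ℤ) - 1 = -(n + 1) by ring, slitGreen_neg _ ((n : ℤ) + 1),
        slitGreen_neg _ (n : ℤ)]
      convert h3 using 2
      ring
    · rw [if_pos (by omega), if_pos (by omega), if_neg (by tauto)]
      refine le_of_eq (abs_eq_zero.2 ?_)
      ring

/-- A nonnegative barrier whose Laplacian is supported on the horizontal sides of the box. -/
noncomputable def sideBarrier (n : ℕ) (x y : ℤ) : ℝ :=
  slitFlux n / (2 * n + 1) * ((y : ℝ) ^ 2 - (x : ℝ) ^ 2 + ((n : ℝ) + 1) ^ 2)

lemma stripLap_sideBarrier {n : ℕ} (hn : 1 ≤ n) (x y : ℤ) (hy : -(n : ℤ) ≤ y) (hy' : y ≤ n) :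
    stripLap n (sideBarrier n) x y = if y = n ∨ y = -(n : ℤ) then slitFlux n else 0 := by
  have h0 : (2 * (n : ℝ) + 1) ≠ 0 := by positivity
  unfold stripLap sideBarrier
  by_cases hN : y = n
  · subst hN
    rw [if_neg (lt_irrefl _), if_pos (by omega), if_pos (Or.inl rfl)]
    push_cast
    field_simp
    ring
  · by_cases hN' : y = -(n : ℤ)
    · subst hN'
      rw [if_pos (by omega), if_neg (lt_irrefl _), if_pos (Or.inr rfl)]
      push_cast
      field_simp
      ring
    · rw [if_pos (by omega), if_pos (by omega), if_neg (by tauto)]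
      push_cast
      ring

lemma sideBarrier_nonneg {n : ℕ} {x y : ℤ} (hx : -(n : ℤ) - 1 ≤ x) (hx' : x ≤ n + 1) :
    0 ≤ sideBarrier n x y := by
  refine mul_nonneg (div_nonneg (slitFlux_nonneg n) (by positivity)) ?_
  have h1 : (-(n : ℝ) - 1) ≤ x := by exact_mod_cast hx
  have h2 : (x : ℝ) ≤ n + 1 := by exact_mod_cast hx'
  nlinarith [sq_nonneg (y : ℝ)]

lemma sideBarrier_axis_le {n : ℕ} (hn : 1 ≤ n) (x : ℤ) :
    sideBarrier n x 0 ≤ 2 * (n * slitFlux n) := by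
  have h1 : (1 : ℝ) ≤ n := by exact_mod_cast hn
  have h2 := slitFlux_nonneg n
  have h3 : (0 : ℝ) < 2 * n + 1 := by positivity
  rw [sideBarrier, div_mul_eq_mul_div, div_le_iff₀ h3]
  push_cast
  have h4 : (0 : ℝ) ^ 2 - (x : ℝ) ^ 2 + ((n : ℝ) + 1) ^ 2 ≤ 2 * n * (2 * n + 1) := by
    nlinarith [sq_nonneg (x : ℝ)]
  nlinarith [mul_le_mul_of_nonneg_left h4 h2]

lemma abs_tipGreen_sub_slitGreen_le {n : ℕ} (hn : 1 ≤ n) {t : ℤ} {ε : ℝ} (hε : 0 ≤ ε)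
    (hl : ∀ y, |slitGreen (-(n : ℤ) - 1 - t) y| ≤ ε) (hr : ∀ y, |slitGreen ((n : ℤ) + 1 - t) y| ≤ ε)
    {x y : ℤ} (hx : -(n : ℤ) - 1 ≤ x) (hx' : x ≤ n + 1) (hy : -(n : ℤ) ≤ y) (hy' : y ≤ n) :
    |tipGreen n (-n - 1) (n + 1) t x y - slitGreen (x - t) y| ≤ ε + sideBarrier n x y := by
  set F : ℤ → ℤ → ℝ := fun x y => slitGreen (x - t) y with hF
  set G : ℤ → ℤ → ℝ := tipGreen n (-n - 1) (n + 1) t with hG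
  have hlap : ∀ x y, (x, y) ∈ slitDomain (n : ℤ) (-n - 1) (n + 1) t →
      |stripLap n F x y - stripLap n G x y| ≤ stripLap n (sideBarrier n) x y := by
    intro x y h
    rw [hG, stripLap_tipGreen h]
    rw [mem_slitDomain] at h
    rw [stripLap_sideBarrier hn x y h.2.1.1 h.2.1.2]
    exact abs_stripLap_slitGreen_le t x y h.2.1.1 h.2.1.2 hn h.2.2
  have hconst : ∀ x y, stripLap (n : ℤ) (fun x y => ε + sideBarrier n x y) x y =
      stripLap n (sideBarrier n) x y := by
    intro x y
    simp [stripLap]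
  have hbd : ∀ x y, -(n : ℤ) - 1 ≤ x → x ≤ n + 1 → -(n : ℤ) ≤ y → y ≤ n →
      (x, y) ∉ slitDomain (n : ℤ) (-n - 1) (n + 1) t →
      |F x y - G x y| ≤ ε + sideBarrier n x y := by
    intro x y hx hx' hy hy' h
    have hs := sideBarrier_nonneg (y := y) hx hx'
    rw [hG, tipGreen_of_notMem h, sub_zero]
    have hF' : |F x y| ≤ ε := by
      rw [mem_slitDomain] at h
      by_cases h1 : x = -(n : ℤ) - 1
      · rw [h1]; exact hl y
      · by_cases h2 : x = n + 1
        · rw [h2]; exact hr y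
        · have h3 : y = 0 ∧ x ≤ t := by omega
          rw [hF]
          simp only [h3.1]
          rw [slitGreen_of_nonpos (by omega), abs_zero]
          exact hε
    linarith
  have h1 : G x y - F x y ≤ ε + sideBarrier n x y := by
    refine le_of_stripLap_le (N := n) (F := fun x y => G x y - F x y) (t := t) (a := -n - 1)
      (b := n + 1) (G := fun x y => ε + sideBarrier n x y) ?_ ?_ hx hx' hy hy'
    · intro x y h
      rw [hconst, stripLap_sub]
      exact (abs_le.1 (hlap x y h)).1 |> fun h => by linarith
    · intro x y h1 h2 h3 h4 h
      have := (abs_le.1 (hbd x y h1 h2 h3 h4 h)).1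
      linarith
  have h2 : F x y - G x y ≤ ε + sideBarrier n x y := by
    refine le_of_stripLap_le (N := n) (F := fun x y => F x y - G x y) (t := t) (a := -n - 1)
      (b := n + 1) (G := fun x y => ε + sideBarrier n x y) ?_ ?_ hx hx' hy hy'
    · intro x y h
      rw [hconst, stripLap_sub]
      exact (abs_le.1 (hlap x y h)).2
    · intro x y h1 h2 h3 h4 h
      exact (abs_le.1 (hbd x y h1 h2 h3 h4 h)).2
  exact abs_le.2 ⟨by linarith, h1⟩

lemma tendsto_tipGreen (t : ℤ) :
    Filter.Tendsto (fun n : ℕ => tipGreen n (-n - 1) (n + 1) t (t + 1) 0) Filter.atTop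
      (nhds (Real.sqrt 2 - 1)) := by
  rw [Metric.tendsto_atTop']
  intro δ hδ
  have hε : 0 < δ / 2 := by positivity
  have hl : ∀ᶠ n : ℕ in Filter.atTop, ∀ y, |slitGreen (-(n : ℤ) - 1 - t) y| ≤ δ / 2 := by
    have hi : Function.Injective fun n : ℕ => -(n : ℤ) - 1 - t := fun a b h => by
      simp only at h; omega
    have := hi.tendsto_cofinite.eventually (slitGreen_eventually_le hε)
    rwa [Nat.cofinite_eq_atTop] at this
  have hr : ∀ᶠ n : ℕ in Filter.atTop, ∀ y, |slitGreen ((n : ℤ) + 1 - t) y| ≤ δ / 2 := by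
    have hi : Function.Injective fun n : ℕ => (n : ℤ) + 1 - t := fun a b h => by
      simp only at h; omega
    have := hi.tendsto_cofinite.eventually (slitGreen_eventually_le hε)
    rwa [Nat.cofinite_eq_atTop] at this
  have hf : ∀ᶠ n : ℕ in Filter.atTop, (n : ℝ) * slitFlux n < δ / 4 :=
    tendsto_slitFlux.eventually_lt_const (by positivity)
  have hev : ∀ᶠ n : ℕ in Filter.atTop,
      dist (tipGreen n (-n - 1) (n + 1) t (t + 1) 0) (Real.sqrt 2 - 1) < δ := by
    filter_upwards [hl, hr, hf, Filter.eventually_ge_atTop (t.natAbs + 1)] with n hl hr hf hn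
    have h1 := abs_tipGreen_sub_slitGreen_le (by omega) hε.le hl hr (x := t + 1) (y := 0)
      (by omega) (by omega) (by omega) (by omega)
    rw [add_sub_cancel_left, slitGreen_tip] at h1
    have h2 := sideBarrier_axis_le (n := n) (by omega) (t + 1)
    rw [Real.dist_eq]
    change |_ - sqrtTwoSubOne| < δ
    linarith
  obtain ⟨N, hN⟩ := Filter.eventually_atTop.1 hev
  exact ⟨N, fun n hn => hN n hn.le⟩

end TipLimit

lemma tendsto_runCount_ratio (k : ℕ) :
    Filter.Tendsto (fun n : ℕ => runCount n k / runCount n 0) Filter.atTop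
      (nhds ((Real.sqrt 2 - 1) ^ k)) := by
  induction k with
  | zero =>
    rw [pow_zero]
    refine tendsto_const_nhds.congr' ?_
    filter_upwards [Filter.eventually_ge_atTop 1] with n hn
    rw [div_self (runCount_zero_pos hn).ne']
  | succ k ih =>
    have h := (ih.mul (tendsto_tipGreen k)).mul (tendsto_wallMeasure_ratio k)
    rw [mul_one, ← pow_succ] at h
    refine h.congr' ?_
    filter_upwards [Filter.eventually_ge_atTop (k + 2)] with n hn
    have h1 := runCount_succ_mul hn
    have h2 : 0 < wallMeasure n (-n - 1) (n + 1) k (k + 1) 0 :=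
      wallMeasure_tip_pos (by omega) (by omega) (by omega)
    have h3 := runCount_zero_pos (n := n) (by omega)
    field_simp
    linear_combination -h1

end TrunkRuns

/-- Geometric runs for the square-lattice spanning tree trunk: the proportion, among
spanning trees of `G_n` whose trunk contains `e₀`, of those whose trunk contains all
of `e₀, e₁, …, e_k`, converges to `(√2 - 1)^k` as `n → ∞`. -/
theorem trunk_geometric_runs (k : ℕ) :
    Filter.Tendsto
      (fun n : ℕ =>
        (Nat.card {T : (gridGraph n).Subgraph //
            IsSpanningTree n T ∧ ∀ j ≤ k, TrunkContains n T (hEdge j)} : ℝ) /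
          (Nat.card {T : (gridGraph n).Subgraph //
            IsSpanningTree n T ∧ TrunkContains n T (hEdge 0)} : ℝ))
      Filter.atTop (nhds ((Real.sqrt 2 - 1) ^ k)) := by
  classical
  refine (TrunkRuns.tendsto_runCount_ratio k).congr' ?_
  filter_upwards [Filter.eventually_ge_atTop (k + 1)] with n hn
  have h0 := TrunkRuns.card_trunkContains_eq_det (n := n) (k := 0) (by omega)
  simp only [Nat.le_zero, forall_eq] at h0
  rw [TrunkRuns.card_trunkContains_eq_det hn, h0, TrunkRuns.runCount, TrunkRuns.runCount]
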